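/- Let d, x, y, z be non-negative integers with 14 ≤ d ≤ 40. Then the linear system L_3(d; 4^{×x}, 3^{×y}, 2^{×z}) is non-special; that is, there exist pairwise linearly independent points p_1,...,p_{x+y+z} ∈ ℚ^4 \ {0} such that the space of homogeneous polynomials of degree d in 4 variables over ℚ vanishing to order ≥ 4 at the first x points, ≥ 3 at the next y points, and ≥ 2 at the last z points has dimension exactly max(C(d+3,3) − 20x − 10y − 4z, 0). -/

import Mathlib

open MvPolynomial

/-- The differential operator `∂₀^{ν 0} ∂₁^{ν 1} ∂₂^{ν 2} ∂₃^{ν 3}` on polynomials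
in 4 variables over `ℚ`. -/
noncomputable def diffOp (ν : Fin 4 → ℕ) :
    Module.End ℚ (MvPolynomial (Fin 4) ℚ) :=
  ((pderiv (0 : Fin 4)).toLinearMap ^ ν 0) * ((pderiv (1 : Fin 4)).toLinearMap ^ ν 1) *
    ((pderiv (2 : Fin 4)).toLinearMap ^ ν 2) * ((pderiv (3 : Fin 4)).toLinearMap ^ ν 3)

/-- Polynomials all of whose partial derivatives of order `< m` (including order 0)
vanish at the point `pt : ℚ⁴`. -/
noncomputable def vanishingSpace (m : ℕ) (pt : Fin 4 → ℚ) :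
    Submodule ℚ (MvPolynomial (Fin 4) ℚ) :=
  ⨅ (ν : Fin 4 → ℕ) (_ : ∑ j, ν j < m),
    LinearMap.ker ((aeval pt).toLinearMap ∘ₗ
      (diffOp ν : MvPolynomial (Fin 4) ℚ →ₗ[ℚ] MvPolynomial (Fin 4) ℚ))

/-- `V(d; m_1,…,m_r; p_1,…,p_r)`: homogeneous polynomials of degree `d` in 4 variables
over `ℚ` vanishing to order `≥ ms[i]` at `pts i` for each `i`. -/
noncomputable def systemSpace (d : ℕ) (ms : List ℕ) (pts : Fin ms.length → Fin 4 → ℚ) :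
    Submodule ℚ (MvPolynomial (Fin 4) ℚ) :=
  homogeneousSubmodule (Fin 4) ℚ d ⊓ ⨅ i, vanishingSpace (ms.get i) (pts i)

/-- The virtual dimension `vdim L_3(d; m_1,…,m_r) = C(d+3,3) − Σ C(m_i+2,3) − 1`. -/
def vdim (d : ℕ) (ms : List ℕ) : ℤ :=
  ((d + 3).choose 3 : ℤ) - (ms.map fun m => ((m + 2).choose 3 : ℤ)).sum - 1

/-- The linear system `L_3(d; m_1,…,m_r)` is non-special: there exist pairwise linearly
independent points of `ℚ⁴ \ {0}` at which the space of degree-`d` homogeneous polynomials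
with the prescribed multiplicities has dimension `max (vdim + 1) 0`
(the expected dimension). -/
noncomputable def nonSpecial (d : ℕ) (ms : List ℕ) : Prop :=
  ∃ pts : Fin ms.length → Fin 4 → ℚ,
    (∀ i, pts i ≠ 0) ∧
    (∀ i j, i ≠ j → LinearIndependent ℚ ![pts i, pts j]) ∧
    (Module.finrank ℚ (systemSpace d ms pts) : ℤ) = max (vdim d ms + 1) 0

/-! ### Part 1: interpolation on finite sets of lattice points -/

namespace NS

open Finset Topology Filter

/-- exponent vectors -/
abbrev Lat := ℕ × ℕ × ℕ

/-- `FI J S g`: the matrix `g` (rows `J`, columns `S`) has trivial kernel -/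
def FI {κ ι : Type} (J : Finset κ) (S : Finset ι) (g : κ → ι → ℚ) : Prop :=
  ∀ u : ι → ℚ, (∀ j ∈ J, ∑ b ∈ S, g j b * u b = 0) → ∀ b ∈ S, u b = 0

/-- the restricted matrix -/
def mat {κ ι : Type} (J : Finset κ) (S : Finset ι) (g : κ → ι → ℚ) : Matrix J S ℚ :=
  fun j b => g j b

lemma FI_iff {κ ι : Type} (J : Finset κ) (S : Finset ι) (g : κ → ι → ℚ) :
    FI J S g ↔ Function.Injective (mat J S g).mulVecLin := by
  classical
  rw [← LinearMap.ker_eq_bot, LinearMap.ker_eq_bot']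
  constructor
  · intro h u hu
    have := h (fun b => if hb : b ∈ S then u ⟨b, hb⟩ else 0) (by
      intro j hj
      have h2 := congrFun hu ⟨j, hj⟩
      simp only [Matrix.mulVecLin_apply, Matrix.mulVec, dotProduct, mat, Pi.zero_apply] at h2
      rw [← Finset.sum_coe_sort]
      rw [← h2]
      refine Finset.sum_congr rfl fun b _ => ?_
      simp)
    funext b
    have h3 := this b b.2
    simpa using h3
  · intro h u hu b hb
    have := h (fun b => u b) (by
      funext j
      have h2 := hu j j.2
      rw [← Finset.sum_coe_sort] at h2
      simpa [Matrix.mulVec, dotProduct, mat] using h2)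
    exact congrFun this ⟨b, hb⟩

lemma FI_perturb {κ ι : Type} (J : Finset κ) (S : Finset ι) (g : ℚ → κ → ι → ℚ)
    (hc : ∀ j b, Continuous fun s => g s j b) (h0 : FI J S (g 0)) :
    ∀ᶠ s in 𝓝 (0 : ℚ), FI J S (g s) := by
  classical
  rw [FI_iff] at h0
  obtain ⟨H, hH⟩ := LinearMap.exists_leftInverse_of_injective _ (LinearMap.ker_eq_bot.2 h0)
  set h := LinearMap.toMatrix' H with hh
  have e1 : h * mat J S (g 0) = 1 := by
    have : LinearMap.toMatrix' (H ∘ₗ (mat J S (g 0)).mulVecLin) = 1 := by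
      rw [hH]; exact LinearMap.toMatrix'_id
    rw [LinearMap.toMatrix'_comp] at this
    have e2 : LinearMap.toMatrix' (mat J S (g 0)).mulVecLin = mat J S (g 0) :=
      LinearMap.toMatrix'_toLin' _
    rwa [e2] at this
  have cont : Continuous fun s => (h * mat J S (g s)).det := by
    apply Continuous.matrix_det
    apply Continuous.matrix_mul continuous_const
    refine continuous_matrix fun j b => ?_
    exact hc _ _
  have : ∀ᶠ s in 𝓝 (0 : ℚ), (h * mat J S (g s)).det ≠ 0 := by
    apply cont.continuousAt.eventually_ne
    rw [e1]; simp
  filter_upwards [this] with s hs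
  rw [FI_iff]
  have : Function.Injective (h * mat J S (g s)).mulVec := by
    apply Matrix.mulVec_injective_of_isUnit
    rw [Matrix.isUnit_iff_isUnit_det]
    exact isUnit_iff_ne_zero.2 hs
  intro a b hab
  apply this
  simp only [Matrix.mulVecLin_apply] at hab
  rw [← Matrix.mulVec_mulVec, ← Matrix.mulVec_mulVec, hab]

/-- square case -/
lemma FI_swap {κ ι : Type} (J : Finset κ) (S : Finset ι) (g : κ → ι → ℚ)
    (hcard : J.card = S.card) (h : FI J S g) : FI S J (fun b j => g j b) := by
  classical
  rw [FI_iff] at h ⊢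
  have e : mat S J (fun b j => g j b) = (mat J S g).transpose := rfl
  have hr : (mat J S g).rank = S.card := by
    rw [Matrix.rank, LinearMap.finrank_range_of_inj h]; simp
  have hr2 : (mat S J (fun b j => g j b)).rank = J.card := by
    rw [e, Matrix.rank_transpose, hr, hcard]
  have h3 := LinearMap.finrank_range_add_finrank_ker (mat S J (fun b j => g j b)).mulVecLin
  rw [Matrix.rank] at hr2
  rw [hr2] at h3
  have h4 : Module.finrank ℚ (J → ℚ) = J.card := by simp
  rw [h4] at h3
  rw [← LinearMap.ker_eq_bot]
  apply Submodule.finrank_eq_zero.1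
  omega

/-- derivative conditions of a point of multiplicity `m` -/
def AL (m : ℕ) : Finset Lat :=
  (range m ×ˢ range m ×ˢ range m).filter fun a => a.1 + a.2.1 + a.2.2 < m

lemma mem_AL {m : ℕ} {a : Lat} : a ∈ AL m ↔ a.1 + a.2.1 + a.2.2 < m := by
  simp only [AL, mem_filter, mem_product, mem_range]
  omega

/-- points of the torus -/
abbrev Pt := ℚ × ℚ × ℚ

/-- value of a monomial -/
def mon (P : Pt) (b : Lat) : ℚ := P.1 ^ b.1 * P.2.1 ^ b.2.1 * P.2.2 ^ b.2.2

/-- the polynomial factor -/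
def pol (a b : Lat) : ℚ := (b.1 : ℚ) ^ a.1 * (b.2.1 : ℚ) ^ a.2.1 * (b.2.2 : ℚ) ^ a.2.2

/-- nonvanishing coordinates -/
def NZ (P : Pt) : Prop := P.1 ≠ 0 ∧ P.2.1 ≠ 0 ∧ P.2.2 ≠ 0

/-- the set of conditions -/
def JJ {I : Type} [Fintype I] (m : I → ℕ) : Finset (Σ _ : I, Lat) := univ.sigma fun i => AL (m i)

/-- the interpolation matrix -/
def GG {I : Type} (P : I → Pt) (j : Σ _ : I, Lat) (b : Lat) : ℚ := mon (P j.1) b * pol j.2 b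

/-- injectivity -/
def Inj (S : Finset Lat) (ms : Multiset ℕ) : Prop :=
  ∃ (I : Type) (_ : Fintype I) (m : I → ℕ) (P : I → Pt), univ.val.map m = ms ∧ (∀ i, NZ (P i)) ∧
    FI (JJ m) S (GG P)

/-- surjectivity -/
def Surj (S : Finset Lat) (ms : Multiset ℕ) : Prop :=
  ∃ (I : Type) (_ : Fintype I) (m : I → ℕ) (P : I → Pt), univ.val.map m = ms ∧ (∀ i, NZ (P i)) ∧
    FI S (JJ m) (fun b j => GG P j b)

lemma exists_le_map {α : Type} (m : α → ℕ) (s : Multiset α) (t : Multiset ℕ) (h : t ≤ s.map m) :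
    ∃ s' ≤ s, s'.map m = t := by
  induction s using Quotient.inductionOn with | _ l => ?_
  induction t using Quotient.inductionOn with | _ k => ?_
  obtain ⟨k', hk, hs⟩ : k.Subperm (l.map m) := by simpa using h
  obtain ⟨l', hl, rfl⟩ := List.sublist_map_iff.1 hs
  refine ⟨(l' : Multiset α), ?_, ?_⟩
  · exact Multiset.coe_le.2 hl.subperm
  · simpa using hk

lemma Surj.mono {S : Finset Lat} {ms ms' : Multiset ℕ} (h : Surj S ms) (hle : ms' ≤ ms) :
    Surj S ms' := by
  classical
  obtain ⟨I, _, m, P, hm, hP, hF⟩ := h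
  rw [← hm] at hle
  obtain ⟨s, hs, rfl⟩ := exists_le_map m _ _ hle
  have hnd : s.Nodup := Multiset.nodup_of_le hs univ.nodup
  let F : Finset I := ⟨s, hnd⟩
  refine ⟨F, inferInstance, fun i => m i, fun i => P i, ?_, fun i => hP _, ?_⟩
  · have : (univ : Finset F).val.map (Subtype.val : {x // x ∈ F} → I) = s := by
      have := Finset.attach_map_val (s := F)
      have h2 := congrArg Finset.val this
      simpa [F] using h2
    conv_rhs => rw [← this]
    rw [Multiset.map_map]; rfl
  · intro c hc j hj
    let c' : (Σ _ : I, Lat) → ℚ := fun j => if h : j.1 ∈ F then c ⟨⟨j.1, h⟩, j.2⟩ else 0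
    have := hF c' (by
      intro b hb
      rw [← hc b hb]
      simp only [JJ, Finset.sum_sigma]
      rw [Finset.univ_eq_attach, ← Finset.sum_subset (Finset.subset_univ F)]
      · rw [← Finset.sum_attach F]
        refine Finset.sum_congr rfl fun i _ => Finset.sum_congr rfl fun a _ => ?_
        simp [c', GG]
      · intro i _ hi
        refine Finset.sum_eq_zero fun a _ => ?_
        simp [c', hi]) ⟨j.1, j.2⟩ (by simpa [JJ] using hj)
    simpa [c'] using this

lemma Inj.mono {S : Finset Lat} {ms ms' : Multiset ℕ} (h : Inj S ms) (hle : ms ≤ ms') :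
    Inj S ms' := by
  classical
  obtain ⟨I, _, m, P, hm, hP, hF⟩ := h
  obtain ⟨t, rfl⟩ := Multiset.le_iff_exists_add.1 hle
  induction t using Quotient.inductionOn with | _ l => ?_
  refine ⟨I ⊕ Fin l.length, inferInstance, Sum.elim m l.get, Sum.elim P (fun _ => (1, 1, 1)), ?_, ?_, ?_⟩
  · rw [← hm]
    show Multiset.map _ (Multiset.disjSum _ _) = _
    simp [Multiset.disjSum, Multiset.map_map]
  · rintro (i | i)
    · exact hP i
    · simp [NZ]
  · intro u hu
    apply hF u
    intro j hj
    have := hu ⟨Sum.inl j.1, j.2⟩ (by simpa [JJ] using hj)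
    simpa [GG] using this

lemma card_JJ {I : Type} [Fintype I] (m : I → ℕ) :
    (JJ m).card = ((univ.val.map m).map fun m => (AL m).card).sum := by
  rw [JJ, Finset.card_sigma, Multiset.map_map]; rfl

/-- conditions imposed by a multiset of multiplicities -/
def wt (ms : Multiset ℕ) : ℕ := (ms.map fun m => (AL m).card).sum

lemma Inj.surj {S : Finset Lat} {ms : Multiset ℕ} (h : Inj S ms) (hc : wt ms = S.card) :
    Surj S ms := by
  obtain ⟨I, _, m, P, hm, hP, hF⟩ := h
  refine ⟨I, _, m, P, hm, hP, FI_swap _ _ _ ?_ hF⟩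
  rw [card_JJ, hm]; exact hc

end NS

/-! ### Part 2: cutting and the distribution of the multiplicities -/

namespace NS

open Finset Topology Filter

lemma FI_block {κ ι : Type} [DecidableEq κ] [DecidableEq ι] (J1 J2 : Finset κ) (A C : Finset ι)
    (hd : Disjoint A C) (g : κ → ι → ℚ) (h1 : FI J1 A g) (h2 : FI J2 C g)
    (h0 : ∀ j ∈ J2, ∀ b ∈ A, g j b = 0) : FI (J1 ∪ J2) (A ∪ C) g := by
  intro u hu
  have hC : ∀ b ∈ C, u b = 0 := by
    apply h2
    intro j hj
    have := hu j (mem_union_right _ hj)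
    rw [sum_union hd] at this
    rw [← this, Finset.sum_eq_zero (s := A), zero_add]
    intro b hb
    rw [h0 j hj b hb, zero_mul]
  have hA : ∀ b ∈ A, u b = 0 := by
    apply h1
    intro j hj
    have := hu j (mem_union_left _ hj)
    rw [sum_union hd] at this
    rw [← this, Finset.sum_eq_zero (s := C), add_zero]
    intro b hb
    rw [hC b hb, mul_zero]
  intro b hb
  rcases mem_union.1 hb with h | h
  · exact hA b h
  · exact hC b h

lemma FI_scale {κ ι : Type} (J : Finset κ) (S : Finset ι) (g g' : κ → ι → ℚ) (r : κ → ℚ) (e : ι → ℚ)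
    (he : ∀ b, e b ≠ 0)
    (hg : ∀ j ∈ J, ∀ b ∈ S, g' j b = r j * e b * g j b) (h : FI J S g') : FI J S g := by
  intro u hu b hb
  have := h (fun b => (e b)⁻¹ * u b) (by
    intro j hj
    have h2 := hu j hj
    have h3 : ∑ b ∈ S, g' j b * ((e b)⁻¹ * u b) = r j * ∑ b ∈ S, g j b * u b := by
      rw [Finset.mul_sum]
      refine Finset.sum_congr rfl fun b hb => ?_
      rw [hg j hj b hb]
      have := he b
      field_simp
    rw [h3, h2, mul_zero]) b hb
  simpa [he b] using this

/-- the degenerating matrix -/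
noncomputable def HH {I1 I2 : Type} (A : Finset Lat) (w : Lat → ℤ) (t : ℤ)
    (P1 : I1 → Pt) (P2 : I2 → Pt) (s : ℚ)
    (j : Σ _ : I1 ⊕ I2, Lat) (b : Lat) : ℚ :=
  match j with
  | ⟨.inl i, a⟩ => (if b ∈ A then 1 else s ^ (t - w b).toNat) * GG P1 ⟨i, a⟩ b
  | ⟨.inr i, a⟩ => (if b ∈ A then s ^ (w b - t).toNat else 1) * GG P2 ⟨i, a⟩ b

/-- the degenerating points -/
noncomputable def PP {I1 I2 : Type} (c : ℤ × ℤ × ℤ) (P1 : I1 → Pt) (P2 : I2 → Pt) (s : ℚ) :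
    I1 ⊕ I2 → Pt :=
  Sum.elim P1 fun i => (s ^ c.1 * (P2 i).1, s ^ c.2.1 * (P2 i).2.1, s ^ c.2.2 * (P2 i).2.2)

/-- affine functional -/
def aff (c0 : ℤ) (c : ℤ × ℤ × ℤ) (b : Lat) : ℤ := c0 + c.1 * b.1 + c.2.1 * b.2.1 + c.2.2 * b.2.2

/-- row factor -/
noncomputable def rfac {I1 I2 : Type} (c0 t : ℤ) (s : ℚ) (j : Σ _ : I1 ⊕ I2, Lat) : ℚ :=
  Sum.elim (fun _ => 1) (fun _ => s ^ (c0 - t)) j.1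

/-- column factor -/
noncomputable def cfac (A : Finset Lat) (w : Lat → ℤ) (t : ℤ) (s : ℚ) (b : Lat) : ℚ :=
  if b ∈ A then 1 else s ^ (t - w b)

lemma HH_eq {I1 I2 : Type} (A : Finset Lat) (c0 : ℤ) (c : ℤ × ℤ × ℤ) (t : ℤ)
    (P1 : I1 → Pt) (P2 : I2 → Pt) (s : ℚ) (hs : s ≠ 0)
    (j : Σ _ : I1 ⊕ I2, Lat) (b : Lat) (h1 : b ∈ A → t < aff c0 c b)
    (h2 : b ∉ A → aff c0 c b ≤ t) :
    HH A (aff c0 c) t P1 P2 s j b =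
      rfac c0 t s j * cfac A (aff c0 c) t s b * GG (PP c P1 P2 s) j b := by
  have key : ∀ P : Pt, mon (s ^ c.1 * P.1, s ^ c.2.1 * P.2.1, s ^ c.2.2 * P.2.2) b =
      s ^ (aff c0 c b - c0) * mon P b := by
    intro P
    simp only [mon, mul_pow]
    have : aff c0 c b - c0 = c.1 * b.1 + c.2.1 * b.2.1 + c.2.2 * b.2.2 := by unfold aff; ring
    rw [this, zpow_add₀ hs, zpow_add₀ hs, zpow_mul, zpow_mul, zpow_mul, zpow_natCast, zpow_natCast,
      zpow_natCast]
    ring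
  obtain ⟨i | i, a⟩ := j
  · by_cases hb : b ∈ A
    · simp [HH, rfac, cfac, hb, GG, PP]
    · simp only [HH, rfac, cfac, hb, GG, PP, if_false, Sum.elim_inl, one_mul]
      rw [← zpow_natCast, Int.toNat_of_nonneg (by have := h2 hb; omega)]
  · by_cases hb : b ∈ A
    · simp only [HH, rfac, cfac, hb, GG, PP, if_true, Sum.elim_inr, mul_one, key]
      rw [← zpow_natCast, Int.toNat_of_nonneg (by have := h1 hb; omega)]
      have : aff c0 c b - t = c0 - t + (aff c0 c b - c0) := by ring
      rw [this, zpow_add₀ hs]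
      ring
    · simp only [HH, rfac, cfac, hb, GG, PP, if_false, Sum.elim_inr, key]
      have : s ^ (c0 - t) * s ^ (t - aff c0 c b) * s ^ (aff c0 c b - c0) = 1 := by
        rw [← zpow_add₀ hs, ← zpow_add₀ hs]
        have : c0 - t + (t - aff c0 c b) + (aff c0 c b - c0) = 0 := by ring
        rw [this, zpow_zero]
      rw [← this]; ring

lemma HH_cont {I1 I2 : Type} (A : Finset Lat) (w : Lat → ℤ) (t : ℤ)
    (P1 : I1 → Pt) (P2 : I2 → Pt) (j : Σ _ : I1 ⊕ I2, Lat) (b : Lat) :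
    Continuous fun s => HH A w t P1 P2 s j b := by
  obtain ⟨i | i, a⟩ := j <;> by_cases hb : b ∈ A <;> simp only [HH, hb, if_true, if_false] <;> fun_prop

/-- left embedding -/
def emL {I1 I2 : Type} : (Σ _ : I1, Lat) ↪ (Σ _ : I1 ⊕ I2, Lat) :=
  ⟨fun j => ⟨Sum.inl j.1, j.2⟩, by rintro ⟨a, b⟩ ⟨c, d⟩ h; simpa using h⟩

/-- right embedding -/
def emR {I1 I2 : Type} : (Σ _ : I2, Lat) ↪ (Σ _ : I1 ⊕ I2, Lat) :=
  ⟨fun j => ⟨Sum.inr j.1, j.2⟩, by rintro ⟨a, b⟩ ⟨c, d⟩ h; simpa using h⟩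

lemma emL_apply {I1 I2 : Type} (j : Σ _ : I1, Lat) :
    (emL j : Σ _ : I1 ⊕ I2, Lat) = ⟨Sum.inl j.1, j.2⟩ := rfl

lemma emR_apply {I1 I2 : Type} (j : Σ _ : I2, Lat) :
    (emR j : Σ _ : I1 ⊕ I2, Lat) = ⟨Sum.inr j.1, j.2⟩ := rfl

/-- conditions at the points of the first kind -/
def JL {I1 I2 : Type} [Fintype I1] (m : I1 → ℕ) : Finset (Σ _ : I1 ⊕ I2, Lat) :=
  (JJ m).map emL

/-- conditions at the points of the second kind -/
def JR {I1 I2 : Type} [Fintype I2] (m : I2 → ℕ) : Finset (Σ _ : I1 ⊕ I2, Lat) :=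
  (JJ m).map emR

lemma JJ_sum {I1 I2 : Type} [Fintype I1] [Fintype I2] [DecidableEq (Σ _ : I1 ⊕ I2, Lat)]
    (m1 : I1 → ℕ) (m2 : I2 → ℕ) :
    JJ (Sum.elim m1 m2) = JL m1 ∪ JR m2 := by
  ext ⟨i | i, a⟩ <;> simp only [JJ, JL, JR, mem_sigma, mem_univ, true_and, mem_union, Finset.mem_map,
    emL_apply, emR_apply, Sum.elim_inl, Sum.elim_inr]
  · constructor
    · intro h; exact Or.inl ⟨⟨i, a⟩, h, rfl⟩
    · rintro (⟨⟨i', a'⟩, h, h'⟩ | ⟨⟨i', a'⟩, h, h'⟩)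
      · cases h'; exact h
      · cases h'
  · constructor
    · intro h; exact Or.inr ⟨⟨i, a⟩, h, rfl⟩
    · rintro (⟨⟨i', a'⟩, h, h'⟩ | ⟨⟨i', a'⟩, h, h'⟩)
      · cases h'
      · cases h'; exact h

lemma JLR_disj {I1 I2 : Type} [Fintype I1] [Fintype I2]
    (m1 : I1 → ℕ) (m2 : I2 → ℕ) :
    Disjoint (JR m2 : Finset (Σ _ : I1 ⊕ I2, Lat)) (JL m1) := by
  rw [Finset.disjoint_left]
  intro j h1 h2
  obtain ⟨j1, _, rfl⟩ := Finset.mem_map.1 h1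
  obtain ⟨j2, _, h⟩ := Finset.mem_map.1 h2
  rw [emL_apply, emR_apply] at h
  cases h

lemma FI_congr {κ ι : Type} {J : Finset κ} {S : Finset ι} {g g' : κ → ι → ℚ}
    (hg : ∀ j ∈ J, ∀ b ∈ S, g' j b = g j b) (h : FI J S g') : FI J S g := by
  refine FI_scale J S g g' (fun _ => 1) (fun _ => 1) (by simp) ?_ h
  simpa using hg

lemma FI_mapL {κ κ' ι : Type} {J : Finset κ} {S : Finset ι} {g : κ' → ι → ℚ} (f : κ ↪ κ')
    (h : FI J S fun j b => g (f j) b) : FI (J.map f) S g := by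
  intro u hu
  apply h u
  intro j hj
  exact hu _ (mem_map_of_mem _ hj)

lemma FI_mapR {κ κ' ι : Type} {J : Finset κ} {S : Finset ι} {g : ι → κ' → ℚ} (f : κ ↪ κ')
    (h : FI S J fun b j => g b (f j)) : FI S (J.map f) g := by
  intro u hu j hj
  obtain ⟨j, hj2, rfl⟩ := Finset.mem_map.1 hj
  refine h (fun j => u (f j)) ?_ j hj2
  intro b hb
  have := hu b hb
  rwa [sum_map] at this

lemma exists_ne_zero {p : ℚ → Prop} (h : ∀ᶠ s in 𝓝 (0 : ℚ), p s) : ∃ s, s ≠ 0 ∧ p s := by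
  have h1 : ∀ᶠ s in 𝓝[≠] (0 : ℚ), p s := h.filter_mono nhdsWithin_le_nhds
  have h2 : ∀ᶠ s in 𝓝[≠] (0 : ℚ), s ≠ 0 := eventually_mem_nhdsWithin
  exact (h2.and h1).exists

lemma PP_NZ {I1 I2 : Type} (c : ℤ × ℤ × ℤ) (P1 : I1 → Pt) (P2 : I2 → Pt) (s : ℚ) (hs : s ≠ 0)
    (h1 : ∀ i, NZ (P1 i)) (h2 : ∀ i, NZ (P2 i)) (i : I1 ⊕ I2) : NZ (PP c P1 P2 s i) := by
  obtain i | i := i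
  · exact h1 i
  · obtain ⟨a, b, e⟩ := h2 i
    simp [PP, NZ, a, b, e, zpow_ne_zero _ hs]

lemma map_elim {I1 I2 : Type} [Fintype I1] [Fintype I2] (m1 : I1 → ℕ) (m2 : I2 → ℕ) :
    (univ : Finset (I1 ⊕ I2)).val.map (Sum.elim m1 m2) = univ.val.map m1 + univ.val.map m2 := by
  show Multiset.map _ (Multiset.disjSum _ _) = _
  simp [Multiset.disjSum, Multiset.map_map]

lemma Inj.cut {S A C : Finset Lat} (c0 : ℤ) (c : ℤ × ℤ × ℤ) (t : ℤ) (hS : S = A ∪ C)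
    (hA : ∀ b ∈ A, t < aff c0 c b) (hC : ∀ b ∈ C, aff c0 c b ≤ t) {m1 m2 : Multiset ℕ}
    (h1 : Inj A m1) (h2 : Inj C m2) : Inj S (m1 + m2) := by
  classical
  subst hS
  obtain ⟨I1, _, m1, P1, rfl, n1, f1⟩ := h1
  obtain ⟨I2, _, m2, P2, rfl, n2, f2⟩ := h2
  have hd : Disjoint A C := by
    rw [Finset.disjoint_left]; intro b h h'; have := hA b h; have := hC b h'; omega
  have f0 : FI (JJ (Sum.elim m1 m2)) (A ∪ C) (HH A (aff c0 c) t P1 P2 0) := by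
    rw [JJ_sum]
    apply FI_block _ _ _ _ hd
    · apply FI_mapL
      refine FI_congr ?_ f1
      intro j _ b hb
      simp [HH, hb, emL_apply]
    · apply FI_mapL
      refine FI_congr ?_ f2
      intro j _ b hb
      simp [HH, Finset.disjoint_right.1 hd hb, emR_apply]
    · intro j hj b hb
      obtain ⟨j, _, rfl⟩ := Finset.mem_map.1 hj
      have := hA b hb
      simp [HH, hb, this, emR_apply]
  obtain ⟨s, hs, fs⟩ := exists_ne_zero (FI_perturb _ _ _ (HH_cont A _ t P1 P2) f0)
  refine ⟨I1 ⊕ I2, inferInstance, Sum.elim m1 m2, PP c P1 P2 s, map_elim _ _,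
    PP_NZ c P1 P2 s hs n1 n2, ?_⟩
  refine FI_scale _ _ _ _ (rfac c0 t s) (cfac A (aff c0 c) t s) ?_ ?_ fs
  · intro b; unfold cfac; split <;> simp [zpow_ne_zero _ hs]
  · intro j _ b hb
    refine HH_eq A c0 c t P1 P2 s hs j b (hA b) fun h => hC b ?_
    rcases mem_union.1 hb with h' | h'
    · exact absurd h' h
    · exact h'

lemma Surj.cut {S A C : Finset Lat} (c0 : ℤ) (c : ℤ × ℤ × ℤ) (t : ℤ) (hS : S = A ∪ C)
    (hA : ∀ b ∈ A, t < aff c0 c b) (hC : ∀ b ∈ C, aff c0 c b ≤ t) {m1 m2 : Multiset ℕ}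
    (h1 : Surj A m1) (h2 : Surj C m2) : Surj S (m1 + m2) := by
  classical
  subst hS
  obtain ⟨I1, _, m1, P1, rfl, n1, f1⟩ := h1
  obtain ⟨I2, _, m2, P2, rfl, n2, f2⟩ := h2
  have hd : Disjoint A C := by
    rw [Finset.disjoint_left]; intro b h h'; have := hA b h; have := hC b h'; omega
  have f0 : FI (A ∪ C) (JJ (Sum.elim m1 m2)) (fun b j => HH A (aff c0 c) t P1 P2 0 j b) := by
    rw [JJ_sum, union_comm, union_comm (JL m1)]
    apply FI_block _ _ _ _ (JLR_disj _ _)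
    · apply FI_mapR
      refine FI_congr ?_ f2
      intro b hb j _ 
      simp [HH, Finset.disjoint_right.1 hd hb, emR_apply]
    · apply FI_mapR
      refine FI_congr ?_ f1
      intro b hb j _
      simp [HH, hb, emL_apply]
    · intro b hb j hj
      obtain ⟨j, _, rfl⟩ := Finset.mem_map.1 hj
      have := hA b hb
      simp [HH, hb, this, emR_apply]
  obtain ⟨s, hs, fs⟩ := exists_ne_zero (FI_perturb _ _ (fun s b j => HH A (aff c0 c) t P1 P2 s j b)
    (fun b j => HH_cont A _ t P1 P2 j b) f0)
  refine ⟨I1 ⊕ I2, inferInstance, Sum.elim m1 m2, PP c P1 P2 s, map_elim _ _,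
    PP_NZ c P1 P2 s hs n1 n2, ?_⟩
  refine FI_scale _ _ _ _ (cfac A (aff c0 c) t s) (rfac c0 t s) ?_ ?_ fs
  · rintro ⟨j | j, a⟩ <;> simp [rfac, zpow_ne_zero _ hs]
  · intro b hb j _
    rw [mul_comm (cfac _ _ _ _ _)]
    refine HH_eq A c0 c t P1 P2 s hs j b (hA b) fun h => hC b ?_
    rcases mem_union.1 hb with h' | h'
    · exact absurd h' h
    · exact h'

/-- multisets of multiplicities -/
def ms (a b c : ℕ) : Multiset ℕ :=
  Multiset.replicate a 4 + Multiset.replicate b 3 + Multiset.replicate c 2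

lemma ms_add (a b c a' b' c' : ℕ) : ms a b c + ms a' b' c' = ms (a + a') (b + b') (c + c') := by
  simp only [ms, Multiset.replicate_add]; abel

lemma ms_le {a b c a' b' c' : ℕ} (h1 : a ≤ a') (h2 : b ≤ b') (h3 : c ≤ c') :
    ms a b c ≤ ms a' b' c' := by
  unfold ms
  gcongr <;> exact (Multiset.replicate_le_replicate _).2 (by assumption)

/-- a group: 20 conditions each -/
def grp (v : Lat) : Multiset ℕ := ms v.1 (2 * v.2.1) (5 * v.2.2)

lemma grp_add (v w : Lat) : grp (v + w) = grp v + grp w := by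
  simp only [grp, ms_add, Prod.fst_add, Prod.snd_add, mul_add]

/-- bijective for all distributions in `N` -/
def Ext0 (S : Finset Lat) (N : Set Lat) : Prop := ∀ v ∈ N, Inj S (grp v) ∧ Surj S (grp v)

/-- reduction of `S` to `R` using the distributions in `N` -/
def Ext (S R : Finset Lat) (N : Set Lat) : Prop :=
  ∀ v ∈ N, ∀ μ, (Inj R μ → Inj S (grp v + μ)) ∧ (Surj R μ → Surj S (grp v + μ))

/-- splitting of `S` by an affine functional -/
def IsCut (S A C : Finset Lat) : Prop :=
  ∃ (c0 : ℤ) (c : ℤ × ℤ × ℤ) (t : ℤ), S = A ∪ C ∧ (∀ b ∈ A, t < aff c0 c b) ∧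
    ∀ b ∈ C, aff c0 c b ≤ t

/-- every element of `N` is a sum -/
def Spl (N N1 N2 : Set Lat) : Prop := ∀ v ∈ N, ∃ a ∈ N1, ∃ b ∈ N2, v = a + b

lemma IsCut.ext0 {S A C : Finset Lat} (h : IsCut S A C) {N N1 N2 : Set Lat} (hN : Spl N N1 N2)
    (h1 : Ext0 A N1) (h2 : Ext0 C N2) : Ext0 S N := by
  obtain ⟨c0, c, t, hS, hA, hC⟩ := h
  intro v hv
  obtain ⟨a, ha, b, hb, rfl⟩ := hN v hv
  rw [grp_add]
  exact ⟨(h1 a ha).1.cut c0 c t hS hA hC (h2 b hb).1, (h1 a ha).2.cut c0 c t hS hA hC (h2 b hb).2⟩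

lemma IsCut.extR {S A C R : Finset Lat} (h : IsCut S A C) {N N1 N2 : Set Lat} (hN : Spl N N1 N2)
    (h1 : Ext0 A N1) (h2 : Ext C R N2) : Ext S R N := by
  obtain ⟨c0, c, t, hS, hA, hC⟩ := h
  intro v hv μ
  obtain ⟨a, ha, b, hb, rfl⟩ := hN v hv
  rw [grp_add, add_assoc]
  exact ⟨fun h => (h1 a ha).1.cut c0 c t hS hA hC ((h2 b hb μ).1 h), 
    fun h => (h1 a ha).2.cut c0 c t hS hA hC ((h2 b hb μ).2 h)⟩

lemma IsCut.extL {S A C R : Finset Lat} (h : IsCut S A C) {N N1 N2 : Set Lat} (hN : Spl N N1 N2)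
    (h1 : Ext A R N1) (h2 : Ext0 C N2) : Ext S R N := by
  obtain ⟨c0, c, t, hS, hA, hC⟩ := h
  intro v hv μ
  obtain ⟨a, ha, b, hb, rfl⟩ := hN v hv
  rw [grp_add, add_right_comm]
  exact ⟨fun h => ((h1 a ha μ).1 h).cut c0 c t hS hA hC (h2 b hb).1, 
    fun h => ((h1 a ha μ).2 h).cut c0 c t hS hA hC (h2 b hb).2⟩

lemma Ext.ext0 {S R : Finset Lat} {N N1 N2 : Set Lat} (hN : Spl N N1 N2)
    (h1 : Ext S R N1) (h2 : Ext0 R N2) : Ext0 S N := by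
  intro v hv
  obtain ⟨a, ha, b, hb, rfl⟩ := hN v hv
  rw [grp_add]
  exact ⟨(h1 a ha _).1 (h2 b hb).1, (h1 a ha _).2 (h2 b hb).2⟩

/-- even distributions -/
def EE (k : ℕ) : Set Lat := {v | ∃ a b c, a + b + c = k ∧ v = (2 * a, 2 * b, 2 * c)}

/-- all distributions -/
def FF (n : ℕ) : Set Lat := {v | v.1 + v.2.1 + v.2.2 = n}

/-- mixed distributions -/
def EF (k n : ℕ) : Set Lat := {v | ∃ a ∈ EE k, ∃ b ∈ FF n, v = a + b}

lemma exists_sub (a b c n : ℕ) (h : n ≤ a + b + c) :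
    ∃ a' b' c', a' ≤ a ∧ b' ≤ b ∧ c' ≤ c ∧ a' + b' + c' = n :=
  ⟨min a n, min b (n - a), n - a - b, by omega, by omega, by omega, by omega⟩

lemma Spl_EE (k l : ℕ) : Spl (EE (k + l)) (EE k) (EE l) := by
  rintro v ⟨a, b, c, h, rfl⟩
  obtain ⟨a', b', c', ha, hb, hc, h'⟩ := exists_sub a b c k (by omega)
  refine ⟨_, ⟨a', b', c', h', rfl⟩, _, ⟨a - a', b - b', c - c', by omega, rfl⟩, ?_⟩
  simp only [Prod.mk_add_mk, Prod.mk.injEq]; omega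

lemma Spl_FF (k l : ℕ) : Spl (FF (k + l)) (FF k) (FF l) := by
  rintro ⟨a, b, c⟩ h
  simp only [FF, Set.mem_ofPred_eq] at h
  obtain ⟨a', b', c', ha, hb, hc, h'⟩ := exists_sub a b c k (by omega)
  refine ⟨(a', b', c'), h', (a - a', b - b', c - c'), ?_, ?_⟩
  · simp only [FF, Set.mem_ofPred_eq]; omega
  · simp only [Prod.mk_add_mk, Prod.mk.injEq]; omega

lemma FF_sub_EF (k n : ℕ) (hn : 2 ≤ n) : FF (2 * k + n) ⊆ EF k n := by
  rintro ⟨a, b, c⟩ h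
  simp only [FF, Set.mem_ofPred_eq] at h
  obtain ⟨a', b', c', ha, hb, hc, h'⟩ := exists_sub (a / 2) (b / 2) (c / 2) k (by omega)
  refine ⟨_, ⟨a', b', c', h', rfl⟩, (a - 2 * a', b - 2 * b', c - 2 * c'), ?_, ?_⟩
  · simp only [FF, Set.mem_ofPred_eq]; omega
  · simp only [Prod.mk_add_mk, Prod.mk.injEq]; omega

lemma Spl_EF (k l n : ℕ) : Spl (EF (k + l) n) (EE k) (EF l n) := by
  rintro v ⟨a, ha, b, hb, rfl⟩
  obtain ⟨a', h1, a'', h2, rfl⟩ := Spl_EE k l a ha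
  exact ⟨a', h1, _, ⟨a'', h2, b, hb, rfl⟩, add_assoc _ _ _⟩

lemma Spl_EF_FF (k n m : ℕ) (hm : 2 ≤ m) : Spl (FF (2 * k + n + m)) (EF k n) (FF m) := by
  intro v hv
  obtain ⟨a, ha, b, hb, rfl⟩ := FF_sub_EF k (n + m) (by omega) (by rwa [← add_assoc])
  obtain ⟨b', h1, b'', h2, rfl⟩ := Spl_FF n m b hb
  exact ⟨_, ⟨a, ha, b', h1, rfl⟩, b'', h2, (add_assoc _ _ _).symm⟩

lemma Spl_FF_EE (n k : ℕ) (hn : 2 ≤ n) : Spl (FF (2 * k + n)) (FF n) (EE k) := by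
  intro v hv
  obtain ⟨a, ha, b, hb, rfl⟩ := FF_sub_EF k n hn hv
  exact ⟨b, hb, a, ha, add_comm _ _⟩

lemma Ext.mono {S R : Finset Lat} {N N' : Set Lat} (h : Ext S R N) (hN : N' ⊆ N) : Ext S R N' :=
  fun v hv => h v (hN hv)

/-- conditions on the last piece -/
structure ROK (R : Finset Lat) (gx : ℕ) : Prop where
  pos : 1 ≤ gx
  le : gx ≤ 3
  s0 : Surj R (ms 0 1 4)
  x4 : Inj R (ms gx 0 0)
  x3 : Inj R (ms 0 (2 * gx) 0)
  x2 : Inj R (ms 0 0 (5 * gx))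
  i4 : ∀ g e z, 1 ≤ g → g < gx → e ≤ 1 → z ≤ 4 → Inj R (ms g e z) ∨ Surj R (ms g e z)
  i3 : ∀ g e z, 1 ≤ g → g < gx → e ≤ 1 → z ≤ 4 →
    Inj R (ms 0 (2 * g + e) z) ∨ Surj R (ms 0 (2 * g + e) z)
  i2 : ∀ g e z, 1 ≤ g → g < gx → e ≤ 1 → z ≤ 4 →
    Inj R (ms 0 e (5 * g + z)) ∨ Surj R (ms 0 e (5 * g + z))

lemma Ext.both {S R : Finset Lat} {N : Set Lat} (h : Ext S R N) (a b c a' b' c' x y z : ℕ)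
    (hv : (a, b, c) ∈ N) (h2 : Inj R (ms a' b' c') ∨ Surj R (ms a' b' c'))
    (hx : x = a + a') (hy : y = 2 * b + b') (hz : z = 5 * c + c') :
    Inj S (ms x y z) ∨ Surj S (ms x y z) := by
  subst hx hy hz
  rw [← ms_add]
  exact h2.imp (h _ hv _).1 (h _ hv _).2

lemma Ext.inj {S R : Finset Lat} {n : ℕ} (h : Ext S R (FF n)) (a b c a' b' c' x y z : ℕ)
    (hv : n ≤ a + b + c) (h2 : Inj R (ms a' b' c'))
    (hx : a + a' ≤ x) (hy : 2 * b + b' ≤ y) (hz : 5 * c + c' ≤ z) :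
    Inj S (ms x y z) ∨ Surj S (ms x y z) := by
  obtain ⟨a1, b1, c1, ha, hb, hc, h'⟩ := exists_sub a b c n hv
  left
  refine ((h (a1, b1, c1) h' _).1 h2).mono ?_
  rw [grp, ms_add]
  apply ms_le <;> dsimp only <;> omega

theorem final_comb {T R : Finset Lat} {n gx : ℕ} (hn : 6 ≤ n) (h : Ext T R (FF n)) (hR : ROK R gx)
    (x y z : ℕ) : Inj T (ms x y z) ∨ Surj T (ms x y z) := by
  obtain ⟨B, hB⟩ : ∃ B, B = y / 2 := ⟨_, rfl⟩
  obtain ⟨C, hC⟩ : ∃ C, C = z / 5 := ⟨_, rfl⟩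
  by_cases h1 : x + B + C ≤ n
  · right
    refine ((h (x + (n - (x + B + C)), B, C) ?_ _).2 hR.s0).mono ?_
    · simp only [FF, Set.mem_ofPred_eq]; omega
    · rw [grp, ms_add]
      apply ms_le <;> dsimp only <;> omega
  have hp := hR.pos
  have hl := hR.le
  by_cases h2 : x + B + C - n < gx
  · obtain ⟨g, hg⟩ : ∃ g, g = x + B + C - n := ⟨_, rfl⟩
    by_cases hx : g ≤ x
    · refine h.both (x - g) B C g (y % 2) (z % 5) x y z ?_ (hR.i4 _ _ _ ?_ ?_ ?_ ?_) ?_ ?_ ?_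
      · simp only [FF, Set.mem_ofPred_eq]; omega
      all_goals omega
    by_cases hx : g ≤ B
    · refine h.both x (B - g) C 0 (2 * g + y % 2) (z % 5) x y z ?_ (hR.i3 _ _ _ ?_ ?_ ?_ ?_) ?_ ?_ ?_
      · simp only [FF, Set.mem_ofPred_eq]; omega
      all_goals omega
    · refine h.both x B (C - g) 0 (y % 2) (5 * g + z % 5) x y z ?_ (hR.i2 _ _ _ ?_ ?_ ?_ ?_) ?_ ?_ ?_
      · simp only [FF, Set.mem_ofPred_eq]; omega
      all_goals omega
  · by_cases hx : gx ≤ x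
    · exact h.inj (x - gx) B C gx 0 0 x y z (by omega) hR.x4 (by omega) (by omega) (by omega)
    by_cases hx : gx ≤ B
    · exact h.inj x (B - gx) C 0 (2 * gx) 0 x y z (by omega) hR.x3 (by omega) (by omega) (by omega)
    · exact h.inj x B (C - gx) 0 0 (5 * gx) x y z (by omega) hR.x2 (by omega) (by omega) (by omega)

end NS

/-! ### Part 3: the evaluator (written with raw recursors so that the kernel runs it quickly) -/

namespace NS


/-- strict `let` -/
noncomputable def slet (v : ℕ) (k : ℕ → Bool) : Bool :=
  @Nat.rec (fun _ => Bool) false (fun x _ => k x) (Nat.succ v)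

/-- Boolean `if` -/
noncomputable def bif' (b t e : Bool) : Bool := @Bool.rec (fun _ => Bool) e t b

/-- append -/
noncomputable def app (a : List ℕ) (r : List ℕ) : List ℕ :=
  @List.rec ℕ (fun _ => List ℕ) r (fun x _ ih => x :: ih) a

/-- find a pivot column of the row `r` -/
noncomputable def findC (r : ℕ) (k : ℕ → ℕ → List ℕ → Bool) (cs : List ℕ) : List ℕ → Bool :=
  @List.rec ℕ (fun _ => List ℕ → Bool) (fun _ => false)
    (fun c t ih acc => slet (Nat.mod (Nat.land (Nat.shiftRight r c) 65535) 127) fun p =>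
      bif' (Nat.beq p 0) (ih (c :: acc)) (k c p (app acc t))) cs

/-- one reduction modulo 127 of all digits -/
noncomputable def fo (mk N : ℕ) : ℕ :=
  Nat.add (Nat.land N mk) (Nat.shiftRight (Nat.sub N (Nat.land N mk)) 7)

/-- clear column `c` -/
noncomputable def comb (p mc c M r : ℕ) : ℕ :=
  Nat.add (Nat.mul p M) (Nat.mul (Nat.shiftRight (Nat.land M (Nat.shiftLeft mc c)) c) r)

/-- Gaussian elimination on a packed matrix -/
noncomputable def elim (ws w2 r254 mk mc : ℕ) (k : ℕ) : ℕ → List ℕ → Bool :=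
  @Nat.rec (fun _ => ℕ → List ℕ → Bool) (fun _ _ => true)
    (fun _ ih M0 cs => slet M0 fun M => findC (Nat.mod M w2) (fun c p =>
      ih (fo mk (fo mk (comb p mc c (Nat.shiftRight M ws) (Nat.sub r254 (Nat.mod M w2)))))) cs []) k

/-- column offsets -/
noncomputable def cols (n : ℕ) (k : List ℕ → Bool) : List ℕ → Bool :=
  @Nat.rec (fun _ => List ℕ → Bool) k
    (fun j ih a => slet (Nat.mul 16 j) fun c => ih (app a [c])) n

/-- a block of `n` points of the same multiplicity, with `K` conditions each;
`tab` is a table with entries of `s` bits -/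
inductive Blk | mk (tab s K n : ℕ)

/-- the matrix row of a lattice point -/
noncomputable def rowOf (e V : ℕ) (bs : List Blk) : ℕ :=
  @List.rec Blk (fun _ => ℕ) 0
    (fun b _ ih => @Blk.rec (fun _ => ℕ) (fun tab s K n =>
      Nat.add (Nat.shiftLeft ih (Nat.mul (Nat.mul 16 K) n))
      (Nat.mul (Nat.mod (Nat.shiftRight tab (Nat.mul e s)) (Nat.pow 2 (Nat.mul (Nat.mul 16 K) n)))
        (Nat.mod V (Nat.pow 2 (Nat.mul 16 K))))) b) bs

/-- number of conditions -/
noncomputable def width (bs : List Blk) : ℕ :=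
  @List.rec Blk (fun _ => ℕ) 0 (fun b _ ih => @Blk.rec (fun _ => ℕ) (fun _ _ K n => Nat.add ih (Nat.mul K n)) b) bs

/-- row data of a lattice point: exponent, packed monomials -/
inductive RowD | mk (e V : ℕ)

/-- pack all the rows -/
noncomputable def buildM (ws mkr : ℕ) (bs : List Blk) (l : List RowD) : ℕ :=
  @List.rec RowD (fun _ => ℕ) 0
    (fun r _ ih => @RowD.rec (fun _ => ℕ) (fun e V => Nat.add (fo mkr (fo mkr (rowOf e V bs)))
      (Nat.shiftLeft ih ws)) r) l

/-- independence test of the `n` rows -/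
noncomputable def tst (n : ℕ) (l : List RowD) (bs : List Blk) : Bool :=
  slet (width bs) fun w =>
  slet (Nat.mul 16 w) fun ws =>
  slet (Nat.pow 2 ws) fun w2 =>
  slet (Nat.pow 2 (Nat.mul n ws)) fun w3 =>
  slet (Nat.div (Nat.sub w2 1) 65535) fun one =>
  slet (Nat.mul 254 one) fun r254 =>
  slet (Nat.mul 127 one) fun mkr =>
  slet (Nat.div (Nat.sub w3 1) (Nat.sub w2 1)) fun ones =>
  slet (Nat.mul 65535 ones) fun mc =>
  slet (Nat.mul mkr ones) fun mk =>
  cols w (fun cs => elim ws w2 r254 mk mc n (buildM ws mkr bs l) cs) []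

/-- table entry: powers of 3 modulo 127 for `k` points, spaced `w` bits -/
noncomputable def tabRow (s0 w e : ℕ) (k : ℕ) : ℕ :=
  @Nat.rec (fun _ => ℕ) 0 (fun i ih => Nat.add
    (Nat.shiftLeft (Nat.mod (Nat.pow 3 (Nat.mod (Nat.mul e (Nat.add s0 i)) 126)) 127) (Nat.mul w i)) ih) k

/-- table -/
noncomputable def mkTab (s0 w k s : ℕ) (c : ℕ → Bool) (n : ℕ) : ℕ → Bool :=
  @Nat.rec (fun _ => ℕ → Bool) c
    (fun e ih a => slet (Nat.add (Nat.shiftLeft a s) (tabRow s0 w e k)) ih) n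

/-- a digit of the point code -/
noncomputable def dg (q i : ℕ) : ℕ := Nat.land (Nat.shiftRight q i) 8191

/-- value of a linear functional on a point code -/
noncomputable def dot (q W : ℕ) : ℕ := Nat.land (Nat.shiftRight (Nat.mul q W) 39) 8191

noncomputable def mono3 (x y z l3 z2 q2 q3 : ℕ) : ℕ :=
  Nat.add 1 (Nat.shiftLeft (Nat.add l3 (Nat.shiftLeft (Nat.add q3 (Nat.shiftLeft
    (Nat.add (Nat.mul x q3) (Nat.shiftLeft (Nat.add (Nat.mul y q2)
      (Nat.shiftLeft (Nat.mul z z2) 48)) 96)) 96)) 48)) 16)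

noncomputable def mono2 (x y z l2 l3 : ℕ) (k : ℕ → Bool) : Bool :=
  slet (Nat.mul z z) fun z2 => slet (Nat.add (Nat.mul y l2) (Nat.shiftLeft z2 32)) fun q2 =>
  k (mono3 x y z l3 z2 q2 (Nat.add (Nat.mul x l3) (Nat.shiftLeft q2 48)))

/-- the monomials of degree `≤ 3`, packed -/
noncomputable def mono (q : ℕ) (k : ℕ → Bool) : Bool :=
  slet (dg q 0) fun x => slet (dg q 13) fun y => slet (dg q 26) fun z =>
  slet (Nat.add y (Nat.shiftLeft z 16)) fun l2 =>
  slet (Nat.add x (Nat.shiftLeft l2 16)) fun l3 => mono2 x y z l2 l3 k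

/-- point codes to row data -/
noncomputable def mapP (m20 : ℕ) (k : List RowD → Bool) (l : List ℕ) : List RowD → Bool :=
  @List.rec ℕ (fun _ => List RowD → Bool) k
    (fun q _ ih a => mono q fun V => slet (fo m20 (fo m20 V)) fun V' =>
      slet (Nat.mod (dot q 550360498176) 126) fun e => ih (.mk e V' :: a)) l

/-- length -/
noncomputable def len (l : List ℕ) : ℕ :=
  @List.rec ℕ (fun _ => ℕ) 0 (fun _ _ ih => Nat.succ ih) l

inductive CTree | l | n (c : ℕ) (a b : CTree)

noncomputable def split (W t : ℕ) (k : List ℕ → List ℕ → Bool) (l : List ℕ) :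
    List ℕ → List ℕ → Bool :=
  @List.rec ℕ (fun _ => List ℕ → List ℕ → Bool) k
    (fun q _ ih a b => bif' (Nat.ble (dot q W) t) (ih a (q :: b)) (ih (q :: a) b)) l

/-- packed reversed weights -/
noncomputable def wts (c : ℕ) : ℕ :=
  Nat.add (Nat.mod c 64) (Nat.shiftLeft (Nat.add (Nat.mod (Nat.shiftRight c 18) 64)
    (Nat.shiftLeft (Nat.add (Nat.mod (Nat.shiftRight c 12) 64)
      (Nat.shiftLeft (Nat.mod (Nat.shiftRight c 6) 64) 13)) 13)) 13)

/-- cut a list of points by the functional with code `c` -/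
noncomputable def cut (c : ℕ) (l : List ℕ) (k : List ℕ → List ℕ → Bool) : Bool :=
  slet (Nat.shiftRight c 24) fun t => slet (wts c) fun W => split W t k l [] []

/-- the four tables -/
inductive Tabs | mk (t4 t3 t2 t1 : ℕ)

noncomputable def blks (T : Tabs) (n4 n3 n2 n1 : ℕ) : List Blk :=
  @Tabs.rec (fun _ => List Blk) (fun t4 t3 t2 t1 =>
    [.mk t4 960 20 n4, .mk t3 1120 10 n3, .mk t2 1024 4 n2, .mk t1 416 1 n1]) T

/-- conjunction -/
noncomputable def band (a b : Bool) : Bool := bif' a b false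

noncomputable def t3 (T : Tabs) (n g : ℕ) (r : List RowD) : Bool :=
  @Tabs.rec (fun _ => Bool) (fun t4 t3 t2 _ =>
    band (tst n r [.mk t4 960 20 g]) (band (tst n r [.mk t3 1120 10 (Nat.mul 2 g)])
      (tst n r [.mk t2 1024 4 (Nat.mul 5 g)]))) T

/-- test of a pure leaf -/
noncomputable def leafE (T : Tabs) (n g : ℕ) (m20 : ℕ) (l : List ℕ) : Bool :=
  band (Nat.beq (len l) n) (mapP m20 (t3 T n g) l [])

noncomputable def leafM (T : Tabs) (m20 : ℕ) (l : List ℕ) : Bool :=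
  band (leafE T 40 2 m20 l) (mapP m20 (fun r => band (tst 40 r (blks T 1 2 0 0))
    (band (tst 40 r (blks T 1 0 5 0)) (tst 40 r (blks T 0 2 5 0)))) l [])

/-- test with padding by simple points -/
noncomputable def ns (T : Tabs) (n : ℕ) (r : List RowD) (n4 n3 n2 : ℕ) : Bool :=
  slet (Nat.sub n (Nat.add (Nat.mul 20 n4) (Nat.add (Nat.mul 10 n3) (Nat.mul 4 n2)))) fun n1 =>
  tst n r (blks T n4 n3 n2 n1)

/-- conjunction over `i < n` -/
noncomputable def allB (f : ℕ → Bool) (n : ℕ) : Bool :=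
  @Nat.rec (fun _ => Bool) true (fun i ih => band ih (slet i f)) n

noncomputable def leafR (T : Tabs) (gx : ℕ) (m20 : ℕ) (l : List ℕ) : Bool :=
  slet (len l) fun n => band (band (Nat.ble 26 n) (Nat.ble n 45)) (mapP m20 (fun r => band (ns T n r 0 1 4) (band (t3 T n gx r)
    (allB (fun g => allB (fun e => allB (fun z =>
      band (ns T n r (Nat.succ g) e z) (band (ns T n r 0 (Nat.add (Nat.mul 2 (Nat.succ g)) e) z)
        (ns T n r 0 e (Nat.add (Nat.mul 5 (Nat.succ g)) z)))) 5) 2) (Nat.pred gx)))) l [])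

noncomputable def pureT (T : Tabs) (m20 : ℕ) (t : CTree) : List ℕ → Bool :=
  @CTree.rec (fun _ => List ℕ → Bool) (fun l => leafE T 40 2 m20 l)
   (fun c _ _ iha ihb l => cut c l fun a b => band (iha a) (ihb b)) t

noncomputable def optCut (c : ℕ) (f : List ℕ → Bool) (l : List ℕ) (k : List ℕ → Bool) : Bool :=
  bif' (Nat.beq c 0) (k l) (cut c l fun a b => band (f a) (k b))

/-- list of cuts and pure trees -/
inductive Spine | nil | cons (c : ℕ) (t : CTree) (s : Spine)

noncomputable def spineT (T : Tabs) (m20 : ℕ) (k : List ℕ → Bool) (s : Spine) : List ℕ → Bool :=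
  @Spine.rec (fun _ => List ℕ → Bool) k
    (fun c t _ ih l => cut c l fun a b => band (pureT T m20 t a) (ih b)) s

/-- the points of a row of the simplex -/
noncomputable def genZ (q0 : ℕ) (k : List ℕ → Bool) (n : ℕ) : List ℕ → Bool :=
  @Nat.rec (fun _ => List ℕ → Bool) k
    (fun z ih a => slet (Nat.sub q0 (Nat.mul z 549688705024)) fun q => ih (q :: a)) n
noncomputable def genY (q0 m : ℕ) (k : List ℕ → Bool) (n : ℕ) : List ℕ → Bool :=
  @Nat.rec (fun _ => List ℕ → Bool) k
    (fun y ih a => slet (Nat.sub q0 (Nat.mul y 549755805696)) fun q1 =>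
      slet (Nat.sub m y) fun n' => genZ q1 ih n' a) n
noncomputable def genX (d : ℕ) (k : List ℕ → Bool) (n : ℕ) : List ℕ → Bool :=
  @Nat.rec (fun _ => List ℕ → Bool) k
    (fun x ih a => slet (Nat.sub (Nat.mul d 549755813888) (Nat.mul x 549755813887)) fun q0 =>
      slet (Nat.sub (Nat.succ d) x) fun m => genY q0 m ih m a) n

noncomputable def withTabs (k : Tabs → ℕ → Bool) : Bool :=
  mkTab 0 320 3 960 (fun t4 => mkTab 3 160 7 1120 (fun t3 => mkTab 10 64 16 1024 (fun t2 =>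
    mkTab 30 16 26 416 (fun t1 => slet (Nat.mul 127 (Nat.div (Nat.sub (Nat.pow 2 320) 1) 65535)) fun m20 =>
      k (.mk t4 t3 t2 t1) m20) 126 0) 126 0) 126 0) 126 0

/-- main check.  `c0`: cut off the smaller simplex (or 0); `cu`, `cm` : cuts for leaves
with 1 and 2 groups (or 0) -/
noncomputable def chk (d c0 : ℕ) (s : Spine) (cu cm gx : ℕ) (pr : Bool) : Bool :=
  withTabs fun T m20 => genX d (fun l0 => 
    (fun f => bif' (Nat.beq c0 0) (f l0) (cut c0 l0 fun a _ => f a)) (spineT T m20 (fun l =>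
      optCut cu (leafE T 20 1 m20) l fun l1 => optCut cm (leafM T m20) l1 fun l2 =>
      band (leafR T gx m20 l2) (bif' pr (leafE T 40 2 m20 l2) true)) s)) (Nat.succ d) []

end NS

/-! ### Part 4: packed arithmetic and elimination -/

namespace NS

open Finset

/-- packing digits with `s` bits -/
def pk (s n : ℕ) (f : ℕ → ℕ) : ℕ := ∑ j ∈ range n, f j * 2 ^ (s * j)

lemma pk_add (s a b : ℕ) (f : ℕ → ℕ) :
    pk s (a + b) f = pk s a f + 2 ^ (s * a) * pk s b (fun k => f (a + k)) := by
  unfold pk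
  rw [sum_range_add, mul_sum]
  congr 1
  refine sum_congr rfl fun j _ => ?_
  rw [mul_add, pow_add]; ring

lemma pk_lt (s n : ℕ) (f : ℕ → ℕ) (h : ∀ j < n, f j < 2 ^ s) : pk s n f < 2 ^ (s * n) := by
  induction n with
  | zero => simp [pk]
  | succ n ih =>
    have h1 := ih fun j hj => h j (by omega)
    have h2 := h n (by omega)
    rw [pk_add, mul_add, pow_add]
    simp only [pk, sum_range_one, mul_zero, pow_zero, mul_one, add_zero] at *
    calc _ < 2 ^ (s * n) + 2 ^ (s * n) * f n := by omega
      _ = 2 ^ (s * n) * (f n + 1) := by ring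
      _ ≤ _ := Nat.mul_le_mul_left _ h2

lemma pk_congr {s n : ℕ} {f g : ℕ → ℕ} (h : ∀ j < n, f j = g j) : pk s n f = pk s n g :=
  sum_congr rfl fun j hj => by rw [h j (mem_range.1 hj)]

lemma pk_mod (s a b : ℕ) (f : ℕ → ℕ) (h : ∀ j < a, f j < 2 ^ s) :
    pk s (a + b) f % 2 ^ (s * a) = pk s a f := by
  rw [pk_add, Nat.add_mul_mod_self_left, Nat.mod_eq_of_lt (pk_lt _ _ _ h)]

lemma pk_div (s a b : ℕ) (f : ℕ → ℕ) (h : ∀ j < a, f j < 2 ^ s) :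
    pk s (a + b) f / 2 ^ (s * a) = pk s b (fun k => f (a + k)) := by
  rw [pk_add, Nat.add_mul_div_left _ _ (by positivity), Nat.div_eq_of_lt (pk_lt _ _ _ h), zero_add]

lemma pk_succ (s n : ℕ) (f : ℕ → ℕ) : pk s (n + 1) f = f 0 + 2 ^ s * pk s n (fun k => f (k + 1)) := by
  rw [add_comm n 1, pk_add]
  simp [pk, add_comm]

lemma land_split (s a b c d : ℕ) (ha : a < 2 ^ s) (hc : c < 2 ^ s) :
    (a + 2 ^ s * b) &&& (c + 2 ^ s * d) = (a &&& c) + 2 ^ s * (b &&& d) := by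
  have h1 : ((a + 2 ^ s * b) &&& (c + 2 ^ s * d)) % 2 ^ s = a &&& c := by
    rw [Nat.and_mod_two_pow, Nat.add_mul_mod_self_left, Nat.add_mul_mod_self_left,
      Nat.mod_eq_of_lt ha, Nat.mod_eq_of_lt hc]
  have h2 : ((a + 2 ^ s * b) &&& (c + 2 ^ s * d)) / 2 ^ s = b &&& d := by
    rw [Nat.and_div_two_pow, Nat.add_mul_div_left _ _ (by positivity),
      Nat.add_mul_div_left _ _ (by positivity), Nat.div_eq_of_lt ha, Nat.div_eq_of_lt hc, zero_add,
      zero_add]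
  rw [← Nat.mod_add_div ((a + 2 ^ s * b) &&& (c + 2 ^ s * d)) (2 ^ s), h1, h2]

lemma pk_land (s n : ℕ) (f g : ℕ → ℕ) (hf : ∀ j < n, f j < 2 ^ s) (hg : ∀ j < n, g j < 2 ^ s) :
    pk s n f &&& pk s n g = pk s n (fun k => f k &&& g k) := by
  induction n generalizing f g with
  | zero => simp [pk]
  | succ n ih =>
    rw [pk_succ, pk_succ, pk_succ, land_split _ _ _ _ _ (hf 0 (by omega)) (hg 0 (by omega)),
      ih _ _ (fun j hj => hf _ (by omega)) (fun j hj => hg _ (by omega))]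

lemma land_high (s n f m : ℕ) (h : f < 2 ^ (s * n)) : f &&& (2 ^ (s * n) * m) = 0 := by
  have := land_split (s * n) f 0 0 m h (by positivity)
  simpa using this

lemma pk_land' (s n e : ℕ) (f g : ℕ → ℕ) (hf : ∀ j < n, f j < 2 ^ s) (hg : ∀ j < n, g j < 2 ^ s) :
    pk s n f &&& pk s (n + e) g = pk s n (fun k => f k &&& g k) := by
  have := land_split (s * n) (pk s n f) 0 (pk s n g) (pk s e fun k => g (n + k)) (pk_lt _ _ _ hf)
    (pk_lt _ _ _ hg)
  rw [pk_add, ← pk_land s n f g hf hg]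
  simpa using this

lemma pk_double (w n : ℕ) (g : ℕ → ℕ → ℕ) :
    ∑ i ∈ range n, pk 16 w (g i) * 2 ^ (16 * w * i) = pk 16 (n * w) (fun k => g (k / w) (k % w)) := by
  induction n with
  | zero => simp [pk]
  | succ n ih =>
    rw [sum_range_succ, ih, add_mul, one_mul, pk_add]
    congr 1
    rw [mul_comm]
    congr 1
    · congr 1; ring
    · refine pk_congr fun k hk => ?_
      have hw : 0 < w := by omega
      rw [mul_comm n w, Nat.mul_add_div hw, Nat.mul_add_mod, Nat.div_eq_of_lt hk, Nat.mod_eq_of_lt hk,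
        add_zero]

lemma geom (s n : ℕ) (hs : 0 < s) : (2 ^ (s * n) - 1) / (2 ^ s - 1) = ∑ i ∈ range n, 2 ^ (s * i) := by
  have := Nat.geomSum_eq (m := 2 ^ s) (by calc 2 = 2 ^ 1 := rfl
    _ ≤ 2 ^ s := Nat.pow_le_pow_right (by norm_num) hs) n
  simp only [← pow_mul] at this
  exact this.symm

lemma one_eq (w : ℕ) : (2 ^ (16 * w) - 1) / 65535 = pk 16 w fun _ => 1 := by
  have := geom 16 w (by norm_num)
  simpa [pk] using this

lemma pk_const (s n c : ℕ) : c * (pk s n fun _ => 1) = pk s n fun _ => c := by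
  simp [pk, mul_sum]

/-- folding a digit -/
def fd (a : ℕ) : ℕ := a % 128 + a / 128

lemma fd_le (a : ℕ) (h : a < 65536) : fd (fd a) ≤ 130 := by unfold fd; omega

lemma fd_lt (a : ℕ) (h : a < 65536) : fd a < 65536 := by unfold fd; omega

lemma fd_mod (a : ℕ) : ((fd a : ℕ) : ZMod 127) = a := by
  rw [ZMod.natCast_eq_natCast_iff]
  unfold fd Nat.ModEq
  omega

lemma fo_pk (n e : ℕ) (f : ℕ → ℕ) (hf : ∀ j < n, f j < 65536) :
    fo (pk 16 (n + e) fun _ => 127) (pk 16 n f) = pk 16 n (fun k => fd (f k)) := by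
  have h1 : Nat.land (pk 16 n f) (pk 16 (n + e) fun _ => 127) = pk 16 n (fun k => f k % 128) := by
    show pk 16 n f &&& _ = _
    rw [pk_land' 16 n e f _ (by simpa using hf) (by simp)]
    refine pk_congr fun k _ => ?_
    exact Nat.and_two_pow_sub_one_eq_mod (f k) 7
  have h2 : pk 16 n f = pk 16 n (fun k => f k % 128) + 2 ^ 7 * pk 16 n (fun k => f k / 128) := by
    unfold pk
    rw [mul_sum, ← sum_add_distrib]
    refine sum_congr rfl fun k _ => ?_
    conv_lhs => rw [← Nat.mod_add_div (f k) 128]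
    ring
  unfold fo
  rw [h1]
  show _ + (pk 16 n f - _) >>> 7 = _
  rw [h2, Nat.add_sub_cancel_left, Nat.shiftRight_eq_div_pow, Nat.mul_div_cancel_left _ (by norm_num)]
  unfold pk
  rw [← sum_add_distrib]
  refine sum_congr rfl fun k _ => ?_
  simp only [fd]; ring

lemma fo2_pk (n e : ℕ) (f : ℕ → ℕ) (hf : ∀ j < n, f j < 65536) :
    fo (pk 16 (n + e) fun _ => 127) (fo (pk 16 (n + e) fun _ => 127) (pk 16 n f)) =
      pk 16 n (fun k => fd (fd (f k))) := by
  rw [fo_pk n e f hf, fo_pk n e _ fun j hj => fd_lt _ (hf j hj)]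

/-- the mask of a column -/
lemma mc_eq (w n : ℕ) (hw : 0 < w) :
    65535 * ∑ i ∈ range n, 2 ^ (16 * w * i) =
      pk 16 (n * w) (fun k => if k % w = 0 then 65535 else 0) := by
  rw [← pk_double w n fun _ j => if j = 0 then 65535 else 0, mul_sum]
  refine sum_congr rfl fun i _ => ?_
  congr 1
  unfold pk
  rw [sum_eq_single 0]
  · simp
  · intro b _ hb; simp [hb]
  · intro h; simp at h; omega

lemma col_eq (w n e j : ℕ) (hj : j < w) (f : ℕ → ℕ) (hf : ∀ k < n * w, f k < 65536) :
    (pk 16 (n * w) f &&& (65535 * ∑ i ∈ range (n + e), 2 ^ (16 * w * i)) <<< (16 * j)) >>> (16 * j) =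
      ∑ i ∈ range n, f (w * i + j) * 2 ^ (16 * w * i) := by
  have hw : 0 < w := by omega
  have e1 : (65535 * ∑ i ∈ range (n + e), 2 ^ (16 * w * i)) <<< (16 * j) =
      pk 16 ((n + e) * w) (fun k => if k % w = j then 65535 else 0) := by
    rw [← pk_double w (n + e) fun _ k => if k = j then 65535 else 0, mul_sum, Nat.shiftLeft_eq, sum_mul]
    refine sum_congr rfl fun i _ => ?_
    unfold pk
    rw [sum_eq_single j]
    · simp; ring
    · intro b _ hb; simp [hb]
    · intro h; simp at h; omega
  rw [e1, add_mul, pk_land' 16 (n * w) (e * w) f _ (by simpa using hf) (by intro k _; split <;> norm_num)]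
  have e2 : pk 16 (n * w) (fun k => f k &&& if k % w = j then 65535 else 0) =
      2 ^ (16 * j) * ∑ i ∈ range n, f (w * i + j) * 2 ^ (16 * w * i) := by
    rw [show pk 16 (n * w) (fun k => f k &&& if k % w = j then 65535 else 0) =
      pk 16 (n * w) (fun k => (fun i k => if k = j then f (w * i + k) else 0) (k / w) (k % w)) from ?_]
    · rw [← pk_double w n (fun i k => if k = j then f (w * i + k) else 0), mul_sum]
      refine sum_congr rfl fun i _ => ?_
      unfold pk
      rw [sum_eq_single j]
      · simp; ring
      · intro b _ hb; simp [hb]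
      · intro h; simp at h; omega
    · refine pk_congr fun k hk => ?_
      simp only
      split
      · rw [Nat.div_add_mod]
        have := Nat.and_two_pow_sub_one_eq_mod (f k) 16
        have h2 := hf k hk
        norm_num at this
        omega
      · simp
  rw [e2, Nat.shiftRight_eq_div_pow, Nat.mul_div_cancel_left _ (by positivity)]

lemma comb_pk (w n e j p : ℕ) (hj : j < w) (f r : ℕ → ℕ) (hf : ∀ k < n * w, f k < 65536) :
    comb p (65535 * ∑ i ∈ range (n + e), 2 ^ (16 * w * i)) (16 * j) (pk 16 (n * w) f) (pk 16 w r) =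
      pk 16 (n * w) (fun k => p * f k + f (w * (k / w) + j) * r (k % w)) := by
  have h1 := col_eq w n e j hj f hf
  show p * _ + ((pk 16 (n * w) f &&& (65535 * ∑ i ∈ range (n + e), 2 ^ (16 * w * i)) <<< (16 * j)) >>> (16 * j)) * _ = _
  rw [h1]
  have h2 : (∑ i ∈ range n, f (w * i + j) * 2 ^ (16 * w * i)) * pk 16 w r =
      pk 16 (n * w) (fun k => f (w * (k / w) + j) * r (k % w)) := by
    rw [← pk_double w n fun i k => f (w * i + j) * r k, sum_mul]
    refine sum_congr rfl fun i _ => ?_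
    unfold pk
    rw [mul_sum, sum_mul]
    refine sum_congr rfl fun k _ => ?_
    ring
  rw [h2]
  unfold pk
  rw [mul_sum, ← sum_add_distrib]
  refine sum_congr rfl fun k _ => ?_
  ring

/-- independence of the rows of a packed matrix, modulo 127 -/
def Ind (n w : ℕ) (f : ℕ → ℕ) : Prop :=
  ∀ u : ℕ → ZMod 127, (∀ j < w, ∑ i ∈ range n, u i * (f (w * i + j) : ZMod 127) = 0) → ∀ i < n, u i = 0

instance : Fact (Nat.Prime 127) := ⟨by norm_num⟩

lemma Ind_step (n w j p : ℕ) (hj : j < w) (f f' : ℕ → ℕ) (hp : (p : ZMod 127) = f j)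
    (hp0 : (p : ZMod 127) ≠ 0)
    (hf : ∀ i < n, ∀ k < w, (f' (w * i + k) : ZMod 127) =
      p * f (w * (i + 1) + k) - f (w * (i + 1) + j) * f k) (h : Ind n w f') : Ind (n + 1) w f := by
  intro u hu
  have h1 : ∀ k < w, ∑ i ∈ range n, u (i + 1) * (f (w * (i + 1) + k) : ZMod 127) = - (u 0 * f k) := by
    intro k hk
    have := hu k hk
    rw [sum_range_succ'] at this
    simp only [mul_zero, zero_add] at this
    exact eq_neg_of_add_eq_zero_left this
  have h2 : ∀ i < n, u (i + 1) = 0 := by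
    apply h (fun i => u (i + 1))
    intro k hk
    have : ∑ i ∈ range n, u (i + 1) * (f' (w * i + k) : ZMod 127) =
        p * ∑ i ∈ range n, u (i + 1) * (f (w * (i + 1) + k) : ZMod 127) -
        (∑ i ∈ range n, u (i + 1) * (f (w * (i + 1) + j) : ZMod 127)) * f k := by
      rw [mul_sum, sum_mul, ← sum_sub_distrib]
      refine sum_congr rfl fun i hi => ?_
      rw [hf i (mem_range.1 hi) k hk]; ring
    rw [this, h1 k hk, h1 j hj, hp]; ring
  have h3 : u 0 = 0 := by
    have := h1 j hj
    rw [sum_eq_zero] at this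
    · rw [← hp] at this
      have h4 : u 0 * (p : ZMod 127) = 0 := neg_eq_zero.1 this.symm
      exact (mul_eq_zero.1 h4).resolve_right hp0
    · intro i hi; rw [h2 i (mem_range.1 hi), zero_mul]
  intro i hi
  rcases i with _ | i
  · exact h3
  · exact h2 i (by omega)

lemma bif_true {b t e : Bool} (h : bif' b t e = true) : (b = true ∧ t = true) ∨ (b = false ∧ e = true) := by
  cases b
  · exact Or.inr ⟨rfl, h⟩
  · exact Or.inl ⟨rfl, h⟩

lemma band_true {a b : Bool} (h : band a b = true) : a = true ∧ b = true := by
  cases a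
  · exact absurd h (by intro h; cases h)
  · exact ⟨rfl, h⟩

lemma app_eq (a b : List ℕ) : app a b = a ++ b := by
  induction a with
  | nil => rfl
  | cons x a ih => exact congrArg (List.cons x) ih

lemma findC_sound (r : ℕ) (k : ℕ → ℕ → List ℕ → Bool) (cs acc : List ℕ) (h : findC r k cs acc = true) :
    ∃ c ∈ cs, ∃ cs', (∀ x ∈ cs', x ∈ cs ∨ x ∈ acc) ∧ (r >>> c &&& 65535) % 127 ≠ 0 ∧
      k c ((r >>> c &&& 65535) % 127) cs' = true := by
  induction cs generalizing acc with
  | nil => exact absurd h (by intro h; cases h)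
  | cons c t ih =>
    have h' : bif' (Nat.beq ((r >>> c &&& 65535) % 127) 0) (findC r k t (c :: acc))
      (k c ((r >>> c &&& 65535) % 127) (app acc t)) = true := h
    rcases bif_true h' with ⟨_, h2⟩ | ⟨h1, h2⟩
    · obtain ⟨c', hc, cs', h3, h4⟩ := ih _ h2
      refine ⟨c', List.mem_cons_of_mem _ hc, cs', ?_, h4⟩
      intro x hx
      rcases h3 x hx with h | h
      · exact Or.inl (List.mem_cons_of_mem _ h)
      · rcases List.mem_cons.1 h with rfl | h
        · simp
        · exact Or.inr h
    · refine ⟨c, by simp, _, ?_, ?_, h2⟩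
      · intro x hx
        rw [app_eq] at hx
        rcases List.mem_append.1 hx with h | h
        · exact Or.inr h
        · exact Or.inl (List.mem_cons_of_mem _ h)
      · exact Nat.ne_of_beq_eq_false h1

lemma elim_sound (w N : ℕ) (n : ℕ) (hn : n ≤ N) (f : ℕ → ℕ) (cs : List ℕ)
    (hf : ∀ k, f k ≤ 130) (hcs : ∀ c ∈ cs, ∃ j < w, c = 16 * j)
    (h : elim (16 * w) (2 ^ (16 * w)) (pk 16 w fun _ => 254) (pk 16 (N * w) fun _ => 127)
      (65535 * ∑ i ∈ range N, 2 ^ (16 * w * i)) n (pk 16 (n * w) f) cs = true) : Ind n w f := by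
  induction n generalizing f cs with
  | zero => intro u _ i hi; omega
  | succ n ih =>
    obtain ⟨e, rfl⟩ := Nat.exists_eq_add_of_lt (show n < N by omega)
    have hf2 : ∀ k, f k < 65536 := fun k => by have := hf k; omega
    obtain ⟨c, hc, cs', h1, h2, h3⟩ := findC_sound _ _ cs [] h
    obtain ⟨j, hj, rfl⟩ := hcs c hc
    have eM : pk 16 ((n + 1) * w) f = pk 16 (w + n * w) f := by congr 1; ring
    have er : pk 16 ((n + 1) * w) f % 2 ^ (16 * w) = pk 16 w f := by
      rw [eM, pk_mod _ _ _ _ fun k _ => hf2 k]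
    have es : pk 16 ((n + 1) * w) f >>> (16 * w) = pk 16 (n * w) (fun k => f (w + k)) := by
      rw [eM, Nat.shiftRight_eq_div_pow, pk_div _ _ _ _ fun k _ => hf2 k]
    have esub : (pk 16 w fun _ => 254) - pk 16 w f = pk 16 w fun k => 254 - f k := by
      rw [Nat.sub_eq_iff_eq_add]
      · unfold pk
        rw [← sum_add_distrib]
        refine sum_congr rfl fun k _ => ?_
        rw [← add_mul, Nat.sub_add_cancel (by have := hf k; omega)]
      · unfold pk
        refine sum_le_sum fun k _ => ?_
        exact Nat.mul_le_mul_right _ (by have := hf k; show f k ≤ 254; omega)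
    have ep : pk 16 w f >>> (16 * j) &&& 65535 = f j := by
      obtain ⟨w', rfl⟩ := Nat.exists_eq_add_of_lt hj
      rw [Nat.shiftRight_eq_div_pow, add_assoc, pk_div _ _ _ _ fun k _ => hf2 k, pk_succ]
      have := Nat.and_two_pow_sub_one_eq_mod (f (j + 0) + 2 ^ 16 * pk 16 w' fun k => f (j + (k + 1))) 16
      rw [Nat.add_mul_mod_self_left, Nat.mod_eq_of_lt (show f (j + 0) < 2 ^ 16 from hf2 _)] at this
      exact this
    replace h2 : (pk 16 ((n + 1) * w) f % 2 ^ (16 * w)) >>> (16 * j) &&& 65535 = f j ∧ f j % 127 ≠ 0 := by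
      have h2' : ((pk 16 ((n + 1) * w) f % 2 ^ (16 * w)) >>> (16 * j) &&& 65535) % 127 ≠ 0 := h2
      rw [er, ep] at h2' ⊢
      exact ⟨rfl, h2'⟩
    obtain ⟨p, hp⟩ : ∃ p, p = f j % 127 := ⟨_, rfl⟩
    have hp1 : p < 127 := by omega
    have ec : fo (pk 16 ((n + e + 1) * w) fun _ => 127) (fo (pk 16 ((n + e + 1) * w) fun _ => 127)
        (comb p (65535 * ∑ i ∈ range (n + e + 1), 2 ^ (16 * w * i)) (16 * j)
          (pk 16 (n * w) (fun k => f (w + k))) (pk 16 w fun k => 254 - f k))) =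
        pk 16 (n * w) (fun k => fd (fd (p * f (w + k) + f (w + (w * (k / w) + j)) * (254 - f (k % w))))) := by
      rw [add_assoc, comb_pk w n (e + 1) j p hj _ _ fun k _ => hf2 _, add_mul]
      rw [fo2_pk]
      intro k _
      have a1 := hf (w + k)
      have a2 := hf (w + (w * (k / w) + j))
      have : p * f (w + k) ≤ 126 * 130 := Nat.mul_le_mul (by omega) a1
      have : f (w + (w * (k / w) + j)) * (254 - f (k % w)) ≤ 130 * 254 :=
        Nat.mul_le_mul a2 (by omega)
      omega
    have hb : ∀ k, p * f (w + k) + f (w + (w * (k / w) + j)) * (254 - f (k % w)) < 65536 := by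
      intro k
      have a1 := hf (w + k)
      have a2 := hf (w + (w * (k / w) + j))
      have : p * f (w + k) ≤ 126 * 130 := Nat.mul_le_mul (by omega) a1
      have : f (w + (w * (k / w) + j)) * (254 - f (k % w)) ≤ 130 * 254 :=
        Nat.mul_le_mul a2 (by omega)
      omega
    have h4 : elim (16 * w) (2 ^ (16 * w)) (pk 16 w fun _ => 254) (pk 16 ((n + e + 1) * w) fun _ => 127)
      (65535 * ∑ i ∈ range (n + e + 1), 2 ^ (16 * w * i)) n
      (fo (pk 16 ((n + e + 1) * w) fun _ => 127) (fo (pk 16 ((n + e + 1) * w) fun _ => 127)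
        (comb (((pk 16 ((n + 1) * w) f % 2 ^ (16 * w)) >>> (16 * j) &&& 65535) % 127)
          (65535 * ∑ i ∈ range (n + e + 1), 2 ^ (16 * w * i)) (16 * j)
          (pk 16 ((n + 1) * w) f >>> (16 * w))
          ((pk 16 w fun _ => 254) - (pk 16 ((n + 1) * w) f % 2 ^ (16 * w)))))) cs' = true := h3
    rw [h2.1, es, er, esub, ← hp, ec] at h4
    have h5 := ih (by omega) _ cs' (fun k => fd_le _ (hb k)) (fun x hx => by
      rcases h1 x hx with h | h
      · exact hcs x h
      · simp at h) h4
    have hpc : (p : ZMod 127) = f j := by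
      rw [hp, ZMod.natCast_mod]
    refine Ind_step n w j p hj f _ hpc ?_ ?_ h5
    · intro h0
      rw [ZMod.natCast_eq_zero_iff] at h0
      have := Nat.le_of_dvd (by omega) h0
      omega
    · intro i hi k hk
      have hw : 0 < w := by omega
      rw [fd_mod, fd_mod, Nat.mul_add_div hw, Nat.mul_add_mod, Nat.div_eq_of_lt hk, Nat.mod_eq_of_lt hk]
      push_cast [Nat.cast_sub (show f k ≤ 254 by have := hf k; omega)]
      have h254 : (254 : ZMod 127) = 0 := by decide
      rw [h254, show w + (w * i + k) = w * (i + 1) + k by ring,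
        show w + (w * (i + 0) + j) = w * (i + 1) + j by ring]
      ring

end NS

/-! ### Part 5: the packed interpolation matrices -/

namespace NS

open Finset

/-- the monomials of degree at most 3 -/
def alL : List Lat :=
  [(0, 0, 0), (1, 0, 0), (0, 1, 0), (0, 0, 1), (2, 0, 0), (1, 1, 0), (1, 0, 1), (0, 2, 0), (0, 1, 1),
    (0, 0, 2), (3, 0, 0), (2, 1, 0), (2, 0, 1), (1, 2, 0), (1, 1, 1), (1, 0, 2), (0, 3, 0), (0, 2, 1),
    (0, 1, 2), (0, 0, 3)]

/-- the `k`-th monomial -/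
def al (k : ℕ) : Lat := alL.getD k (0, 0, 0)

/-- integral monomial -/
def npol (a b : Lat) : ℕ := b.1 ^ a.1 * b.2.1 ^ a.2.1 * b.2.2 ^ a.2.2

/-- digits of the packed monomials -/
def vd (b : Lat) (k : ℕ) : ℕ := fd (fd (npol (al k) b))

/-- small lattice points -/
def Ok (b : Lat) : Prop := b.1 ≤ 40 ∧ b.2.1 ≤ 40 ∧ b.2.2 ≤ 40

lemma al_deg (k : ℕ) : (al k).1 + (al k).2.1 + (al k).2.2 ≤ 3 := by
  unfold al
  by_cases h : k < 20
  · interval_cases k <;> decide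
  · rw [List.getD_eq_default _ _ (by simp [alL]; omega)]; decide

lemma npol_lt {b : Lat} (hb : Ok b) (k : ℕ) : npol (al k) b < 65536 := by
  obtain ⟨h1, h2, h3⟩ := hb
  calc npol (al k) b ≤ 40 ^ (al k).1 * 40 ^ (al k).2.1 * 40 ^ (al k).2.2 := by
        unfold npol; gcongr
    _ = 40 ^ ((al k).1 + (al k).2.1 + (al k).2.2) := by rw [pow_add, pow_add]
    _ ≤ 40 ^ 3 := Nat.pow_le_pow_right (by norm_num) (al_deg k)
    _ < 65536 := by norm_num

lemma vd_le {b : Lat} (hb : Ok b) (k : ℕ) : vd b k ≤ 130 := fd_le _ (npol_lt hb k)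

/-- weight of a lattice point on the monomial curve -/
def wtb (b : Lat) : ℕ := b.1 + 9 * b.2.1 + 86 * b.2.2

/-- row data of a lattice point -/
def rd (b : Lat) : RowD := .mk (wtb b % 126) (pk 16 20 (vd b))

/-- table entries -/
def tent (ix e : ℕ) : ℕ := 3 ^ (e * ix % 126) % 127

/-- tables -/
def tabv (s0 K k : ℕ) : ℕ := pk (16 * K * k) 126 (fun e => pk (16 * K) k fun i => tent (s0 + i) e)

lemma tent_lt (ix e : ℕ) : tent ix e < 127 := Nat.mod_lt _ (by norm_num)

lemma pow_mod_126 (n : ℕ) : (3 : ZMod 127) ^ (n % 126) = 3 ^ n := by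
  conv_rhs => rw [← Nat.mod_add_div n 126, pow_add, pow_mul]
  have : (3 : ZMod 127) ^ 126 = 1 := ZMod.pow_card_sub_one_eq_one (p := 127) (by decide)
  rw [this, one_pow, mul_one]

lemma tent_cast (ix e : ℕ) : (tent ix (e % 126) : ZMod 127) = 3 ^ (ix * e) := by
  unfold tent
  rw [ZMod.natCast_mod]
  push_cast
  rw [pow_mod_126, mul_comm, mul_comm ix e, ← pow_mod_126 (e * ix), ← pow_mod_126 (ix * (e % 126))]
  congr 1
  rw [mul_comm e, Nat.mul_mod_mod]

lemma tab_lookup (s0 K k n e : ℕ) (he : e < 126) (hn : n ≤ k) (hK : 0 < K) :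
    tabv s0 K k >>> (e * (16 * K * k)) % 2 ^ (16 * K * n) =
      pk (16 * K) n fun i => tent (s0 + i) e := by
  have hp : 127 ≤ 2 ^ (16 * K) := by
    calc 127 ≤ 2 ^ 16 := by norm_num
      _ ≤ _ := Nat.pow_le_pow_right (by norm_num) (by omega)
  have ht : ∀ e, ∀ j, (fun i => tent (s0 + i) e) j < 2 ^ (16 * K) := fun e j =>
    (tent_lt _ _).trans_le hp
  obtain ⟨r, hr⟩ := Nat.exists_eq_add_of_lt he
  obtain ⟨k', rfl⟩ := Nat.exists_eq_add_of_le hn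
  unfold tabv
  rw [hr, add_assoc e, Nat.shiftRight_eq_div_pow, mul_comm e, pk_div]
  · rw [pk_succ, mul_add, pow_add, mul_assoc, Nat.add_mul_mod_self_left]
    exact pk_mod _ _ _ _ fun j _ => ht _ j
  · intro j _
    exact pk_lt _ _ _ fun i _ => ht _ i

lemma rowOf_cons (e V tab s K n : ℕ) (bs : List Blk) : rowOf e V (.mk tab s K n :: bs) =
    (rowOf e V bs) <<< (16 * K * n) +
      (tab >>> (e * s) % 2 ^ (16 * K * n)) * (V % 2 ^ (16 * K)) := rfl

lemma width_cons (tab s K n : ℕ) (bs : List Blk) : width (.mk tab s K n :: bs) = width bs + K * n := rfl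

/-- the blocks realize the multiplicities `μ` -/
def Real' (bs : List Blk) (μ : Multiset ℕ) : Prop :=
  ∃ (I : Type) (_ : Fintype I) (m : I → ℕ) (ix : I → ℕ) (ρ : Lat → ℕ → ℕ), univ.val.map m = μ ∧
    (∀ b, Ok b → ∀ j, ρ b j < 65536) ∧
    (∀ b, Ok b → rowOf (wtb b % 126) (pk 16 20 (vd b)) bs = pk 16 (width bs) (ρ b)) ∧
    ∀ j < width bs, ∃ i, ∃ a ∈ AL (m i), ∀ b, Ok b →
      (ρ b j : ZMod 127) = ((3 ^ (ix i * wtb b) * npol a b : ℕ) : ZMod 127)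

lemma Real'_nil : Real' [] 0 :=
  ⟨Empty, inferInstance, fun _ => 0, fun _ => 0, fun _ _ => 0, rfl, by simp, by intro b _; simp [pk]; rfl,
    fun j hj => absurd hj (Nat.not_lt_zero j)⟩

lemma pk20_mod {b : Lat} (hb : Ok b) (K : ℕ) (hK : K ≤ 20) :
    pk 16 20 (vd b) % 2 ^ (16 * K) = pk 16 K (vd b) := by
  obtain ⟨r, hr⟩ := Nat.exists_eq_add_of_le hK
  rw [hr]
  apply pk_mod
  intro j _
  have := vd_le hb j
  omega

lemma row_eq (K n W : ℕ) (t v ρ : ℕ → ℕ) :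
    (pk 16 W ρ) <<< (16 * K * n) + (pk (16 * K) n t) * pk 16 K v =
      pk 16 (W + K * n) (fun j => if j < n * K then t (j / K) * v (j % K) else ρ (j - n * K)) := by
  rw [add_comm W, mul_comm K n, pk_add, Nat.shiftLeft_eq, add_comm]
  have h1 : pk 16 (n * K) (fun j => if j < n * K then t (j / K) * v (j % K) else ρ (j - n * K)) =
      (pk (16 * K) n t) * pk 16 K v := by
    rw [pk_congr (g := fun j => t (j / K) * v (j % K)) fun j hj => if_pos hj,
      ← pk_double K n (fun i j => t i * v j)]
    conv_rhs => rw [pk, sum_mul]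
    refine sum_congr rfl fun i _ => ?_
    unfold pk
    rw [mul_sum, sum_mul]
    refine sum_congr rfl fun j _ => ?_
    ring
  have h2 : pk 16 W (fun k => (fun j => if j < n * K then t (j / K) * v (j % K) else ρ (j - n * K))
      (n * K + k)) = pk 16 W ρ := by
    refine pk_congr fun j _ => ?_
    simp
  rw [h1, h2, show 16 * K * n = 16 * (n * K) by ring, mul_comm (2 ^ _)]

lemma Real'_cons (s0 K k n m s : ℕ) (bs : List Blk) (μ : Multiset ℕ) (h : Real' bs μ) (hn : n ≤ k)
    (hs : s = 16 * K * k)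
    (hK : 0 < K) (hK2 : K ≤ 20) (hal : ∀ j < K, al j ∈ AL m) :
    Real' (.mk (tabv s0 K k) s K n :: bs) (Multiset.replicate n m + μ) := by
  subst hs
  obtain ⟨I, _, m', ix, ρ, hm, h1, h2, h3⟩ := h
  refine ⟨Fin n ⊕ I, inferInstance, Sum.elim (fun _ => m) m', Sum.elim (fun i => s0 + i) ix,
    fun b j => if j < n * K then tent (s0 + j / K) (wtb b % 126) * vd b (j % K) else ρ b (j - n * K),
    ?_, ?_, ?_, ?_⟩
  · rw [map_elim, hm]; simp
  · intro b hb j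
    dsimp only
    split
    · have a1 := tent_lt (s0 + j / K) (wtb b % 126)
      have a2 := vd_le hb (j % K)
      have := Nat.mul_le_mul (show tent (s0 + j / K) (wtb b % 126) ≤ 126 by omega) a2
      omega
    · exact h1 b hb _
  · intro b hb
    rw [rowOf_cons, width_cons, h2 b hb, tab_lookup _ _ _ _ _ (Nat.mod_lt _ (by norm_num)) hn hK]
    rw [pk20_mod hb K hK2]
    exact row_eq _ _ _ _ _ _
  · intro j hj
    rw [width_cons] at hj
    by_cases hjn : j < n * K
    · refine ⟨Sum.inl ⟨j / K, Nat.div_lt_of_lt_mul (by rwa [mul_comm])⟩, al (j % K),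
        hal _ (Nat.mod_lt _ hK), ?_⟩
      intro b hb
      simp only [hjn, if_true, Sum.elim_inl]
      push_cast
      rw [tent_cast, vd, fd_mod, fd_mod]
    · obtain ⟨i, a, ha, h⟩ := h3 (j - n * K) (by rw [mul_comm K n] at hj; omega)
      refine ⟨Sum.inr i, a, ha, ?_⟩
      intro b hb
      simp only [hjn, if_false, Sum.elim_inr]
      exact h b hb

/-- the tables used by the evaluator -/
def T0 : Tabs := .mk (tabv 0 20 3) (tabv 3 10 7) (tabv 10 4 16) (tabv 30 1 26)

lemma Real'_4 {bs : List Blk} {μ : Multiset ℕ} (h : Real' bs μ) (n : ℕ) (hn : n ≤ 3) :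
    Real' (.mk (tabv 0 20 3) 960 20 n :: bs) (Multiset.replicate n 4 + μ) :=
  Real'_cons 0 20 3 n 4 960 bs μ h hn rfl (by norm_num) (by norm_num) (by decide)

lemma Real'_3 {bs : List Blk} {μ : Multiset ℕ} (h : Real' bs μ) (n : ℕ) (hn : n ≤ 7) :
    Real' (.mk (tabv 3 10 7) 1120 10 n :: bs) (Multiset.replicate n 3 + μ) :=
  Real'_cons 3 10 7 n 3 1120 bs μ h hn rfl (by norm_num) (by norm_num) (by decide)

lemma Real'_2 {bs : List Blk} {μ : Multiset ℕ} (h : Real' bs μ) (n : ℕ) (hn : n ≤ 16) :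
    Real' (.mk (tabv 10 4 16) 1024 4 n :: bs) (Multiset.replicate n 2 + μ) :=
  Real'_cons 10 4 16 n 2 1024 bs μ h hn rfl (by norm_num) (by norm_num) (by decide)

lemma Real'_1 {bs : List Blk} {μ : Multiset ℕ} (h : Real' bs μ) (n : ℕ) (hn : n ≤ 26) :
    Real' (.mk (tabv 30 1 26) 416 1 n :: bs) (Multiset.replicate n 1 + μ) :=
  Real'_cons 30 1 26 n 1 416 bs μ h hn rfl (by norm_num) (by norm_num) (by decide)

lemma sum_getD {M : Type} [AddCommMonoid M] (L : List Lat) (h : Lat → M) :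
    (L.map h).sum = ∑ i ∈ range L.length, h (L.getD i (0, 0, 0)) := by
  induction L with
  | nil => simp
  | cons a L ih =>
    rw [List.length_cons, sum_range_succ', List.map_cons, List.sum_cons, ih, add_comm]
    simp

lemma buildM_eq (w : ℕ) (bs : List Blk) (ρ : Lat → ℕ → ℕ) (L : List Lat) (hL : ∀ b ∈ L, Ok b)
    (h1 : ∀ b, Ok b → ∀ j, ρ b j < 65536)
    (h2 : ∀ b, Ok b → rowOf (wtb b % 126) (pk 16 20 (vd b)) bs = pk 16 w (ρ b)) :
    buildM (16 * w) (pk 16 w fun _ => 127) bs (L.map rd) =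
      pk 16 (L.length * w) (fun k => fd (fd (ρ (L.getD (k / w) (0, 0, 0)) (k % w)))) := by
  rw [← pk_double w L.length (fun i j => fd (fd (ρ (L.getD i (0, 0, 0)) j)))]
  induction L with
  | nil => rfl
  | cons b L ih =>
    have h3 : buildM (16 * w) (pk 16 w fun _ => 127) bs ((b :: L).map rd) =
      fo (pk 16 w fun _ => 127) (fo (pk 16 w fun _ => 127) (rowOf (wtb b % 126) (pk 16 20 (vd b)) bs)) +
       (buildM (16 * w) (pk 16 w fun _ => 127) bs (L.map rd)) <<< (16 * w) := rfl
    rw [h3, ih fun b hb => hL b (List.mem_cons_of_mem _ hb), h2 b (hL b (by simp))]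
    have := fo2_pk w 0 (ρ b) fun j _ => h1 b (hL b (by simp)) j
    rw [add_zero] at this
    rw [this, List.length_cons, sum_range_succ', add_comm, Nat.shiftLeft_eq, sum_mul]
    congr 1
    · refine sum_congr rfl fun i _ => ?_
      rw [mul_assoc, ← pow_add, List.getD_cons_succ]
      congr 1
    · simp

lemma cols_sound (n : ℕ) (k : List ℕ → Bool) (a : List ℕ) (h : cols n k a = true) :
    ∃ cs, (∀ c ∈ cs, c ∈ a ∨ ∃ j < n, c = 16 * j) ∧ k cs = true := by
  induction n generalizing a with
  | zero => exact ⟨a, fun c hc => Or.inl hc, h⟩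
  | succ n ih =>
    have h' : cols n k (app a [16 * n]) = true := h
    obtain ⟨cs, h1, h2⟩ := ih _ h'
    refine ⟨cs, ?_, h2⟩
    intro c hc
    rcases h1 c hc with h | ⟨j, hj, h⟩
    · rw [app_eq] at h
      rcases List.mem_append.1 h with h | h
      · exact Or.inl h
      · exact Or.inr ⟨n, by omega, by simpa using h⟩
    · exact Or.inr ⟨j, by omega, h⟩

lemma tst_ind (n : ℕ) (bs : List Blk) (ρ : Lat → ℕ → ℕ) (L : List Lat) (hL : ∀ b ∈ L, Ok b)
    (hn : L.length = n)
    (h1 : ∀ b, Ok b → ∀ j, ρ b j < 65536)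
    (h2 : ∀ b, Ok b → rowOf (wtb b % 126) (pk 16 20 (vd b)) bs = pk 16 (width bs) (ρ b))
    (h : tst n (L.map rd) bs = true) :
    Ind n (width bs) (fun k => fd (fd (ρ (L.getD (k / width bs) (0, 0, 0)) (k % width bs)))) := by
  obtain ⟨w, hw⟩ : ∃ w, w = width bs := ⟨_, rfl⟩
  have h3 : cols w (fun cs => elim (16 * w) (2 ^ (16 * w)) (254 * ((2 ^ (16 * w) - 1) / 65535))
    (127 * ((2 ^ (16 * w) - 1) / 65535) * ((2 ^ (n * (16 * w)) - 1) / (2 ^ (16 * w) - 1)))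
    (65535 * ((2 ^ (n * (16 * w)) - 1) / (2 ^ (16 * w) - 1))) n
    (buildM (16 * w) (127 * ((2 ^ (16 * w) - 1) / 65535)) bs (L.map rd)) cs) [] = true := by
    rw [hw]; exact h
  obtain ⟨cs, h4, h5⟩ := cols_sound _ _ _ h3
  rw [← hw] at h2 ⊢
  have h4' : ∀ c ∈ cs, ∃ j < w, c = 16 * j := fun c hc => (h4 c hc).resolve_left (by simp)
  rcases Nat.eq_zero_or_pos w with hw0 | hw0
  · cases n with
    | zero => intro u _ i hi; omega
    | succ n =>
      cases cs with
      | nil => cases h5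
      | cons c cs =>
        obtain ⟨j, hj, _⟩ := h4' c (by simp)
        omega
  rw [one_eq, pk_const, pk_const, buildM_eq w bs ρ L hL h1 h2, hn, mul_comm n, geom _ _ (by omega)] at h5
  have e1 : (pk 16 w fun _ => 127) * ∑ i ∈ range n, 2 ^ (16 * w * i) = pk 16 (n * w) fun _ => 127 := by
    rw [← pk_double w n (fun _ _ => 127), mul_sum]
  rw [e1] at h5
  refine elim_sound w n n le_rfl _ cs ?_ h4' h5
  intro k
  apply fd_le
  apply h1
  by_cases hk : k / w < L.length
  · rw [List.getD_eq_getElem _ _ hk]; exact hL _ (List.getElem_mem _)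
  · rw [List.getD_eq_default _ _ (by omega)]; exact ⟨by norm_num, by norm_num, by norm_num⟩

lemma FI_of_mod {κ : Type} (J : Finset κ) (S : Finset Lat) (g : κ → Lat → ℕ)
    (h : ∀ u : Lat → ZMod 127, (∀ j ∈ J, ∑ b ∈ S, (g j b : ZMod 127) * u b = 0) → ∀ b ∈ S, u b = 0) :
    FI J S (fun j b => (g j b : ℚ)) := by
  intro u hu
  by_contra hne
  push Not at hne
  obtain ⟨b0, hb0, hb1⟩ := hne
  obtain ⟨D, hD⟩ := IsLocalization.exist_integer_multiples (nonZeroDivisors ℤ) S u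
  have hD0 : (D : ℤ) ≠ 0 := nonZeroDivisors.ne_zero D.2
  have hv : ∀ b, ∃ v : ℤ, b ∈ S → (v : ℚ) = (D : ℤ) * u b := by
    intro b
    by_cases hb : b ∈ S
    · obtain ⟨v, hv⟩ := hD b hb
      refine ⟨v, fun _ => ?_⟩
      simpa [Algebra.smul_def] using hv
    · exact ⟨0, fun h => absurd h hb⟩
  choose v hv using hv
  obtain ⟨g', hg1, hg2⟩ := Finset.extract_gcd v ⟨b0, hb0⟩
  have hgne : S.gcd v ≠ 0 := by
    intro h0
    have := hg1 b0 hb0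
    rw [h0, zero_mul] at this
    have h2 := hv b0 hb0
    rw [this] at h2
    have : ((D : ℤ) : ℚ) * u b0 ≠ 0 := mul_ne_zero (by exact_mod_cast hD0) hb1
    exact this (by rw [← h2]; simp)
  have hz : ∀ j ∈ J, ∑ b ∈ S, (g j b : ℤ) * g' b = 0 := by
    intro j hj
    have h1 : ∑ b ∈ S, (g j b : ℤ) * v b = 0 := by
      have : ((∑ b ∈ S, (g j b : ℤ) * v b : ℤ) : ℚ) = ((D : ℤ) : ℚ) * ∑ b ∈ S, (g j b : ℚ) * u b := by
        push_cast
        rw [mul_sum]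
        refine sum_congr rfl fun b hb => ?_
        rw [hv b hb]; ring
      rw [hu j hj, mul_zero] at this
      exact_mod_cast this
    have h2 : S.gcd v * ∑ b ∈ S, (g j b : ℤ) * g' b = 0 := by
      rw [← h1, mul_sum]
      refine sum_congr rfl fun b hb => ?_
      rw [hg1 b hb]; ring
    exact (mul_eq_zero.1 h2).resolve_left hgne
  have h3 := h (fun b => (g' b : ZMod 127)) (by
    intro j hj
    have := congrArg (Int.cast : ℤ → ZMod 127) (hz j hj)
    push_cast at this
    exact this)
  have h4 : (127 : ℤ) ∣ S.gcd g' := by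
    apply Finset.dvd_gcd
    intro b hb
    have := h3 b hb
    rw [ZMod.intCast_zmod_eq_zero_iff_dvd] at this
    exact_mod_cast this
  rw [hg2] at h4
  norm_num at h4

lemma tst_sound {n : ℕ} {bs : List Blk} {μ : Multiset ℕ} {L : List Lat} (hR : Real' bs μ)
    (hL : ∀ b ∈ L, Ok b) (hn : L.length = n) (hnd : L.Nodup) (h : tst n (L.map rd) bs = true) :
    Inj L.toFinset μ := by
  obtain ⟨I, _, m, ix, ρ, hm, h1, h2, h3⟩ := hR
  have hI := tst_ind n bs ρ L hL hn h1 h2 h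
  refine ⟨I, _, m, fun i => (3 ^ ix i, 3 ^ (9 * ix i), 3 ^ (86 * ix i)), hm, fun i => ?_, ?_⟩
  · simp [NZ]
  have hF : FI (JJ m) L.toFinset (fun j b => ((3 ^ (ix j.1 * wtb b) * npol j.2 b : ℕ) : ℚ)) := by
    apply FI_of_mod
    intro u hu b hb
    have h4 := hI (fun i => u (L.getD i (0, 0, 0))) (by
      intro j hj
      obtain ⟨i, a, ha, h5⟩ := h3 j hj
      have h6 := hu ⟨i, a⟩ (by simpa [JJ] using ha)
      rw [List.sum_toFinset _ hnd, sum_getD, hn] at h6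
      rw [← h6]
      refine sum_congr rfl fun t ht => ?_
      have hw : 0 < width bs := by omega
      rw [mul_comm]
      congr 1
      rw [fd_mod, fd_mod, Nat.mul_add_div hw, Nat.mul_add_mod, Nat.div_eq_of_lt hj, Nat.mod_eq_of_lt hj,
        add_zero]
      refine h5 _ (hL _ ?_)
      have : t < L.length := by rw [hn]; exact mem_range.1 ht
      rw [List.getD_eq_getElem _ _ this]; exact List.getElem_mem _)
    obtain ⟨i, hi, rfl⟩ := List.getElem_of_mem (List.mem_toFinset.1 hb)
    have := h4 i (by omega)
    rwa [List.getD_eq_getElem _ _ hi] at this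
  refine FI_congr ?_ hF
  intro j _ b _
  simp only [GG, mon, pol, npol, wtb]
  push_cast
  ring

end NS

/-! ### Part 6: tables and point codes -/

namespace NS

open Finset

lemma slet_eq (v : ℕ) (k : ℕ → Bool) : slet v k = k v := Eq.trans (Eq.refl _) (Eq.refl (k v))

lemma tabRow_eq (s0 w e k : ℕ) : tabRow s0 w e k = pk w k (fun i => tent (s0 + i) e) := by
  induction k with
  | zero => rfl
  | succ k ih =>
    have h : tabRow s0 w e (k + 1) = (tent (s0 + k) e) <<< (w * k) + tabRow s0 w e k := rfl
    rw [h, ih, Nat.shiftLeft_eq, add_comm]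
    unfold pk
    rw [sum_range_succ]

lemma mkTab_eq (s0 w k s : ℕ) (c : ℕ → Bool) (n a : ℕ) :
    mkTab s0 w k s c n a = c (a * 2 ^ (s * n) + pk s n fun e => pk w k fun i => tent (s0 + i) e) := by
  induction n generalizing a with
  | zero => simp [pk]; rfl
  | succ n ih =>
    have h : mkTab s0 w k s c (n + 1) a = mkTab s0 w k s c n (a <<< s + tabRow s0 w n k) := rfl
    rw [h, ih, tabRow_eq, Nat.shiftLeft_eq]
    congr 1
    conv_rhs => rw [pk, sum_range_succ]
    rw [← pk, mul_add, mul_one, pow_add]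
    ring

lemma mkTab_0 (s0 K k w s : ℕ) (hw : w = 16 * K) (hs : s = 16 * K * k) (c : ℕ → Bool) :
    mkTab s0 w k s c 126 0 = c (tabv s0 K k) := by
  subst hw hs
  rw [mkTab_eq, zero_mul, zero_add]; rfl

/-- the mask -/
def M20 : ℕ := pk 16 20 fun _ => 127

set_option exponentiation.threshold 400 in
lemma M20_eq : 127 * ((2 ^ 320 - 1) / 65535) = M20 := by
  have := one_eq 20
  rw [show 16 * 20 = 320 from rfl] at this
  rw [this, pk_const]; rfl

lemma withTabs_eq (k : Tabs → ℕ → Bool) : withTabs k = k T0 M20 := by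
  unfold withTabs
  rw [mkTab_0 0 20 3 320 960 rfl rfl, mkTab_0 3 10 7 160 1120 rfl rfl, mkTab_0 10 4 16 64 1024 rfl rfl,
    mkTab_0 30 1 26 16 416 rfl rfl, slet_eq, ← M20_eq]
  rfl

/-- code of a lattice point of the simplex -/
def enc (d : ℕ) (b : Lat) : ℕ :=
  b.1 + b.2.1 * 2 ^ 13 + b.2.2 * 2 ^ 26 + (d - b.1 - b.2.1 - b.2.2) * 2 ^ 39

/-- value of the functional with weights given by `c` -/
def val (d c : ℕ) (b : Lat) : ℕ :=
  b.1 * (c / 64 % 64) + b.2.1 * (c / 4096 % 64) + b.2.2 * (c / 262144 % 64) +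
    (d - b.1 - b.2.1 - b.2.2) * (c % 64)

lemma land_13 (a : ℕ) : Nat.land a 8191 = a % 8192 := Nat.and_two_pow_sub_one_eq_mod a 13

lemma dg_enc (d : ℕ) (hd : d ≤ 40) (b : Lat) (hb : b.1 + b.2.1 + b.2.2 ≤ d) :
    dg (enc d b) 0 = b.1 ∧ dg (enc d b) 13 = b.2.1 ∧ dg (enc d b) 26 = b.2.2 := by
  have h : ∀ i, dg (enc d b) i = enc d b / 2 ^ i % 8192 := fun i => by
    rw [← Nat.shiftRight_eq_div_pow, ← land_13]; rfl
  simp only [h]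
  unfold enc
  obtain ⟨x, y, z⟩ := b
  simp only at hb ⊢
  norm_num
  omega

lemma dot_eq (x y z e w0 w1 w2 w3 : ℕ) (h : x + y + z + e ≤ 40) (h0 : w0 ≤ 127) (h1 : w1 ≤ 127)
    (h2 : w2 ≤ 127) (h3 : w3 ≤ 127) :
    dot (x + y * 2 ^ 13 + z * 2 ^ 26 + e * 2 ^ 39) (w0 + w1 * 2 ^ 13 + w2 * 2 ^ 26 + w3 * 2 ^ 39) =
      x * w3 + y * w2 + z * w1 + e * w0 := by
  have hm : ∀ a w, w ≤ 127 → a * w ≤ a * 127 := fun a w h => Nat.mul_le_mul_left a h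
  have e1 : (x + y * 2 ^ 13 + z * 2 ^ 26 + e * 2 ^ 39) * (w0 + w1 * 2 ^ 13 + w2 * 2 ^ 26 + w3 * 2 ^ 39) =
      (x * w0 + (x * w1 + y * w0) * 2 ^ 13 + (x * w2 + y * w1 + z * w0) * 2 ^ 26) +
      2 ^ 39 * ((x * w3 + y * w2 + z * w1 + e * w0) + 8192 * (y * w3 + z * w2 + e * w1 +
        (z * w3 + e * w2) * 2 ^ 13 + e * w3 * 2 ^ 26)) := by ring
  have e2 : dot (x + y * 2 ^ 13 + z * 2 ^ 26 + e * 2 ^ 39) (w0 + w1 * 2 ^ 13 + w2 * 2 ^ 26 + w3 * 2 ^ 39)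
     = (x + y * 2 ^ 13 + z * 2 ^ 26 + e * 2 ^ 39) * (w0 + w1 * 2 ^ 13 + w2 * 2 ^ 26 + w3 * 2 ^ 39)
      / 2 ^ 39 % 8192 := by
    rw [← Nat.shiftRight_eq_div_pow, ← land_13]; rfl
  have a0 := hm x w0 h0
  have a1 := hm x w1 h1
  have a2 := hm x w2 h2
  have a3 := hm x w3 h3
  have b0 := hm y w0 h0
  have b1 := hm y w1 h1
  have b2 := hm y w2 h2
  have c0 := hm z w0 h0
  have c1 := hm z w1 h1
  have d0 := hm e w0 h0
  rw [e2, e1, Nat.add_mul_div_left _ _ (by positivity), Nat.div_eq_of_lt, zero_add,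
    Nat.add_mul_mod_self_left, Nat.mod_eq_of_lt]
  · omega
  · norm_num; omega

lemma dot_val (d c : ℕ) (hd : d ≤ 40) (b : Lat) (hb : b.1 + b.2.1 + b.2.2 ≤ d) :
    dot (enc d b) (wts c) = val d c b := by
  have e1 : wts c = c % 64 + (c / 262144 % 64) * 2 ^ 13 + (c / 4096 % 64) * 2 ^ 26 +
      (c / 64 % 64) * 2 ^ 39 := by
    have : wts c = c % 64 + ((c >>> 18 % 64) + ((c >>> 12 % 64) + (c >>> 6 % 64) <<< 13) <<< 13) <<< 13 := rfl
    rw [this]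
    simp only [Nat.shiftRight_eq_div_pow, Nat.shiftLeft_eq]
    norm_num
    ring
  rw [e1, enc, dot_eq _ _ _ _ _ _ _ _ (by omega) (by omega) (by omega) (by omega) (by omega)]
  rfl

lemma dot_wtb (d : ℕ) (hd : d ≤ 40) (b : Lat) (hb : b.1 + b.2.1 + b.2.2 ≤ d) :
    dot (enc d b) 550360498176 = wtb b := by
  have := dot_eq b.1 b.2.1 b.2.2 (d - b.1 - b.2.1 - b.2.2) 0 86 9 1 (by omega) (by omega) (by omega)
    (by omega) (by omega)
  norm_num at this
  have h2 : enc d b = b.1 + b.2.1 * 8192 + b.2.2 * 67108864 + (d - b.1 - b.2.1 - b.2.2) * 549755813888 := by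
    unfold enc; norm_num
  rw [h2, this, wtb]
  ring

set_option exponentiation.threshold 400 in
lemma mono_pk (x y z : ℕ) : mono3 x y z (x + (y + z <<< 16) <<< 16) (z * z)
    (y * (y + z <<< 16) + (z * z) <<< 32)
    (x * (x + (y + z <<< 16) <<< 16) + (y * (y + z <<< 16) + (z * z) <<< 32) <<< 48) =
      pk 16 20 (fun k => npol (al k) (x, y, z)) := by
  have h : ∀ l3 z2 q2 q3, mono3 x y z l3 z2 q2 q3 =
    1 + (l3 + (q3 + (x * q3 + (y * q2 + (z * z2) <<< 48) <<< 96) <<< 96) <<< 48) <<< 16 :=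
    fun _ _ _ _ => rfl
  rw [h]
  simp only [pk, sum_range_succ, sum_range_zero, al, alL, npol, Nat.shiftLeft_eq, List.getD_cons_zero,
    List.getD_cons_succ]
  ring

lemma mono_eq (d : ℕ) (hd : d ≤ 40) (b : Lat) (hb : b.1 + b.2.1 + b.2.2 ≤ d) (k : ℕ → Bool) :
    mono (enc d b) k = k (pk 16 20 (fun k => npol (al k) b)) := by
  obtain ⟨h1, h2, h3⟩ := dg_enc d hd b hb
  unfold mono mono2
  simp only [slet_eq, h1, h2, h3]
  rw [show pk 16 20 (fun k => npol (al k) b) = pk 16 20 (fun k => npol (al k) (b.1, b.2.1, b.2.2)) from rfl,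
    ← mono_pk]
  rfl

/-- `l` represents `L` -/
def Rep (d : ℕ) (L : List Lat) (l : List ℕ) : Prop :=
  (∀ b ∈ L, b.1 + b.2.1 + b.2.2 ≤ d) ∧ l = L.map (enc d)

lemma ok_of {d : ℕ} (hd : d ≤ 40) {b : Lat} (h : b.1 + b.2.1 + b.2.2 ≤ d) : Ok b :=
  ⟨by omega, by omega, by omega⟩

lemma M20_def : M20 = pk 16 20 fun _ => 127 := rfl

lemma mod_eq' (x y : ℕ) : Nat.mod x y = x % y := Eq.trans (Eq.refl _) (Eq.refl (x % y))

lemma mapP_cons (m : ℕ) (k : List RowD → Bool) (q : ℕ) (l : List ℕ) (a : List RowD) :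
    mapP m k (q :: l) a = mono q fun V => mapP m k l
      (.mk ((dot q 550360498176) % 126) (fo m (fo m V)) :: a) := by
  have : mapP m k (q :: l) a = mono q fun V => slet (fo m (fo m V)) fun V' =>
      slet (Nat.mod (dot q 550360498176) 126) fun e => mapP m k l (.mk e V' :: a) := rfl
  rw [this]
  refine congrArg (mono q) (funext fun V => ?_)
  rw [slet_eq, slet_eq, mod_eq']

lemma mapP_nil (m : ℕ) (k : List RowD → Bool) (a : List RowD) : mapP m k [] a = k a := rfl

lemma fo_M20 {b : Lat} (hb : Ok b) :
    fo M20 (fo M20 (pk 16 20 fun k => npol (al k) b)) = pk 16 20 (vd b) := by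
  have h2 := fo2_pk 20 0 (fun k => npol (al k) b) fun j _ => npol_lt hb j
  rw [add_zero, ← M20_def] at h2
  rw [h2]
  exact pk_congr fun j _ => rfl

lemma mapP_eq (d : ℕ) (hd : d ≤ 40) (k : List RowD → Bool) (L : List Lat)
    (hL : ∀ b ∈ L, b.1 + b.2.1 + b.2.2 ≤ d) (a : List RowD) :
    mapP M20 k (L.map (enc d)) a = k (L.reverse.map rd ++ a) := by
  induction L generalizing a with
  | nil => rw [List.map_nil, mapP_nil, List.reverse_nil, List.map_nil, List.nil_append]
  | cons b L ih =>
    have hb := hL b (by simp)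
    have hr : rd b = .mk (wtb b % 126) (pk 16 20 (vd b)) := by rw [rd]
    rw [List.map_cons, mapP_cons, mono_eq d hd b hb, dot_wtb d hd b hb,
      ih fun b hb => hL b (List.mem_cons_of_mem _ hb), fo_M20 (ok_of hd hb), List.reverse_cons,
      List.map_append, List.append_assoc, List.map_cons, List.map_nil, List.cons_append, List.nil_append, hr]

lemma len_eq (l : List ℕ) : len l = l.length := by
  induction l with
  | nil => rfl
  | cons a l ih => exact congrArg Nat.succ ih

lemma split_eq (d c t : ℕ) (hd : d ≤ 40) (k : List ℕ → List ℕ → Bool) (L A B : List Lat)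
    (hL : ∀ b ∈ L, b.1 + b.2.1 + b.2.2 ≤ d) :
    split (wts c) t k (L.map (enc d)) (A.map (enc d)) (B.map (enc d)) =
      k (((L.filter fun b => ¬ val d c b ≤ t).reverse ++ A).map (enc d))
        (((L.filter fun b => val d c b ≤ t).reverse ++ B).map (enc d)) := by
  induction L generalizing A B with
  | nil => rfl
  | cons b L ih =>
    have h : split (wts c) t k ((b :: L).map (enc d)) (A.map (enc d)) (B.map (enc d)) =
      bif' (Nat.ble (dot (enc d b) (wts c)) t)
        (split (wts c) t k (L.map (enc d)) (A.map (enc d)) ((b :: B).map (enc d)))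
        (split (wts c) t k (L.map (enc d)) ((b :: A).map (enc d)) (B.map (enc d))) := rfl
    have hL' : ∀ b ∈ L, b.1 + b.2.1 + b.2.2 ≤ d := fun b hb => hL b (List.mem_cons_of_mem _ hb)
    rw [h, ih _ _ hL', ih _ _ hL', dot_val d c hd b (hL b (by simp))]
    by_cases hv : val d c b ≤ t
    · rw [Nat.ble_eq_true_of_le hv]
      simp [hv, bif']
    · have : Nat.ble (val d c b) t = false := by
        rw [← Bool.not_eq_true, Nat.ble_eq]; exact hv
      rw [this]
      simp [hv, bif', Nat.lt_of_not_le hv]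

end NS

/-! ### Part 7: soundness of the cutting procedure -/

namespace NS

open Finset

/-- the lattice points of the simplex -/
def Td (d : ℕ) : Finset Lat :=
  (range (d + 1) ×ˢ range (d + 1) ×ˢ range (d + 1)).filter fun b => b.1 + b.2.1 + b.2.2 ≤ d

lemma mem_Td {d : ℕ} {b : Lat} : b ∈ Td d ↔ b.1 + b.2.1 + b.2.2 ≤ d := by
  simp only [Td, mem_filter, mem_product, mem_range]
  omega

/-- `l` is a list of the codes of the elements of `S` -/
def RepS (d : ℕ) (S : Finset Lat) (l : List ℕ) : Prop :=
  ∃ L : List Lat, L.Nodup ∧ L.toFinset = S ∧ (∀ b ∈ L, b.1 + b.2.1 + b.2.2 ≤ d) ∧ l = L.map (enc d)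

lemma genZ_eq (q0 : ℕ) (k : List ℕ → Bool) (n : ℕ) (a : List ℕ) :
    genZ q0 k n a = k ((List.range n).map (fun z => q0 - z * 549688705024) ++ a) := by
  induction n generalizing a with
  | zero => rfl
  | succ n ih =>
    have h : genZ q0 k (n + 1) a = slet (Nat.sub q0 (Nat.mul n 549688705024)) fun q =>
      genZ q0 k n (q :: a) := rfl
    rw [h, slet_eq, ih, List.range_succ, List.map_append, List.append_assoc, List.map_cons, List.map_nil,
      List.cons_append, List.nil_append]
    rfl

lemma genY_eq (q0 m : ℕ) (k : List ℕ → Bool) (n : ℕ) (a : List ℕ) :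
    genY q0 m k n a = k ((List.range n).flatMap (fun y => (List.range (m - y)).map fun z =>
      q0 - y * 549755805696 - z * 549688705024) ++ a) := by
  induction n generalizing a with
  | zero => rfl
  | succ n ih =>
    have h : genY q0 m k (n + 1) a = slet (Nat.sub q0 (Nat.mul n 549755805696)) fun q =>
      slet (Nat.sub m n) fun n' => genZ q (genY q0 m k n) n' a := rfl
    rw [h, slet_eq, slet_eq, genZ_eq, ih, List.range_succ, List.flatMap_append, List.append_assoc,
      List.flatMap_singleton]
    rfl

lemma genX_eq (d : ℕ) (k : List ℕ → Bool) (n : ℕ) (a : List ℕ) :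
    genX d k n a = k ((List.range n).flatMap (fun x => (List.range (d + 1 - x)).flatMap fun y =>
      (List.range (d + 1 - x - y)).map fun z =>
      d * 549755813888 - x * 549755813887 - y * 549755805696 - z * 549688705024) ++ a) := by
  induction n generalizing a with
  | zero => rfl
  | succ n ih =>
    have h : genX d k (n + 1) a = slet (Nat.sub (Nat.mul d 549755813888) (Nat.mul n 549755813887)) fun q =>
      slet (Nat.sub (Nat.succ d) n) fun m => genY q m (genX d k n) m a := rfl
    rw [h, slet_eq, slet_eq, genY_eq, ih, List.range_succ, List.flatMap_append, List.append_assoc,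
      List.flatMap_singleton]
    rfl

/-- list of the points of the simplex -/
def TL (d : ℕ) : List Lat := (List.range (d + 1)).flatMap fun x => (List.range (d + 1 - x)).flatMap fun y =>
  (List.range (d + 1 - x - y)).map fun z => (x, y, z)

lemma mem_TL {d : ℕ} {b : Lat} : b ∈ TL d ↔ b.1 + b.2.1 + b.2.2 ≤ d := by
  obtain ⟨x, y, z⟩ := b
  simp only [TL, List.mem_flatMap, List.mem_range, List.mem_map, Prod.mk.injEq]
  constructor
  · rintro ⟨_, h1, _, h2, _, h3, rfl, rfl, rfl⟩
    omega
  · intro h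
    exact ⟨x, by omega, y, by omega, z, by omega, rfl, rfl, rfl⟩

lemma TL_nodup (d : ℕ) : (TL d).Nodup := by
  unfold TL
  rw [List.nodup_flatMap]
  constructor
  · intro x _
    rw [List.nodup_flatMap]
    constructor
    · intro y _
      refine List.Nodup.map ?_ List.nodup_range
      intro a b h; simpa using h
    · refine List.nodup_range.imp ?_
      intro a b hab c h1 h2
      simp only [List.mem_map] at h1 h2
      obtain ⟨_, _, rfl⟩ := h1
      obtain ⟨_, _, h⟩ := h2
      simp only [Prod.mk.injEq] at h
      omega
  · refine List.nodup_range.imp ?_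
    intro a b hab c h1 h2
    simp only [List.mem_map, List.mem_flatMap] at h1 h2
    obtain ⟨_, _, _, _, rfl⟩ := h1
    obtain ⟨_, _, _, _, h⟩ := h2
    simp only [Prod.mk.injEq] at h
    omega

lemma enc_sub (d x y z : ℕ) (h : x + y + z ≤ d) :
    (enc d ∘ fun z => (x, y, z)) z =
      d * 549755813888 - x * 549755813887 - y * 549755805696 - z * 549688705024 := by
  obtain ⟨e, he⟩ := Nat.exists_eq_add_of_le h
  obtain ⟨f, hf⟩ : ∃ f, f = d - x - y - z := ⟨_, rfl⟩
  have h2 : (enc d ∘ fun z => (x, y, z)) z = x + y * 2 ^ 13 + z * 2 ^ 26 + (d - x - y - z) * 2 ^ 39 := by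
    rw [Function.comp_apply, enc]
  rw [h2, ← hf]
  rw [show (2 : ℕ) ^ 13 = 8192 by norm_num, show (2 : ℕ) ^ 26 = 67108864 by norm_num,
    show (2 : ℕ) ^ 39 = 549755813888 by norm_num]
  omega

lemma genX_sound (d : ℕ) (k : List ℕ → Bool) (h : genX d k (Nat.succ d) [] = true) :
    ∃ l, RepS d (Td d) l ∧ k l = true := by
  refine ⟨(TL d).map (enc d), ⟨TL d, TL_nodup d, ?_, fun b => mem_TL.1, rfl⟩, ?_⟩
  · ext b; rw [List.mem_toFinset, mem_TL, mem_Td]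
  rw [genX_eq, List.append_nil] at h
  rw [← h]
  refine congrArg k ?_
  rw [TL]
  simp only [List.map_flatMap, List.map_map]
  refine List.flatMap_congr fun x hx => List.flatMap_congr fun y hy => List.map_congr_left fun z hz => ?_
  rw [List.mem_range] at hx hy hz
  exact enc_sub d x y z (by omega)

/-- upper part -/
def cutA (d c : ℕ) (S : Finset Lat) : Finset Lat := S.filter fun b => ¬ val d c b ≤ c >>> 24

/-- lower part -/
def cutC (d c : ℕ) (S : Finset Lat) : Finset Lat := S.filter fun b => val d c b ≤ c >>> 24

lemma RepS.le {d : ℕ} {S : Finset Lat} {l : List ℕ} (h : RepS d S l) : ∀ b ∈ S, b.1 + b.2.1 + b.2.2 ≤ d := by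
  obtain ⟨L, h1, rfl, h3, _⟩ := h
  simpa using h3

lemma cut_sound {d : ℕ} (hd : d ≤ 40) {S : Finset Lat} {l : List ℕ} (hl : RepS d S l) (c : ℕ)
    {k : List ℕ → List ℕ → Bool} (h : cut c l k = true) :
    ∃ a b, RepS d (cutA d c S) a ∧ RepS d (cutC d c S) b ∧ k a b = true := by
  obtain ⟨L, h1, h2, h3, rfl⟩ := hl
  have h4 : split (wts c) (c >>> 24) k (L.map (enc d)) (([] : List Lat).map (enc d))
    (([] : List Lat).map (enc d)) = true := h
  rw [split_eq d c _ hd k L [] [] h3, List.append_nil, List.append_nil] at h4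
  refine ⟨_, _, ⟨_, ?_, ?_, ?_, rfl⟩, ⟨_, ?_, ?_, ?_, rfl⟩, h4⟩
  · exact List.nodup_reverse.2 (h1.filter _)
  · ext b; rw [← h2]; simp [cutA]
  · intro b hb; exact h3 b (by simp at hb; exact hb.1)
  · exact List.nodup_reverse.2 (h1.filter _)
  · ext b; rw [← h2]; simp [cutC]
  · intro b hb; exact h3 b (by simp at hb; exact hb.1)

lemma isCut (d c : ℕ) (S : Finset Lat) (hS : ∀ b ∈ S, b.1 + b.2.1 + b.2.2 ≤ d) :
    IsCut S (cutA d c S) (cutC d c S) := by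
  have key : ∀ b ∈ S, aff ((d : ℤ) * (c % 64 : ℕ)) (((c / 64 % 64 : ℕ) : ℤ) - (c % 64 : ℕ),
      ((c / 4096 % 64 : ℕ) : ℤ) - (c % 64 : ℕ), ((c / 262144 % 64 : ℕ) : ℤ) - (c % 64 : ℕ)) b =
      (val d c b : ℕ) := by
    intro b hb
    have h := hS b hb
    obtain ⟨e, he⟩ := Nat.exists_eq_add_of_le h
    have h2 : d - b.1 - b.2.1 - b.2.2 = e := by omega
    rw [val, h2, aff, he]
    push_cast
    ring
  refine ⟨(d : ℤ) * (c % 64 : ℕ), (((c / 64 % 64 : ℕ) : ℤ) - (c % 64 : ℕ),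
      ((c / 4096 % 64 : ℕ) : ℤ) - (c % 64 : ℕ), ((c / 262144 % 64 : ℕ) : ℤ) - (c % 64 : ℕ)),
      (c >>> 24 : ℕ), ?_, fun b hb => ?_, fun b hb => ?_⟩
  · ext b
    simp only [cutA, cutC, mem_union, mem_filter]
    tauto
  · rw [key b (mem_of_mem_filter b hb)]
    have := (mem_filter.1 hb).2
    exact_mod_cast not_le.1 this
  · rw [key b (mem_of_mem_filter b hb)]
    exact_mod_cast (mem_filter.1 hb).2

/-- row data of the elements of `S` -/
def RepR (S : Finset Lat) (r : List RowD) : Prop :=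
  ∃ L : List Lat, L.Nodup ∧ L.toFinset = S ∧ (∀ b ∈ L, Ok b) ∧ r = L.map rd

lemma mapP_sound {d : ℕ} (hd : d ≤ 40) {S : Finset Lat} {l : List ℕ} (hl : RepS d S l)
    {k : List RowD → Bool} (h : mapP M20 k l [] = true) : ∃ r, RepR S r ∧ k r = true := by
  obtain ⟨L, h1, h2, h3, rfl⟩ := hl
  rw [mapP_eq d hd k L h3, List.append_nil] at h
  refine ⟨_, ⟨L.reverse, List.nodup_reverse.2 h1, ?_, fun b hb => ok_of hd (h3 b (by simpa using hb)), rfl⟩, h⟩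
  rw [← h2]; ext b; simp

lemma len_sound {d : ℕ} {S : Finset Lat} {l : List ℕ} (hl : RepS d S l) : len l = S.card := by
  obtain ⟨L, h1, rfl, h3, rfl⟩ := hl
  rw [len_eq, List.length_map, List.toFinset_card_of_nodup h1]

lemma tstR {S : Finset Lat} {r : List RowD} {n : ℕ} (hr : RepR S r) (hn : S.card = n) {bs : List Blk}
    {μ : Multiset ℕ} (hR : Real' bs μ) (h : tst n r bs = true) : Inj S μ := by
  obtain ⟨L, h1, rfl, h3, rfl⟩ := hr
  refine tst_sound hR h3 ?_ h1 h
  rw [← hn, List.toFinset_card_of_nodup h1]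

lemma wt_add (μ ν : Multiset ℕ) : wt (μ + ν) = wt μ + wt ν := by simp [wt]

lemma wt_rep (n m : ℕ) : wt (Multiset.replicate n m) = n * (AL m).card := by simp [wt]

lemma AL_card : (AL 4).card = 20 ∧ (AL 3).card = 10 ∧ (AL 2).card = 4 ∧ (AL 1).card = 1 := by decide

lemma wt_ms (a b c : ℕ) : wt (ms a b c) = a * 20 + b * 10 + c * 4 := by
  obtain ⟨h1, h2, h3, _⟩ := AL_card
  rw [ms, wt_add, wt_add, wt_rep, wt_rep, wt_rep, h1, h2, h3]

lemma Real'_blks (n4 n3 n2 n1 : ℕ) (h4 : n4 ≤ 3) (h3 : n3 ≤ 7) (h2 : n2 ≤ 16) (h1 : n1 ≤ 26) :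
    Real' (blks T0 n4 n3 n2 n1) (ms n4 n3 n2 + Multiset.replicate n1 1) := by
  have := Real'_4 (Real'_3 (Real'_2 (Real'_1 Real'_nil n1 h1) n2 h2) n3 h3) n4 h4
  have e : ms n4 n3 n2 + Multiset.replicate n1 1 = Multiset.replicate n4 4 + (Multiset.replicate n3 3 +
    (Multiset.replicate n2 2 + (Multiset.replicate n1 1 + 0))) := by
    unfold ms; abel
  rw [e]
  exact this

lemma t3_sound {S : Finset Lat} {r : List RowD} {n g : ℕ} (hr : RepR S r) (hn : S.card = n) (hg : g ≤ 3)
    (h : t3 T0 n g r = true) : Inj S (ms g 0 0) ∧ Inj S (ms 0 (2 * g) 0) ∧ Inj S (ms 0 0 (5 * g)) := by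
  have h0 : band (tst n r [.mk (tabv 0 20 3) 960 20 g]) (band (tst n r [.mk (tabv 3 10 7) 1120 10 (2 * g)])
      (tst n r [.mk (tabv 10 4 16) 1024 4 (5 * g)])) = true := h
  obtain ⟨h1, h2⟩ := band_true h0
  obtain ⟨h2, h3⟩ := band_true h2
  refine ⟨?_, ?_, ?_⟩
  · have := tstR hr hn (Real'_4 Real'_nil g hg) h1
    simpa [ms] using this
  · have := tstR hr hn (Real'_3 Real'_nil (2 * g) (by omega)) h2
    simpa [ms] using this
  · have := tstR hr hn (Real'_2 Real'_nil (5 * g) (by omega)) h3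
    simpa [ms] using this

lemma leafE_sound {d : ℕ} (hd : d ≤ 40) {S : Finset Lat} {l : List ℕ} (hl : RepS d S l) {n g : ℕ}
    (hg : g ≤ 3) (h : leafE T0 n g M20 l = true) :
    S.card = n ∧ Inj S (ms g 0 0) ∧ Inj S (ms 0 (2 * g) 0) ∧ Inj S (ms 0 0 (5 * g)) := by
  obtain ⟨h1, h2⟩ := band_true h
  have hn : S.card = n := by rw [← len_sound hl]; exact Nat.eq_of_beq_eq_true h1
  obtain ⟨r, hr, h3⟩ := mapP_sound hd hl h2
  exact ⟨hn, t3_sound hr hn hg h3⟩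

lemma Inj.both {S : Finset Lat} {a b c : ℕ} (h : Inj S (ms a b c)) (hc : S.card = a * 20 + b * 10 + c * 4) :
    Inj S (ms a b c) ∧ Surj S (ms a b c) := ⟨h, h.surj (by rw [wt_ms, hc])⟩

lemma leaf40 {d : ℕ} (hd : d ≤ 40) {S : Finset Lat} {l : List ℕ} (hl : RepS d S l)
    (h : leafE T0 40 2 M20 l = true) : Ext0 S (EE 1) := by
  obtain ⟨hn, h1, h2, h3⟩ := leafE_sound hd hl (by norm_num) h
  rintro v ⟨a, b, c, habc, rfl⟩
  have : (a = 1 ∧ b = 0 ∧ c = 0) ∨ (a = 0 ∧ b = 1 ∧ c = 0) ∨ (a = 0 ∧ b = 0 ∧ c = 1) := by omega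
  rcases this with ⟨rfl, rfl, rfl⟩ | ⟨rfl, rfl, rfl⟩ | ⟨rfl, rfl, rfl⟩
  · exact h1.both hn
  · exact h2.both hn
  · exact h3.both hn

lemma leaf20 {d : ℕ} (hd : d ≤ 40) {S : Finset Lat} {l : List ℕ} (hl : RepS d S l)
    (h : leafE T0 20 1 M20 l = true) : Ext0 S (FF 1) := by
  obtain ⟨hn, h1, h2, h3⟩ := leafE_sound hd hl (by norm_num) h
  rintro ⟨a, b, c⟩ habc
  have habc : a + b + c = 1 := habc
  have : (a = 1 ∧ b = 0 ∧ c = 0) ∨ (a = 0 ∧ b = 1 ∧ c = 0) ∨ (a = 0 ∧ b = 0 ∧ c = 1) := by omega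
  rcases this with ⟨rfl, rfl, rfl⟩ | ⟨rfl, rfl, rfl⟩ | ⟨rfl, rfl, rfl⟩
  · exact h1.both hn
  · exact h2.both hn
  · exact h3.both hn

lemma leafM_sound {d : ℕ} (hd : d ≤ 40) {S : Finset Lat} {l : List ℕ} (hl : RepS d S l)
    (h : leafM T0 M20 l = true) : Ext0 S (FF 2) := by
  obtain ⟨h1, h2⟩ := band_true h
  obtain ⟨hn, ha, hb, hc⟩ := leafE_sound hd hl (by norm_num) h1
  obtain ⟨r, hr, h3⟩ := mapP_sound hd hl h2
  obtain ⟨h4, h5⟩ := band_true h3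
  obtain ⟨h5, h6⟩ := band_true h5
  have i1 := tstR hr hn (Real'_blks 1 2 0 0 (by norm_num) (by norm_num) (by norm_num) (by norm_num)) h4
  have i2 := tstR hr hn (Real'_blks 1 0 5 0 (by norm_num) (by norm_num) (by norm_num) (by norm_num)) h5
  have i3 := tstR hr hn (Real'_blks 0 2 5 0 (by norm_num) (by norm_num) (by norm_num) (by norm_num)) h6
  rw [Multiset.replicate_zero, add_zero] at i1 i2 i3
  rintro ⟨a, b, c⟩ habc
  have habc : a + b + c = 2 := habc
  have : (a = 2 ∧ b = 0 ∧ c = 0) ∨ (a = 0 ∧ b = 2 ∧ c = 0) ∨ (a = 0 ∧ b = 0 ∧ c = 2) ∨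
    (a = 1 ∧ b = 1 ∧ c = 0) ∨ (a = 1 ∧ b = 0 ∧ c = 1) ∨ (a = 0 ∧ b = 1 ∧ c = 1) := by omega
  rcases this with ⟨rfl, rfl, rfl⟩ | ⟨rfl, rfl, rfl⟩ | ⟨rfl, rfl, rfl⟩ | ⟨rfl, rfl, rfl⟩ | ⟨rfl, rfl, rfl⟩ |
    ⟨rfl, rfl, rfl⟩
  · exact ha.both hn
  · exact hb.both hn
  · exact hc.both hn
  · exact i1.both hn
  · exact i2.both hn
  · exact i3.both hn

lemma ns_sound {S : Finset Lat} {r : List RowD} {n : ℕ} (hr : RepR S r) (hn : S.card = n) (n4 n3 n2 : ℕ)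
    (h4 : n4 ≤ 3) (h3 : n3 ≤ 7) (h2 : n2 ≤ 16) (h1 : n ≤ n4 * 20 + n3 * 10 + n2 * 4 + 26)
    (h : ns T0 n r n4 n3 n2 = true) :
    (n ≤ n4 * 20 + n3 * 10 + n2 * 4 ∧ Inj S (ms n4 n3 n2)) ∨ Surj S (ms n4 n3 n2) := by
  obtain ⟨n1, hn1⟩ : ∃ n1, n1 = n - (20 * n4 + (10 * n3 + 4 * n2)) := ⟨_, rfl⟩
  have h0 : tst n r (blks T0 n4 n3 n2 n1) = true := by
    rw [ns, slet_eq] at h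
    have e : Nat.sub n (Nat.add (Nat.mul 20 n4) (Nat.add (Nat.mul 10 n3) (Nat.mul 4 n2))) = n1 := hn1.symm
    rw [e] at h
    exact h
  have hi := tstR hr hn (Real'_blks n4 n3 n2 n1 h4 h3 h2 (by omega)) h0
  by_cases hle : n ≤ n4 * 20 + n3 * 10 + n2 * 4
  · left
    refine ⟨hle, ?_⟩
    rwa [show n1 = 0 by omega, Multiset.replicate_zero, add_zero] at hi
  · right
    refine (hi.surj ?_).mono (Multiset.le_add_right _ _)
    rw [wt_add, wt_ms, wt_rep, AL_card.2.2.2, hn]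
    omega

lemma allB_sound {f : ℕ → Bool} {n : ℕ} (h : allB f n = true) (i : ℕ) (hi : i < n) : f i = true := by
  induction n with
  | zero => omega
  | succ n ih =>
    have h' : band (allB f n) (slet n f) = true := h
    obtain ⟨h1, h2⟩ := band_true h'
    rw [slet_eq] at h2
    rcases Nat.lt_succ_iff_lt_or_eq.1 hi with hlt | rfl
    · exact ih h1 hlt
    · exact h2

end NS

/-! ### Part 8: soundness of the check -/

namespace NS

open Finset

lemma leafR_sound {d : ℕ} (hd : d ≤ 40) {S : Finset Lat} {l : List ℕ} (hl : RepS d S l) {gx : ℕ}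
    (hg1 : 1 ≤ gx) (hg2 : gx ≤ 3) (h : leafR T0 gx M20 l = true) : ROK S gx := by
  rw [leafR, slet_eq] at h
  obtain ⟨hA, hB⟩ := band_true h
  obtain ⟨hA1, hA2⟩ := band_true hA
  have hn := (len_sound hl).symm
  have hA1 := Nat.le_of_ble_eq_true hA1
  have hA2 := Nat.le_of_ble_eq_true hA2
  obtain ⟨r, hr, h1⟩ := mapP_sound hd hl hB
  obtain ⟨h1, h2⟩ := band_true h1
  obtain ⟨h2, h3⟩ := band_true h2
  obtain ⟨x4, x3, x2⟩ := t3_sound hr hn hg2 h2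
  have key : ∀ g e z, 1 ≤ g → g < gx → e ≤ 1 → z ≤ 4 →
      (Inj S (ms g e z) ∨ Surj S (ms g e z)) ∧
      (Inj S (ms 0 (2 * g + e) z) ∨ Surj S (ms 0 (2 * g + e) z)) ∧
      (Inj S (ms 0 e (5 * g + z)) ∨ Surj S (ms 0 e (5 * g + z))) := by
    intro g e z g1 g2 he hz
    obtain ⟨g, rfl⟩ := Nat.exists_eq_add_of_le' g1
    have g3 : g < Nat.pred gx := by rw [Nat.pred_eq_sub_one]; omega
    have h4 := allB_sound (allB_sound (allB_sound h3 g g3) e (by omega)) z (by omega)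
    obtain ⟨h4, h5⟩ := band_true h4
    obtain ⟨h5, h6⟩ := band_true h5
    refine ⟨?_, ?_, ?_⟩
    · exact (ns_sound hr hn _ _ _ (by omega) (by omega) (by omega) (by omega) h4).imp_left And.right
    · have e1 : Nat.add (Nat.mul 2 (Nat.succ g)) e = 2 * (g + 1) + e := rfl
      rw [e1] at h5
      exact (ns_sound hr hn _ _ _ (by omega) (by omega) (by omega) (by omega) h5).imp_left And.right
    · have e1 : Nat.add (Nat.mul 5 (Nat.succ g)) z = 5 * (g + 1) + z := rfl
      rw [e1] at h6
      exact (ns_sound hr hn _ _ _ (by omega) (by omega) (by omega) (by omega) h6).imp_left And.right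
  refine ⟨hg1, hg2, ?_, x4, x3, x2, fun g e z a b c d => (key g e z a b c d).1,
    fun g e z a b c d => (key g e z a b c d).2.1, fun g e z a b c d => (key g e z a b c d).2.2⟩
  rcases ns_sound hr hn 0 1 4 (by omega) (by omega) (by omega) (by omega) h1 with ⟨h4, h5⟩ | h4
  · exact h5.surj (by rw [wt_ms]; omega)
  · exact h4

lemma pureT_sound {d : ℕ} (hd : d ≤ 40) (t : CTree) {S : Finset Lat} {l : List ℕ} (hl : RepS d S l)
    (h : pureT T0 M20 t l = true) : ∃ k, 1 ≤ k ∧ Ext0 S (EE k) := by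
  induction t generalizing S l with
  | l => exact ⟨1, le_rfl, leaf40 hd hl h⟩
  | n c a b iha ihb =>
    have h' : cut c l (fun u v => band (pureT T0 M20 a u) (pureT T0 M20 b v)) = true := h
    obtain ⟨u, v, hu, hv, huv⟩ := cut_sound hd hl c h'
    obtain ⟨h1, h2⟩ := band_true huv
    obtain ⟨k1, hk1, e1⟩ := iha hu h1
    obtain ⟨k2, hk2, e2⟩ := ihb hv h2
    exact ⟨k1 + k2, by omega, (isCut d c S hl.le).ext0 (Spl_EE k1 k2) e1 e2⟩

/-- number of cuts -/
def slen : Spine → ℕ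
  | .nil => 0
  | .cons _ _ s => slen s + 1

lemma spineT_sound {d : ℕ} (hd : d ≤ 40) (s : Spine) {S : Finset Lat} {l : List ℕ} (hl : RepS d S l)
    {q : List ℕ → Bool} {n : ℕ} {Q : Finset Lat → Prop}
    (hq : ∀ S l, RepS d S l → q l = true → ∃ R, Q R ∧ Ext S R (EF 0 n))
    (h : spineT T0 M20 q s l = true) : ∃ R k, slen s ≤ k ∧ Q R ∧ Ext S R (EF k n) := by
  induction s generalizing S l with
  | nil =>
    obtain ⟨R, h1, h2⟩ := hq S l hl h
    exact ⟨R, 0, le_rfl, h1, h2⟩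
  | cons c t s ih =>
    have h' : cut c l (fun u v => band (pureT T0 M20 t u) (spineT T0 M20 q s v)) = true := h
    obtain ⟨u, v, hu, hv, huv⟩ := cut_sound hd hl c h'
    obtain ⟨h1, h2⟩ := band_true huv
    obtain ⟨k1, hk1, e1⟩ := pureT_sound hd t hu h1
    obtain ⟨R, k, hk, hR, e2⟩ := ih hv h2
    exact ⟨R, k1 + k, by rw [slen]; omega, hR, (isCut d c S hl.le).extR (Spl_EF k1 k n) e1 e2⟩

lemma optCut_sound {d : ℕ} (hd : d ≤ 40) {S : Finset Lat} {l : List ℕ} (hl : RepS d S l) {c m n : ℕ}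
    {f q : List ℕ → Bool} {Q : Finset Lat → Prop}
    (hf : ∀ S l, RepS d S l → f l = true → Ext0 S (FF m))
    (hq : ∀ S l, RepS d S l → q l = true → ∃ R, Q R ∧ Ext S R (FF n))
    (h : optCut c f l q = true) :
    ∃ R, Q R ∧ Ext S R (FF ((if c = 0 then 0 else m) + n)) := by
  rcases bif_true h with ⟨h1, h2⟩ | ⟨h1, h2⟩
  · have : c = 0 := Nat.eq_of_beq_eq_true h1
    rw [if_pos this, zero_add]
    exact hq S l hl h2
  · have : c ≠ 0 := Nat.ne_of_beq_eq_false h1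
    rw [if_neg this]
    obtain ⟨u, v, hu, hv, huv⟩ := cut_sound hd hl c h2
    obtain ⟨h1, h2⟩ := band_true huv
    obtain ⟨R, hR, e⟩ := hq _ _ hv h2
    exact ⟨R, hR, (isCut d c S hl.le).extR (Spl_FF m n) (hf _ _ hu h1) e⟩

/-- number of extra groups -/
def nx (cu cm : ℕ) : ℕ := (if cu = 0 then 0 else 1) + (if cm = 0 then 0 else 2)

/-- the last piece is good -/
def Good (gx : ℕ) (pr : Bool) (R : Finset Lat) : Prop := ROK R gx ∧ (pr = true → Ext0 R (EE 1))

lemma FF_zero {S : Finset Lat} : Ext S S (FF 0) := by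
  rintro ⟨a, b, c⟩ h
  have h : a + b + c = 0 := h
  obtain ⟨rfl, rfl, rfl⟩ : a = 0 ∧ b = 0 ∧ c = 0 := by omega
  intro μ
  have : grp (0, 0, 0) = 0 := by simp [grp, ms]
  rw [this, zero_add]
  exact ⟨id, id⟩

lemma EF_zero (n : ℕ) : EF 0 n ⊆ FF n := by
  rintro v ⟨_, ⟨a, b, c, h, rfl⟩, w, hw, rfl⟩
  obtain ⟨rfl, rfl, rfl⟩ : a = 0 ∧ b = 0 ∧ c = 0 := by omega
  have hw : w.1 + w.2.1 + w.2.2 = n := hw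
  show 2 * 0 + w.1 + (2 * 0 + w.2.1) + (2 * 0 + w.2.2) = n
  omega

/-- the part of the check after the first cut -/
noncomputable def chkS (s : Spine) (cu cm gx : ℕ) (pr : Bool) : List ℕ → Bool :=
  spineT T0 M20 (fun l =>
      optCut cu (leafE T0 20 1 M20) l fun l1 => optCut cm (leafM T0 M20) l1 fun l2 =>
      band (leafR T0 gx M20 l2) (bif' pr (leafE T0 40 2 M20 l2) true)) s

lemma chkS_sound {d : ℕ} (hd : d ≤ 40) {s : Spine} {cu cm gx : ℕ} {pr : Bool} {S : Finset Lat} {l : List ℕ}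
    (hl : RepS d S l) (hg1 : 1 ≤ gx) (hg2 : gx ≤ 3) (h : chkS s cu cm gx pr l = true) :
    ∃ R k, slen s ≤ k ∧ Good gx pr R ∧ Ext S R (EF k (nx cu cm)) := by
  refine spineT_sound hd s hl ?_ h
  intro S l hl h
  have := optCut_sound hd hl (m := 1) (n := if cm = 0 then 0 else 2) (Q := Good gx pr)
    (fun S l hl h => leaf20 hd hl h) ?_ h
  · obtain ⟨R, h1, h2⟩ := this
    exact ⟨R, h1, h2.mono (EF_zero _)⟩
  intro S l hl h
  have := optCut_sound hd hl (m := 2) (n := 0) (Q := Good gx pr)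
    (fun S l hl h => leafM_sound hd hl h) ?_ h
  · exact this
  intro S l hl h
  obtain ⟨h1, h2⟩ := band_true h
  refine ⟨S, ⟨leafR_sound hd hl hg1 hg2 h1, ?_⟩, FF_zero⟩
  intro hp
  subst hp
  exact leaf40 hd hl h2

lemma chk_direct {d : ℕ} (hd : d ≤ 40) {s : Spine} {cu cm gx : ℕ} {pr : Bool}
    (hg1 : 1 ≤ gx) (hg2 : gx ≤ 3) (h : chk d 0 s cu cm gx pr = true) :
    ∃ R k, slen s ≤ k ∧ Good gx pr R ∧ Ext (Td d) R (EF k (nx cu cm)) := by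
  rw [chk, withTabs_eq] at h
  obtain ⟨l, hl, h1⟩ := genX_sound d _ h
  have h2 : bif' (Nat.beq 0 0) (chkS s cu cm gx pr l) (cut 0 l fun a _ => chkS s cu cm gx pr a) = true := h1
  exact chkS_sound hd hl hg1 hg2 h2

lemma chk_slab {d e : ℕ} (hd : d ≤ 40) (he : e ≤ d) {c0 : ℕ} (hc : c0 = e * 2 ^ 24 + 266304) {s : Spine}
    {cu cm gx : ℕ} {pr : Bool} (hg1 : 1 ≤ gx) (hg2 : gx ≤ 3) (h : chk d c0 s cu cm gx pr = true)
    {m : ℕ} (hm : 2 ≤ m) (hE : Ext0 (Td e) (FF m)) :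
    ∃ R n, m ≤ n ∧ Good gx pr R ∧ Ext (Td d) R (FF n) := by
  rw [chk, withTabs_eq] at h
  obtain ⟨l, hl, h1⟩ := genX_sound d _ h
  have h2 : bif' (Nat.beq c0 0) (chkS s cu cm gx pr l) (cut c0 l fun a _ => chkS s cu cm gx pr a) = true := h1
  rcases bif_true h2 with ⟨h3, _⟩ | ⟨_, h3⟩
  · have := Nat.eq_of_beq_eq_true h3
    omega
  obtain ⟨a, b, ha, hb, h4⟩ := cut_sound hd hl c0 h3
  obtain ⟨R, k, hk, hR, hX⟩ := chkS_sound hd ha hg1 hg2 h4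
  have hC : cutC d c0 (Td d) = Td e := by
    ext b
    have e1 : val d c0 b = b.1 + b.2.1 + b.2.2 := by
      rw [val, show c0 % 64 = 0 by omega, show c0 / 64 % 64 = 1 by omega, show c0 / 4096 % 64 = 1 by omega,
        show c0 / 262144 % 64 = 1 by omega]
      omega
    have e2 : c0 >>> 24 = e := by rw [Nat.shiftRight_eq_div_pow]; omega
    rw [cutC, mem_filter, mem_Td, mem_Td, e1, e2]
    omega
  have hcut := isCut d c0 (Td d) hl.le
  rw [hC] at hcut
  exact ⟨R, 2 * k + nx cu cm + m, by omega, hR, hcut.extL (Spl_EF_FF k (nx cu cm) m hm) hX hE⟩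

/-- conclusion for the simplex of degree `d` -/
def Fin' (d : ℕ) : Prop := ∀ x y z, Inj (Td d) (ms x y z) ∨ Surj (Td d) (ms x y z)

/-- the simplex may be used for higher degrees -/
def Base (d : ℕ) : Prop := ∃ m, 6 ≤ m ∧ Ext0 (Td d) (FF m)

lemma finish {d gx : ℕ} {pr : Bool} (h : ∃ R n, 6 ≤ n ∧ Good gx pr R ∧ Ext (Td d) R (FF n)) :
    Fin' d ∧ (pr = true → Base d) := by
  obtain ⟨R, n, hn, ⟨h1, h2⟩, h3⟩ := h
  refine ⟨final_comb hn h3 h1, fun hp => ⟨2 * 1 + n, by omega, ?_⟩⟩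
  exact h3.ext0 (Spl_FF_EE n 1 (by omega)) (h2 hp)

theorem direct {d : ℕ} {s : Spine} {cu cm gx : ℕ} {pr : Bool} (h : chk d 0 s cu cm gx pr = true)
    (hd : d ≤ 40) (hg1 : 1 ≤ gx) (hg2 : gx ≤ 3) (hm : cm ≠ 0) (hs : 2 ≤ slen s) :
    Fin' d ∧ (pr = true → Base d) := by
  obtain ⟨R, k, hk, hR, hX⟩ := chk_direct hd hg1 hg2 h
  have hn : 2 ≤ nx cu cm := by rw [nx, if_neg hm]; omega
  exact finish ⟨R, 2 * k + nx cu cm, by omega, hR, hX.mono (FF_sub_EF k _ hn)⟩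

theorem slab {d e c0 : ℕ} {s : Spine} {cu cm gx : ℕ} {pr : Bool} (h : chk d c0 s cu cm gx pr = true)
    (hE : Base e) (hc : c0 = e * 2 ^ 24 + 266304)
    (hd : d ≤ 40) (he : e ≤ d) (hg1 : 1 ≤ gx) (hg2 : gx ≤ 3) :
    Fin' d ∧ (pr = true → Base d) := by
  obtain ⟨m, hm, hE⟩ := hE
  obtain ⟨R, n, hn, hR, hX⟩ := chk_slab hd he hc hg1 hg2 h (by omega) hE
  exact finish ⟨R, n, by omega, hR, hX⟩

end NS

/-! ### Part 9: from lattice points to forms -/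

namespace NS

open Finset MvPolynomial Topology Filter

/-- falling factorial -/
def df (x n : ℕ) : ℚ := (x.descFactorial n : ℚ)

lemma df_zero (x : ℕ) : df x 0 = 1 := by simp [df]

lemma df_succ (x n : ℕ) : df x (n + 1) = ((x : ℚ) - n) * df x n := by
  unfold df
  rw [Nat.descFactorial_succ]
  rcases le_or_gt n x with h | h
  · push_cast [h]; ring
  · rw [Nat.descFactorial_eq_zero_iff_lt.2 h]; simp

lemma pow_of_df (S : Finset Lat) (w : Lat → ℚ) (m : ℕ)
    (h : ∀ n1 n2 n3, n1 + n2 + n3 < m → ∑ b ∈ S, df b.1 n1 * df b.2.1 n2 * df b.2.2 n3 * w b = 0)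
    (a1 a2 a3 : ℕ) (ha : a1 + a2 + a3 < m) :
    ∑ b ∈ S, (b.1 : ℚ) ^ a1 * (b.2.1 : ℚ) ^ a2 * (b.2.2 : ℚ) ^ a3 * w b = 0 := by
  have h3 : ∀ a3 n1 n2 n3, n1 + n2 + n3 + a3 < m →
      ∑ b ∈ S, (b.2.2 : ℚ) ^ a3 * (df b.1 n1 * df b.2.1 n2 * df b.2.2 n3) * w b = 0 := by
    intro a3
    induction a3 with
    | zero => intro n1 n2 n3 hn; simpa using h n1 n2 n3 (by omega)
    | succ k ih =>
      intro n1 n2 n3 hn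
      have e1 := ih n1 n2 (n3 + 1) (by omega)
      have e2 := ih n1 n2 n3 (by omega)
      have : ∑ b ∈ S, (b.2.2 : ℚ) ^ (k + 1) * (df b.1 n1 * df b.2.1 n2 * df b.2.2 n3) * w b
          = ∑ b ∈ S, (b.2.2 : ℚ) ^ k * (df b.1 n1 * df b.2.1 n2 * df b.2.2 (n3 + 1)) * w b
          + n3 * ∑ b ∈ S, (b.2.2 : ℚ) ^ k * (df b.1 n1 * df b.2.1 n2 * df b.2.2 n3) * w b := by
        rw [mul_sum, ← sum_add_distrib]
        refine sum_congr rfl fun b _ => ?_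
        rw [df_succ]; ring
      rw [this, e1, e2]; ring
  have h2 : ∀ a2 a3 n1 n2, n1 + n2 + a2 + a3 < m →
      ∑ b ∈ S, (b.2.1 : ℚ) ^ a2 * (b.2.2 : ℚ) ^ a3 * (df b.1 n1 * df b.2.1 n2) * w b = 0 := by
    intro a2 a3
    induction a2 with
    | zero => intro n1 n2 hn; simpa [df_zero] using h3 a3 n1 n2 0 (by omega)
    | succ k ih =>
      intro n1 n2 hn
      have e1 := ih n1 (n2 + 1) (by omega)
      have e2 := ih n1 n2 (by omega)
      have : ∑ b ∈ S, (b.2.1 : ℚ) ^ (k + 1) * (b.2.2 : ℚ) ^ a3 * (df b.1 n1 * df b.2.1 n2) * w b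
          = ∑ b ∈ S, (b.2.1 : ℚ) ^ k * (b.2.2 : ℚ) ^ a3 * (df b.1 n1 * df b.2.1 (n2 + 1)) * w b
          + n2 * ∑ b ∈ S, (b.2.1 : ℚ) ^ k * (b.2.2 : ℚ) ^ a3 * (df b.1 n1 * df b.2.1 n2) * w b := by
        rw [mul_sum, ← sum_add_distrib]
        refine sum_congr rfl fun b _ => ?_
        rw [df_succ]; ring
      rw [this, e1, e2]; ring
  have h1 : ∀ a1 n1, n1 + a1 + a2 + a3 < m →
      ∑ b ∈ S, (b.1 : ℚ) ^ a1 * (b.2.1 : ℚ) ^ a2 * (b.2.2 : ℚ) ^ a3 * df b.1 n1 * w b = 0 := by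
    intro a1
    induction a1 with
    | zero => intro n1 hn; simpa [df_zero] using h2 a2 a3 n1 0 (by omega)
    | succ k ih =>
      intro n1 hn
      have e1 := ih (n1 + 1) (by omega)
      have e2 := ih n1 (by omega)
      have : ∑ b ∈ S, (b.1 : ℚ) ^ (k + 1) * (b.2.1 : ℚ) ^ a2 * (b.2.2 : ℚ) ^ a3 * df b.1 n1 * w b
          = ∑ b ∈ S, (b.1 : ℚ) ^ k * (b.2.1 : ℚ) ^ a2 * (b.2.2 : ℚ) ^ a3 * df b.1 (n1 + 1) * w b
          + n1 * ∑ b ∈ S, (b.1 : ℚ) ^ k * (b.2.1 : ℚ) ^ a2 * (b.2.2 : ℚ) ^ a3 * df b.1 n1 * w b := by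
        rw [mul_sum, ← sum_add_distrib]
        refine sum_congr rfl fun b _ => ?_
        rw [df_succ]; ring
      rw [this, e1, e2]; ring
  simpa [df_zero] using h1 a1 0 (by omega)

lemma df_of_pow (d : ℕ) (w : Lat → ℚ) (m : ℕ)
    (h : ∀ a1 a2 a3, a1 + a2 + a3 < m →
      ∑ b ∈ Td d, (b.1 : ℚ) ^ a1 * (b.2.1 : ℚ) ^ a2 * (b.2.2 : ℚ) ^ a3 * w b = 0)
    (n0 n1 n2 n3 : ℕ) (hn : n0 + n1 + n2 + n3 < m) :
    ∑ b ∈ Td d, df (d - b.1 - b.2.1 - b.2.2) n0 * df b.1 n1 * df b.2.1 n2 * df b.2.2 n3 * w b = 0 := by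
  -- one variable at a time
  have step : ∀ (k : ℕ) (D : Lat → ℚ), (∀ a1 a2 a3, a1 + a2 + a3 < k + 1 →
      ∑ b ∈ Td d, (b.1 : ℚ) ^ a1 * (b.2.1 : ℚ) ^ a2 * (b.2.2 : ℚ) ^ a3 * D b = 0) →
      ∀ c0 c1 c2 c3 : ℚ, ∀ a1 a2 a3, a1 + a2 + a3 < k →
      ∑ b ∈ Td d, (b.1 : ℚ) ^ a1 * (b.2.1 : ℚ) ^ a2 * (b.2.2 : ℚ) ^ a3 *
        ((c0 + c1 * b.1 + c2 * b.2.1 + c3 * b.2.2) * D b) = 0 := by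
    intro k D hD c0 c1 c2 c3 a1 a2 a3 ha
    have e0 := hD a1 a2 a3 (by omega)
    have e1 := hD (a1 + 1) a2 a3 (by omega)
    have e2 := hD a1 (a2 + 1) a3 (by omega)
    have e3 := hD a1 a2 (a3 + 1) (by omega)
    have : ∑ b ∈ Td d, (b.1 : ℚ) ^ a1 * (b.2.1 : ℚ) ^ a2 * (b.2.2 : ℚ) ^ a3 *
        ((c0 + c1 * b.1 + c2 * b.2.1 + c3 * b.2.2) * D b) =
        c0 * ∑ b ∈ Td d, (b.1 : ℚ) ^ a1 * (b.2.1 : ℚ) ^ a2 * (b.2.2 : ℚ) ^ a3 * D b +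
        c1 * ∑ b ∈ Td d, (b.1 : ℚ) ^ (a1 + 1) * (b.2.1 : ℚ) ^ a2 * (b.2.2 : ℚ) ^ a3 * D b +
        c2 * ∑ b ∈ Td d, (b.1 : ℚ) ^ a1 * (b.2.1 : ℚ) ^ (a2 + 1) * (b.2.2 : ℚ) ^ a3 * D b +
        c3 * ∑ b ∈ Td d, (b.1 : ℚ) ^ a1 * (b.2.1 : ℚ) ^ a2 * (b.2.2 : ℚ) ^ (a3 + 1) * D b := by
      rw [mul_sum, mul_sum, mul_sum, mul_sum, ← sum_add_distrib, ← sum_add_distrib, ← sum_add_distrib]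
      refine sum_congr rfl fun b _ => ?_
      ring
    rw [this, e0, e1, e2, e3]; ring
  have iter : ∀ (c : Lat → ℕ) (c0 c1 c2 c3 : ℚ),
      (∀ b ∈ Td d, (c b : ℚ) = c0 + c1 * b.1 + c2 * b.2.1 + c3 * b.2.2) →
      ∀ (n k : ℕ) (D : Lat → ℚ), (∀ a1 a2 a3, a1 + a2 + a3 < k + n →
      ∑ b ∈ Td d, (b.1 : ℚ) ^ a1 * (b.2.1 : ℚ) ^ a2 * (b.2.2 : ℚ) ^ a3 * D b = 0) →
      ∀ a1 a2 a3, a1 + a2 + a3 < k →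
      ∑ b ∈ Td d, (b.1 : ℚ) ^ a1 * (b.2.1 : ℚ) ^ a2 * (b.2.2 : ℚ) ^ a3 * (df (c b) n * D b) = 0 := by
    intro c c0 c1 c2 c3 hc n
    induction n with
    | zero => intro k D hD a1 a2 a3 ha; simpa [df_zero] using hD a1 a2 a3 (by omega)
    | succ n ih =>
      intro k D hD a1 a2 a3 ha
      have := ih (k + 1) D (fun a1 a2 a3 h => hD a1 a2 a3 (by omega))
      rw [← step k _ this (c0 - n) c1 c2 c3 a1 a2 a3 ha]
      refine sum_congr rfl fun b hb => ?_
      rw [df_succ, hc b hb]; ring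
  have r3 := iter (fun b => b.2.2) 0 0 0 1 (by simp) n3 (m - n3) w
    (fun a1 a2 a3 ha => h a1 a2 a3 (by omega))
  have r2 := iter (fun b => b.2.1) 0 0 1 0 (by simp) n2 (m - n3 - n2) _
    (fun a1 a2 a3 ha => r3 a1 a2 a3 (by omega))
  have r1 := iter (fun b => b.1) 0 1 0 0 (by simp) n1 (m - n3 - n2 - n1) _
    (fun a1 a2 a3 ha => r2 a1 a2 a3 (by omega))
  have r0 := iter (fun b => d - b.1 - b.2.1 - b.2.2) d (-1) (-1) (-1) (by
      intro b hb
      have := mem_Td.1 hb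
      rw [Nat.cast_sub (by omega), Nat.cast_sub (by omega), Nat.cast_sub (by omega)]; ring)
    n0 (m - n3 - n2 - n1 - n0) _ (fun a1 a2 a3 ha => r1 a1 a2 a3 (by omega))
  rw [← r0 0 0 0 (by omega)]
  refine sum_congr rfl fun b hb => ?_
  ring

/-- the exponent of the form of degree `d` -/
noncomputable def ex (d : ℕ) (b : Lat) : Fin 4 →₀ ℕ :=
  Finsupp.equivFunOnFinite.symm ![d - b.1 - b.2.1 - b.2.2, b.1, b.2.1, b.2.2]

lemma ex0 (d : ℕ) (b : Lat) : ex d b 0 = d - b.1 - b.2.1 - b.2.2 := rfl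
lemma ex1 (d : ℕ) (b : Lat) : ex d b 1 = b.1 := rfl
lemma ex2 (d : ℕ) (b : Lat) : ex d b 2 = b.2.1 := rfl
lemma ex3 (d : ℕ) (b : Lat) : ex d b 3 = b.2.2 := rfl

lemma ex_inj (d : ℕ) {b c : Lat} (h : ex d b = ex d c) : b = c := by
  have h1 := DFunLike.congr_fun h 1
  have h2 := DFunLike.congr_fun h 2
  have h3 := DFunLike.congr_fun h 3
  rw [ex1, ex1] at h1
  rw [ex2, ex2] at h2
  rw [ex3, ex3] at h3
  exact Prod.ext h1 (Prod.ext h2 h3)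

lemma degree_four (s : Fin 4 →₀ ℕ) : s.degree = s 0 + s 1 + s 2 + s 3 := by
  rw [Finsupp.degree_eq_sum, Fin.sum_univ_four]

lemma degree_ex {d : ℕ} {b : Lat} (hb : b ∈ Td d) : (ex d b).degree = d := by
  have := mem_Td.1 hb
  rw [degree_four, ex0, ex1, ex2, ex3]; omega

lemma exists_ex {d : ℕ} {s : Fin 4 →₀ ℕ} (hs : s.degree = d) :
    ∃ b ∈ Td d, ex d b = s := by
  rw [degree_four] at hs
  refine ⟨(s 1, s 2, s 3), mem_Td.2 (by show s 1 + s 2 + s 3 ≤ d; omega), ?_⟩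
  ext i
  fin_cases i
  · show d - s 1 - s 2 - s 3 = s 0
    omega
  · rfl
  · rfl
  · rfl

/-- the form with given coefficients -/
noncomputable def form (d : ℕ) : (Td d → ℚ) →ₗ[ℚ] MvPolynomial (Fin 4) ℚ :=
  ∑ b : Td d, (monomial (ex d b)) ∘ₗ (LinearMap.proj b)

lemma form_apply (d : ℕ) (u : Td d → ℚ) : form d u = ∑ b : Td d, monomial (ex d b) (u b) := by
  simp [form]

lemma coeff_form (d : ℕ) (u : Td d → ℚ) (b : Td d) : coeff (ex d b) (form d u) = u b := by
  classical
  rw [form_apply, coeff_sum, Finset.sum_eq_single b]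
  · rw [coeff_monomial, if_pos rfl]
  · intro c _ hc
    rw [coeff_monomial, if_neg]
    intro h
    exact hc (Subtype.ext (ex_inj d h))
  · intro h; exact absurd (mem_univ _) h

lemma form_inj (d : ℕ) : Function.Injective (form d) := by
  intro u v h
  funext b
  rw [← coeff_form d u b, h, coeff_form d v b]

lemma form_hom (d : ℕ) (u : Td d → ℚ) : form d u ∈ homogeneousSubmodule (Fin 4) ℚ d := by
  rw [form_apply]
  refine Submodule.sum_mem _ fun b _ => ?_
  rw [mem_homogeneousSubmodule]
  exact isHomogeneous_monomial _ (degree_ex b.2)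

lemma exists_form {d : ℕ} {f : MvPolynomial (Fin 4) ℚ} (hf : f ∈ homogeneousSubmodule (Fin 4) ℚ d) :
    ∃ u, form d u = f := by
  classical
  refine ⟨fun b => coeff (ex d b) f, ?_⟩
  rw [mem_homogeneousSubmodule] at hf
  have hg := form_hom d (fun b => coeff (ex d b) f)
  rw [mem_homogeneousSubmodule] at hg
  ext s
  by_cases hs : s.degree = d
  · obtain ⟨b, hb, rfl⟩ := exists_ex hs
    exact coeff_form d _ ⟨b, hb⟩
  · rw [hf.coeff_eq_zero hs, hg.coeff_eq_zero hs]

lemma pderiv_pow_mon (i : Fin 4) (n : ℕ) (s : Fin 4 →₀ ℕ) (c : ℚ) :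
    ((pderiv i).toLinearMap ^ n : Module.End ℚ (MvPolynomial (Fin 4) ℚ)) (monomial s c) =
      monomial (s - Finsupp.single i n) (c * df (s i) n) := by
  induction n with
  | zero => simp [df_zero]
  | succ n ih =>
    rw [pow_succ', Module.End.mul_apply, ih]
    show pderiv i _ = _
    rw [pderiv_monomial, tsub_tsub, ← Finsupp.single_add, df_succ]
    congr 1
    rw [Finsupp.tsub_apply, Finsupp.single_eq_same]
    rcases le_or_gt n (s i) with h | h
    · push_cast [h]; ring
    · have : df (s i) n = 0 := by unfold df; rw [Nat.descFactorial_eq_zero_iff_lt.2 h]; simp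
      rw [this]; ring

lemma diffOp_mon (ν : Fin 4 → ℕ) (s : Fin 4 →₀ ℕ) (c : ℚ) :
    diffOp ν (monomial s c) = monomial (s - Finsupp.single 3 (ν 3) - Finsupp.single 2 (ν 2)
      - Finsupp.single 1 (ν 1) - Finsupp.single 0 (ν 0))
      (c * df (s 3) (ν 3) * df (s 2) (ν 2) * df (s 1) (ν 1) * df (s 0) (ν 0)) := by
  unfold diffOp
  rw [Module.End.mul_apply, Module.End.mul_apply, Module.End.mul_apply, pderiv_pow_mon, pderiv_pow_mon,
    pderiv_pow_mon, pderiv_pow_mon]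
  congr 1
  simp

lemma df_pow (x : ℚ) (hx : x ≠ 0) (e n : ℕ) : df e n * x ^ (e - n) = df e n * x ^ e * (x ^ n)⁻¹ := by
  rcases le_or_gt n e with h | h
  · rw [pow_sub₀ x hx h]; ring
  · have : df e n = 0 := by unfold df; rw [Nat.descFactorial_eq_zero_iff_lt.2 h]; simp
    rw [this]; ring

/-- the projective point -/
def proj4 (P : Pt) : Fin 4 → ℚ := ![1, P.1, P.2.1, P.2.2]

lemma eval_diffOp_mon (P : Pt) (hP : NZ P) (d : ℕ) (b : Lat) (ν : Fin 4 → ℕ) (c : ℚ) :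
    aeval (proj4 P) (diffOp ν (monomial (ex d b) c)) =
      (df (d - b.1 - b.2.1 - b.2.2) (ν 0) * df b.1 (ν 1) * df b.2.1 (ν 2) * df b.2.2 (ν 3) * (mon P b * c)) *
      (P.1 ^ ν 1 * P.2.1 ^ ν 2 * P.2.2 ^ ν 3)⁻¹ := by
  rw [diffOp_mon, aeval_monomial, Finsupp.prod_fintype _ _ (by simp), Fin.prod_univ_four]
  have q0 : proj4 P 0 = 1 := rfl
  have q1 : proj4 P 1 = P.1 := rfl
  have q2 : proj4 P 2 = P.2.1 := rfl
  have q3 : proj4 P 3 = P.2.2 := rfl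
  rw [q0, q1, q2, q3, ex0, ex1, ex2, ex3]
  simp only [Finsupp.tsub_apply, Finsupp.single_apply, ex1, ex2, ex3]
  simp only [Fin.reduceEq, if_true, if_false, tsub_zero, one_pow, one_mul]
  have t1 := df_pow P.1 hP.1 b.1 (ν 1)
  have t2 := df_pow P.2.1 hP.2.1 b.2.1 (ν 2)
  have t3 := df_pow P.2.2 hP.2.2 b.2.2 (ν 3)
  rw [Algebra.algebraMap_self, RingHom.id_apply, mon, mul_inv, mul_inv]
  calc _ = c * df (d - b.1 - b.2.1 - b.2.2) (ν 0) * (df b.1 (ν 1) * P.1 ^ (b.1 - ν 1)) *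
        (df b.2.1 (ν 2) * P.2.1 ^ (b.2.1 - ν 2)) * (df b.2.2 (ν 3) * P.2.2 ^ (b.2.2 - ν 3)) := by ring
    _ = _ := by rw [t1, t2, t3]; ring

lemma mem_vanishing (P : Pt) (hP : NZ P) (d m : ℕ) (u : Td d → ℚ) :
    form d u ∈ vanishingSpace m (proj4 P) ↔
      ∀ a ∈ AL m, ∑ b : Td d, mon P b * pol a b * u b = 0 := by
  classical
  have key : ∀ ν : Fin 4 → ℕ, form d u ∈ LinearMap.ker ((aeval (proj4 P)).toLinearMap ∘ₗ
      (diffOp ν : MvPolynomial (Fin 4) ℚ →ₗ[ℚ] MvPolynomial (Fin 4) ℚ)) ↔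
      ∑ b : Td d, (df (d - b.1.1 - b.1.2.1 - b.1.2.2) (ν 0) * df b.1.1 (ν 1) * df b.1.2.1 (ν 2) *
        df b.1.2.2 (ν 3) * (mon P b * u b)) = 0 := by
    intro ν
    rw [LinearMap.mem_ker, LinearMap.comp_apply, form_apply, map_sum, map_sum]
    have : ∀ b : Td d, (aeval (proj4 P)).toLinearMap (diffOp ν (monomial (ex d b) (u b))) = _ :=
      fun b => eval_diffOp_mon P hP d b ν (u b)
    rw [Finset.sum_congr rfl fun b _ => this b, ← Finset.sum_mul, mul_eq_zero, or_iff_left]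
    refine inv_ne_zero (mul_ne_zero (mul_ne_zero ?_ ?_) ?_)
    · exact pow_ne_zero _ hP.1
    · exact pow_ne_zero _ hP.2.1
    · exact pow_ne_zero _ hP.2.2
  -- extend `u` by zero
  set w : Lat → ℚ := fun b => mon P b * (if hb : b ∈ Td d then u ⟨b, hb⟩ else 0) with hw
  have conv : ∀ g : Lat → ℚ, ∑ b : Td d, g b * (mon P b * u b) = ∑ b ∈ Td d, g b * w b := by
    intro g
    rw [← Finset.sum_coe_sort (Td d)]
    refine Finset.sum_congr rfl fun b _ => ?_
    simp [hw]
  unfold vanishingSpace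
  simp only [Submodule.mem_iInf, key]
  have conv1 : ∀ ν : Fin 4 → ℕ, _ = _ := fun ν => conv fun b =>
    df (d - b.1 - b.2.1 - b.2.2) (ν 0) * df b.1 (ν 1) * df b.2.1 (ν 2) * df b.2.2 (ν 3)
  have conv2 : ∀ a : Lat, ∑ b : Td d, mon P b * pol a b * u b =
      ∑ b ∈ Td d, (b.1 : ℚ) ^ a.1 * (b.2.1 : ℚ) ^ a.2.1 * (b.2.2 : ℚ) ^ a.2.2 * w b := by
    intro a
    rw [← conv fun b => (b.1 : ℚ) ^ a.1 * (b.2.1 : ℚ) ^ a.2.1 * (b.2.2 : ℚ) ^ a.2.2]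
    refine Finset.sum_congr rfl fun b _ => ?_
    rw [pol]; ring
  constructor
  · intro h a ha
    rw [conv2]
    refine pow_of_df (Td d) w m ?_ _ _ _ (mem_AL.1 ha)
    intro n1 n2 n3 hn
    have h1 := h ![0, n1, n2, n3] (by
      rw [Fin.sum_univ_four]
      show 0 + n1 + n2 + n3 < m
      omega)
    rw [conv1] at h1
    rw [← h1]
    refine Finset.sum_congr rfl fun b _ => ?_
    show _ = df _ 0 * df b.1 n1 * df b.2.1 n2 * df b.2.2 n3 * w b
    rw [df_zero, one_mul]
  · intro h ν hν
    rw [conv1]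
    rw [Fin.sum_univ_four] at hν
    refine df_of_pow d w m ?_ _ _ _ _ hν
    intro a1 a2 a3 ha
    rw [← conv2 (a1, a2, a3)]
    exact h _ (mem_AL.2 ha)

lemma exists_list {I : Type} (m : I → ℕ) (L : List ℕ) (s : Multiset I) (h : s.map m = L) :
    ∃ l : List I, l.map m = L ∧ (l : Multiset I) = s := by
  classical
  induction L generalizing s with
  | nil =>
    refine ⟨[], rfl, ?_⟩
    have : s = 0 := (Multiset.map_eq_zero (f := m)).1 h
    rw [this]; rfl
  | cons a L ih =>
    have ha : a ∈ s.map m := by rw [h]; simp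
    obtain ⟨i, hi, rfl⟩ := Multiset.mem_map.1 ha
    obtain ⟨s', rfl⟩ := Multiset.exists_cons_of_mem hi
    rw [Multiset.map_cons, ← Multiset.cons_coe] at h
    obtain ⟨l, h1, h2⟩ := ih s' ((Multiset.cons_inj_right _).1 h)
    exact ⟨i :: l, by rw [List.map_cons, h1], by rw [← h2]; rfl⟩

lemma exists_equiv {I : Type} [Fintype I] (m : I → ℕ) (L : List ℕ) (h : univ.val.map m = L) :
    ∃ e : Fin L.length ≃ I, ∀ i, m (e i) = L.get i := by
  classical
  obtain ⟨l, rfl, h2⟩ := exists_list m L _ h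
  have hnd : l.Nodup := by
    rw [← Multiset.coe_nodup, h2]; exact univ.nodup
  have hmem : ∀ i, i ∈ l := by
    intro i
    rw [← Multiset.mem_coe, h2]; exact mem_univ i
  refine ⟨(finCongr (List.length_map m)).trans (hnd.getEquivOfForallMemList l hmem), ?_⟩
  intro i
  simp

/-- moving the points apart -/
def mv {I : Type} (P : I → Pt) (c : I → ℚ) (s : ℚ) (i : I) : Pt := ((P i).1 + s * c i, (P i).2)

lemma mv_good {I : Type} [Fintype I] (P : I → Pt) (c : I → ℚ) (hc : Function.Injective c)
    (hP : ∀ i, NZ (P i)) : ∀ᶠ s in 𝓝[≠] (0 : ℚ), (∀ i, NZ (mv P c s i)) ∧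
      ∀ i j, i ≠ j → (mv P c s i).1 ≠ (mv P c s j).1 := by
  refine Filter.Eventually.and ?_ ?_
  · rw [Filter.eventually_all]
    intro i
    have : ∀ᶠ s in 𝓝 (0 : ℚ), (P i).1 + s * c i ≠ 0 := by
      have hcont : Continuous fun s : ℚ => (P i).1 + s * c i := by fun_prop
      apply hcont.continuousAt.eventually_ne
      simpa using (hP i).1
    filter_upwards [this.filter_mono nhdsWithin_le_nhds] with s hs
    exact ⟨hs, (hP i).2⟩
  · rw [Filter.eventually_all]
    intro i
    rw [Filter.eventually_all]
    intro j
    by_cases hij : i = j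
    · exact Filter.Eventually.of_forall fun s h => absurd hij h
    by_cases h : (P i).1 = (P j).1
    · filter_upwards [eventually_mem_nhdsWithin] with s hs _ h2
      have h3 : (P i).1 + s * c i = (P j).1 + s * c j := h2
      rw [h] at h3
      exact hij (hc (mul_left_cancel₀ hs (add_left_cancel h3)))
    · have : ∀ᶠ s in 𝓝 (0 : ℚ), ((P i).1 + s * c i) - ((P j).1 + s * c j) ≠ 0 := by
        have hcont : Continuous fun s : ℚ => ((P i).1 + s * c i) - ((P j).1 + s * c j) := by fun_prop
        apply hcont.continuousAt.eventually_ne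
        simpa using sub_ne_zero.2 h
      filter_upwards [this.filter_mono nhdsWithin_le_nhds] with s hs _ h2
      exact hs (sub_eq_zero.2 h2)

lemma mv_cont {I : Type} (P : I → Pt) (c : I → ℚ) (j : Σ _ : I, Lat) (b : Lat) :
    Continuous fun s => GG (mv P c s) j b := by
  unfold GG mon mv
  fun_prop

lemma mv_zero {I : Type} (P : I → Pt) (c : I → ℚ) : mv P c 0 = P := by
  funext i
  simp [mv]

/-- combination of the two cases -/
def Gen (d : ℕ) (L : List ℕ) : Prop :=
  ∃ P : Fin L.length → Pt, (∀ i, NZ (P i)) ∧ (∀ i j, i ≠ j → (P i).1 ≠ (P j).1) ∧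
    (FI (JJ L.get) (Td d) (GG P) ∨ FI (Td d) (JJ L.get) (fun b j => GG P j b))

/-- reindexing of conditions -/
def emE {I J : Type} (e : I ≃ J) : (Σ _ : I, Lat) ↪ (Σ _ : J, Lat) :=
  ⟨fun j => ⟨e j.1, j.2⟩, fun a b h => by
    obtain ⟨a1, a2⟩ := a
    obtain ⟨b1, b2⟩ := b
    simp only [Sigma.mk.injEq, EmbeddingLike.apply_eq_iff_eq, heq_eq_eq] at h
    obtain ⟨rfl, rfl⟩ := h
    rfl⟩

lemma JJ_reindex {I J : Type} [Fintype I] [Fintype J] (e : I ≃ J) (m : J → ℕ) (m' : I → ℕ)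
    (h : ∀ i, m (e i) = m' i) : (JJ m).map (emE e.symm) = JJ m' := by
  ext ⟨i, a⟩
  simp only [JJ, Finset.mem_map, mem_sigma, mem_univ, true_and]
  constructor
  · rintro ⟨⟨j, a'⟩, h1, h2⟩
    have h2 : (⟨e.symm j, a'⟩ : Σ _ : I, Lat) = ⟨i, a⟩ := h2
    simp only [Sigma.mk.injEq, heq_eq_eq] at h2
    obtain ⟨rfl, rfl⟩ := h2
    rw [← h]; simpa using h1
  · intro h1
    refine ⟨⟨e i, a⟩, ?_, ?_⟩
    · show a ∈ AL (m (e i))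
      rw [h]; exact h1
    · show (⟨e.symm (e i), a⟩ : Σ _ : I, Lat) = ⟨i, a⟩
      rw [Equiv.symm_apply_apply]

lemma Gen_of {d : ℕ} {L : List ℕ} (h : Inj (Td d) L ∨ Surj (Td d) L) : Gen d L := by
  classical
  have main : ∀ (I : Type) (_ : Fintype I) (m : I → ℕ) (P : I → Pt), univ.val.map m = (L : Multiset ℕ) →
      (∀ i, NZ (P i)) → (FI (JJ m) (Td d) (GG P) ∨ FI (Td d) (JJ m) (fun b j => GG P j b)) → Gen d L := by
    intro I _ m P hm hP hF
    obtain ⟨e, he⟩ := exists_equiv m L hm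
    set c : I → ℚ := fun i => ((e.symm i : ℕ) : ℚ) with hcdef
    have hc : Function.Injective c := by
      intro i j hij
      have : (e.symm i : ℕ) = (e.symm j : ℕ) := Nat.cast_injective (R := ℚ) hij
      exact e.symm.injective (Fin.ext this)
    have hev : ∀ᶠ s in 𝓝 (0 : ℚ), FI (JJ m) (Td d) (GG (mv P c s)) ∨
        FI (Td d) (JJ m) (fun b j => GG (mv P c s) j b) := by
      rcases hF with hF | hF
      · have := FI_perturb (JJ m) (Td d) (fun s => GG (mv P c s)) (fun j b => mv_cont P c j b)
          (by rw [mv_zero]; exact hF)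
        filter_upwards [this] with s hs using Or.inl hs
      · have := FI_perturb (Td d) (JJ m) (fun s b j => GG (mv P c s) j b) (fun b j => mv_cont P c j b)
          (by rw [mv_zero]; exact hF)
        filter_upwards [this] with s hs using Or.inr hs
    obtain ⟨s, ⟨h1, h2⟩, h3⟩ := ((mv_good P c hc hP).and (hev.filter_mono nhdsWithin_le_nhds)).exists
    refine ⟨fun i => mv P c s (e i), fun i => h1 _, fun i j hij => h2 _ _ (e.injective.ne hij), ?_⟩
    have hJ := JJ_reindex e m L.get he
    rw [← hJ]
    have hG : ∀ j b, GG (fun i => mv P c s (e i)) (emE e.symm j) b = GG (mv P c s) j b := by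
      intro j b
      show mon (mv P c s (e (e.symm j.1))) b * pol j.2 b = _
      rw [Equiv.apply_symm_apply]; rfl
    rcases h3 with h3 | h3
    · left
      apply FI_mapL
      simp only [hG]
      exact h3
    · right
      apply FI_mapR
      simp only [hG]
      exact h3
  rcases h with ⟨I, hI, m, P, hm, hP, hF⟩ | ⟨I, hI, m, P, hm, hP, hF⟩
  · exact main I hI m P hm hP (Or.inl hF)
  · exact main I hI m P hm hP (Or.inr hF)

lemma systemSpace_eq {d : ℕ} {L : List ℕ} (P : Fin L.length → Pt) (hP : ∀ i, NZ (P i)) :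
    systemSpace d L (fun i => proj4 (P i)) =
      (LinearMap.ker (mat (JJ L.get) (Td d) (GG P)).mulVecLin).map (form d) := by
  ext f
  have key : ∀ u : Td d → ℚ, (form d u ∈ ⨅ i, vanishingSpace (L.get i) (proj4 (P i))) ↔
      u ∈ LinearMap.ker (mat (JJ L.get) (Td d) (GG P)).mulVecLin := by
    intro u
    rw [Submodule.mem_iInf, LinearMap.mem_ker]
    constructor
    · intro h
      funext j
      obtain ⟨⟨i, a⟩, hj⟩ := j
      have ha : a ∈ AL (L.get i) := (mem_sigma.1 hj).2
      exact (mem_vanishing (P i) (hP i) d _ u).1 (h i) a ha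
    · intro h i
      rw [mem_vanishing (P i) (hP i)]
      intro a ha
      exact congrFun h ⟨⟨i, a⟩, mem_sigma.2 ⟨mem_univ _, ha⟩⟩
  unfold systemSpace
  rw [Submodule.mem_inf, Submodule.mem_map]
  constructor
  · rintro ⟨h1, h2⟩
    obtain ⟨u, rfl⟩ := exists_form h1
    exact ⟨u, (key u).1 h2, rfl⟩
  · rintro ⟨u, hu, rfl⟩
    exact ⟨form_hom d u, (key u).2 hu⟩

lemma card_Td (d : ℕ) : (Td d).card = (d + 3).choose 3 := by
  have h1 : Td d = (range (d + 1)).biUnion fun x => (range (d + 1 - x)).biUnion fun y =>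
      (range (d + 1 - x - y)).image fun z => (x, y, z) := by
    ext ⟨x, y, z⟩
    simp only [mem_Td, mem_biUnion, mem_range, mem_image, Prod.mk.injEq]
    constructor
    · intro h
      exact ⟨x, by omega, y, by omega, z, by omega, rfl, rfl, rfl⟩
    · rintro ⟨x, h1, y, h2, z, h3, rfl, rfl, rfl⟩
      omega
  have h2 : (Td d).card = ∑ x ∈ range (d + 1), ∑ y ∈ range (d + 1 - x), (d + 1 - x - y) := by
    rw [h1, card_biUnion]
    · refine sum_congr rfl fun x _ => ?_
      rw [card_biUnion]
      · refine sum_congr rfl fun y _ => ?_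
        rw [card_image_of_injective _ (by intro a b h; simpa using h), card_range]
      · intro y _ y' _ hy
        rw [Function.onFun, disjoint_left]
        intro b hb hb'
        simp only [mem_image] at hb hb'
        obtain ⟨_, _, rfl⟩ := hb
        obtain ⟨_, _, h⟩ := hb'
        simp only [Prod.mk.injEq] at h
        exact hy h.2.1.symm
    · intro y _ y' _ hy
      rw [Function.onFun, disjoint_left]
      intro b hb hb'
      simp only [mem_image, mem_biUnion] at hb hb'
      obtain ⟨_, _, _, _, rfl⟩ := hb
      obtain ⟨_, _, _, _, h⟩ := hb'
      simp only [Prod.mk.injEq] at h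
      exact hy h.1.symm
  have h3 : ∀ n : ℕ, ∑ y ∈ range n, (n - y) = (n + 1).choose 2 := by
    intro n
    induction n with
    | zero => rfl
    | succ n ih =>
      rw [sum_range_succ', Nat.sub_zero]
      have : ∑ k ∈ range n, (n + 1 - (k + 1)) = ∑ k ∈ range n, (n - k) :=
        sum_congr rfl fun k _ => by omega
      rw [this, ih, Nat.choose_succ_succ' (n + 1) 1, Nat.choose_one_right, add_comm]
  have h4 : ∀ n : ℕ, ∑ x ∈ range n, (n - x + 1).choose 2 = (n + 2).choose 3 := by
    intro n
    induction n with
    | zero => rfl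
    | succ n ih =>
      rw [sum_range_succ', Nat.sub_zero]
      have : ∑ k ∈ range n, (n + 1 - (k + 1) + 1).choose 2 = ∑ k ∈ range n, (n - k + 1).choose 2 :=
        sum_congr rfl fun k _ => by rw [Nat.add_sub_add_right]
      rw [this, ih, Nat.choose_succ_succ' (n + 2) 2, add_comm]
  rw [h2, sum_congr rfl fun x _ => h3 (d + 1 - x), h4]

lemma nonSpecial_of_Gen {d : ℕ} {L : List ℕ} (h : Gen d L) (hL : ∀ m ∈ L, (AL m).card = (m + 2).choose 3) :
    nonSpecial d L := by
  classical
  obtain ⟨P, hP, hd, hF⟩ := h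
  refine ⟨fun i => proj4 (P i), ?_, ?_, ?_⟩
  · intro i h
    have := congrFun h 0
    exact one_ne_zero (α := ℚ) this
  · intro i j hij
    rw [LinearIndependent.pair_iff]
    intro s t hst
    have h0 := congrFun hst 0
    have h1 := congrFun hst 1
    simp only [Pi.add_apply, Pi.smul_apply, smul_eq_mul, Pi.zero_apply] at h0 h1
    have q : ∀ P : Pt, proj4 P 0 = 1 := fun _ => rfl
    have q1 : ∀ P : Pt, proj4 P 1 = P.1 := fun _ => rfl
    rw [q, q] at h0
    rw [q1, q1] at h1
    have h2 : s * ((P i).1 - (P j).1) = 0 := by linear_combination h1 - (P j).1 * h0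
    have h3 : s = 0 := (mul_eq_zero.1 h2).resolve_right (sub_ne_zero.2 (hd i j hij))
    exact ⟨h3, by linarith⟩
  · rw [systemSpace_eq P hP]
    set M := mat (JJ L.get) (Td d) (GG P) with hM
    rw [← (Submodule.equivMapOfInjective (form d) (form_inj d) _).finrank_eq]
    have hrank := LinearMap.finrank_range_add_finrank_ker M.mulVecLin
    have hS : Module.finrank ℚ (Td d → ℚ) = (d + 3).choose 3 := by
      rw [Module.finrank_fintype_fun_eq_card, Fintype.card_coe, card_Td]
    rw [hS] at hrank
    have hJ : ((JJ L.get).card : ℤ) = (L.map fun m => ((m + 2).choose 3 : ℤ)).sum := by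
      rw [card_JJ]
      have : (univ.val.map L.get : Multiset ℕ) = (L : Multiset ℕ) := by
        rw [Fin.univ_val_map, List.ofFn_get]
      rw [this, Multiset.map_coe, Multiset.sum_coe]
      rw [List.map_congr_left hL]
      push_cast
      rw [List.map_map]
      rfl
    have hv : vdim d L + 1 = ((d + 3).choose 3 : ℤ) - (JJ L.get).card := by
      rw [vdim, hJ]; ring
    have hle : Module.finrank ℚ (LinearMap.range M.mulVecLin) ≤ (JJ L.get).card := by
      have := Submodule.finrank_le (LinearMap.range M.mulVecLin)
      rwa [Module.finrank_fintype_fun_eq_card, Fintype.card_coe] at this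
    rw [hv]
    rcases hF with hF | hF
    · rw [FI_iff, ← LinearMap.ker_eq_bot] at hF
      have h0 : Module.finrank ℚ (LinearMap.ker M.mulVecLin) = 0 := by
        rw [hF]; exact finrank_bot ℚ _
      rw [h0] at hrank ⊢
      rw [max_eq_right]
      · rfl
      · omega
    · rw [FI_iff] at hF
      have e : mat (Td d) (JJ L.get) (fun b j => GG P j b) = M.transpose := rfl
      rw [e] at hF
      have hr : M.rank = (JJ L.get).card := by
        rw [← Matrix.rank_transpose, Matrix.rank, LinearMap.finrank_range_of_inj hF]; simp
      rw [Matrix.rank] at hr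
      rw [max_eq_left] <;> omega

lemma list_coe (x y z : ℕ) :
    ((List.replicate x 4 ++ List.replicate y 3 ++ List.replicate z 2 : List ℕ) : Multiset ℕ) = ms x y z := by
  rw [ms, ← Multiset.coe_add, ← Multiset.coe_add, Multiset.coe_replicate, Multiset.coe_replicate,
    Multiset.coe_replicate]

lemma nonSpecial_of_fin {d x y z : ℕ} (h : Inj (Td d) (ms x y z) ∨ Surj (Td d) (ms x y z)) :
    nonSpecial d (List.replicate x 4 ++ List.replicate y 3 ++ List.replicate z 2) := by
  rw [← list_coe] at h
  refine nonSpecial_of_Gen (Gen_of h) ?_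
  obtain ⟨h4, h3, h2, _⟩ := AL_card
  intro m hm
  rw [List.mem_append, List.mem_append] at hm
  rcases hm with (hm | hm) | hm
  · rw [List.eq_of_mem_replicate hm, h4]; rfl
  · rw [List.eq_of_mem_replicate hm, h3]; rfl
  · rw [List.eq_of_mem_replicate hm, h2]; rfl

end NS

/-! ### Part 10: the certificates -/

namespace NS

set_option maxRecDepth 1000000

theorem cert14 : chk 14 0 (.cons 957612483 (.n 2572734477 (.n 184557634 .l (.n 3494961600 .l .l)) (.n 672923780 (.n 1194590342 .l .l) (.n 1410871808 .l .l)))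
  (.cons 1294729481 (.n 3019912851 (.n 3071280017 .l .l) (.n 2231399506 .l (.n 4116549952 .l .l)))
  (.cons 1124860682 (.n 2685235712 .l .l)
  (.cons 1902911498 .l .nil))))
  0 1531203597 2 true = true := by decide +kernel

theorem cert15 : chk 15 0 (.cons 889201349 (.n 1829576714 (.n 1980023488 (.n 570687876 .l .l) (.n 655622211 .l (.n 2468611084 .l (.n 1862833728 .l .l)))) (.n 2641158155 (.n 1276641921 (.n 773328901 .l .l) .l) (.n 1309434432 (.n 1025036297 .l (.n 1799672192 .l .l)) .l)))
  (.cons 2936123846 (.n 1627435459 (.n 639369356 .l .l) .l)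
  (.cons 1224782215 .l
  (.cons 2684445786 .l .nil))))
  1191199820 1510065801 2 false = true := by decide +kernel

theorem cert16 : chk 16 0 (.cons 807403717 (.n 2874441737 (.n 2553807622 (.n 3225972992 (.n 973865543 .l .l) (.n 1779228690 .l .l)) (.n 654573956 .l (.n 958398595 (.n 587219077 .l .l) .l))) (.n 1410895881 (.n 889978950 (.n 1058037765 (.n 1527832581 .l .l) .l) (.n 2232157198 .l .l)) (.n 4043327046 (.n 2751509318 .l .l) (.n 973115650 .l (.n 1728385046 .l .l)))))
  (.cons 3561752461 (.n 1429209545 .l .l)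
  (.cons 1343489156 .l
  (.cons 251920515 .l .nil))))
  2197840597 2551496713 2 false = true := by decide +kernel

theorem cert17 : chk 17 0 (.cons 688390468 (.n 4972707859 (.n 2202010180 (.n 2420138624 (.n 2350727182 .l .l) .l) (.n 2168718022 .l (.n 940835140 .l .l))) (.n 1530417163 (.n 1092878784 (.n 2049704389 (.n 3595382811 .l .l) (.n 3372233752 .l .l)) (.n 3494662162 .l (.n 3796369626 .l .l))) (.n 671903749 (.n 2013791045 .l .l) (.n 1663566211 .l (.n 453533701 .l .l)))))
  (.cons 3126068038 (.n 1543561990 .l (.n 1209049152 .l .l))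
  (.cons 940573190 (.n 940065280 .l .l)
  (.cons 2406490123 (.n 1929413393 .l .l)
  (.cons 1427899465 .l .nil)))))
  1175978636 1728344704 2 true = true := by decide +kernel

theorem cert18 : chk 18 235147328 (.cons 3036787211 (.n 1375760708 (.n 840183812 (.n 454819971 .l .l) (.n 453521409 (.n 805847104 .l .l) (.n 1546125766 .l .l))) (.n 2134142983 (.n 1073770755 .l .l) .l))
  (.cons 3847004174 (.n 1308680778 .l (.n 940331015 .l .l))
  (.cons 4033348048 (.n 2285137932 .l .l)
  (.cons 2473381908 .l .nil))))
  1647313219 0 2 false = true := by decide +kernel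

theorem cert19 : chk 19 235147328 (.cons 3036689930 (.n 3959542470 (.n 4482139847 (.n 3607204242 .l .l) (.n 1694527873 .l .l)) (.n 2286448651 (.n 4295009995 .l .l) (.n 1627414980 (.n 4328604679 .l .l) .l)))
  (.cons 520106177 (.n 2437153928 (.n 352583874 .l .l) (.n 1846837251 (.n 252444738 .l (.n 1615343633 .l .l)) .l))
  (.cons 1242563013 (.n 1595437061 .l (.n 1459663683 .l .l))
  (.cons 939556993 .l
  (.cons 5425333195 .l .nil)))))
  3326099840 0 2 true = true := by decide +kernel

theorem cert20 : chk 20 235147328 (.cons 3177972108 (.n 2738393093 (.n 1377304773 (.n 520626177 (.n 1258352970 .l (.n 386150402 .l .l)) (.n 1041260547 .l .l)) (.n 3090940426 .l (.n 4083155656 .l (.n 1075576965 .l .l)))) (.n 1711284870 (.n 941371396 .l (.n 4770497475 .l .l)) (.n 1225834501 (.n 2533405264 .l .l) .l)))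
  (.cons 1711841283 (.n 1342201924 (.n 4501340165 (.n 2600498324 .l .l) (.n 923796290 .l .l)) (.n 2013271123 .l .l))
  (.cons 1681162250 (.n 1343782976 .l .l)
  (.cons 3005219589 (.n 3741397766 .l .l)
  (.cons 1544290756 .l .nil)))))
  1209008457 0 2 false = true := by decide +kernel

theorem cert21 : chk 21 285478976 (.cons 806621186 (.n 2720793026 (.n 3929354252 (.n 3408658830 .l .l) (.n 2502455488 .l .l)) (.n 2182873862 .l (.n 4652271055 .l (.n 1713897794 .l .l))))
  (.cons 3106931398 (.n 3170931465 (.n 4446045063 .l .l) (.n 1677758916 .l .l))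
  (.cons 1661993928 (.n 2350646152 (.n 4856303629 .l (.n 3394503432 .l (.n 856449027 .l .l))) (.n 1143746564 .l .l))
  (.cons 2268356615 (.n 1241534596 .l .l)
  (.cons 756286083 .l .nil)))))
  0 0 3 false = true := by decide +kernel

theorem cert22 : chk 22 235147328 (.cons 1461460995 (.n 3844435975 (.n 1713635523 (.n 4043420879 .l (.n 1291894981 .l .l)) .l) (.n 8110522387 (.n 5943976896 .l .l) (.n 637562948 .l (.n 335548609 .l (.n 2432726171 .l .l)))))
  (.cons 2317353608 (.n 4884006155 (.n 2885730885 (.n 6634079503 .l (.n 4163896263 .l .l)) (.n 6056613328 (.n 991178763 .l .l) (.n 1562402831 .l .l))) (.n 504107011 (.n 5946213070 (.n 1745895936 .l .l) (.n 2116579334 .l (.n 2824638528 .l .l))) (.n 1479315460 (.n 4597019724 .l .l) .l)))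
  (.cons 1763443335 (.n 822096003 (.n 722731265 .l .l) (.n 2147505033 (.n 925106304 .l .l) .l))
  (.cons 2550182533 (.n 7536492555 (.n 3087053185 (.n 2621988883 .l .l) (.n 3944018112 .l .l)) (.n 1561874437 (.n 2753823702 .l .l) (.n 3261890574 .l (.n 2063606599 .l .l)))) .nil))))
  4801765378 0 2 true = true := by decide +kernel

theorem cert23 : chk 23 319033408 (.cons 1056993412 (.n 855900610 (.n 3157581832 (.n 1931223616 .l .l) (.n 3341373456 (.n 5307937792 .l .l) (.n 890503361 .l .l))) (.n 671100993 (.n 2013294851 (.n 2669187075 (.n 4265918466 .l .l) .l) (.n 1193025541 .l .l)) (.n 1310720133 (.n 2872574473 .l .l) .l)))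
  (.cons 2502201349 (.n 822120642 (.n 2770624522 .l .l) (.n 1090548488 .l (.n 1494249600 .l .l)))
  (.cons 1409290564 (.n 7734343128 .l .l)
  (.cons 688664578 (.n 5943854102 .l .l)
  (.cons 5519799560 .l
  (.cons 4951115010 .l .nil))))))
  503337027 0 2 true = true := by decide +kernel

theorem cert24 : chk 24 319033408 (.cons 4314105421 (.n 3321918217 (.n 2667667658 (.n 2434064387 .l (.n 7337674379 .l (.n 6665823808 .l .l))) (.n 2877030607 (.n 7784748618 .l .l) (.n 1444413698 .l .l))) (.n 1260126275 (.n 2298532808 (.n 1174413763 (.n 3389035649 .l .l) (.n 4767352020 .l .l)) (.n 754983364 .l .l)) (.n 2317877766 (.n 2452656135 .l (.n 6597379420 .l .l)) .l)))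
  (.cons 4966134669 (.n 2667595084 (.n 875036870 (.n 3825255235 .l .l) (.n 2635092800 .l .l)) (.n 2153513677 (.n 1174683651 .l .l) (.n 6751854596 .l .l)))
  (.cons 1577087110 .l
  (.cons 1744875844 (.n 738206019 .l (.n 5811733587 .l .l))
  (.cons 3103880718 (.n 1342210629 .l .l)
  (.cons 2348906126 .l .nil))))))
  1610724042 0 3 false = true := by decide +kernel

theorem cert25 : chk 25 319033408 (.cons 973099138 (.n 2031644675 (.n 1845518467 (.n 1461453770 .l (.n 471597124 .l (.n 2332058177 .l .l))) (.n 2117075592 (.n 4046237701 .l (.n 4714483793 .l .l)) (.n 1745094151 .l (.n 3405824643 .l .l)))) (.n 402923521 (.n 939540546 (.n 2566943234 (.n 6394585104 .l .l) .l) (.n 7499539289 .l .l)) (.n 3323281421 (.n 1344798981 .l .l) (.n 1478529029 .l (.n 1578631491 .l .l)))))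
  (.cons 437002242 (.n 5609889807 (.n 537145346 (.n 2348900872 (.n 2030061134 .l (.n 1795215492 .l .l)) .l) (.n 1276383232 (.n 3878211590 .l (.n 7371001868 .l (.n 2869016066 .l .l))) (.n 3959486151 .l .l))) (.n 4282216457 (.n 1610875651 (.n 3981991937 .l .l) (.n 838869379 .l .l)) (.n 9049998867 (.n 5737866700 .l (.n 2199650626 .l .l)) (.n 2131775936 .l .l))))
  (.cons 1177305093 .l
  (.cons 2185068558 .l
  (.cons 1768722447 .l .nil)))))
  691286025 0 2 false = true := by decide +kernel

theorem cert26 : chk 26 369365056 (.cons 3892404748 (.n 3138445319 (.n 3707814147 (.n 5508227080 (.n 656146636 .l .l) (.n 1949566085 .l .l)) (.n 1226575876 (.n 2486436358 (.n 2752294918 .l .l) .l) (.n 3495714826 (.n 4982911054 .l .l) (.n 2453954570 .l .l)))) (.n 3190366212 (.n 773595139 (.n 2382635968 (.n 3612635156 .l .l) .l) .l) (.n 1711538563 (.n 1678246212 .l .l) (.n 3161719173 .l .l))))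
  (.cons 3458990340 (.n 6211600404 (.n 453013635 .l .l) (.n 688394243 .l .l))
  (.cons 1595695109 (.n 1628467207 (.n 1258328388 (.n 8512688138 .l .l) .l) (.n 8058308240 (.n 3089432597 .l .l) .l))
  (.cons 470556674 (.n 1814577160 .l .l)
  (.cons 1681428488 .l
  (.cons 673722374 .l .nil))))))
  0 0 2 false = true := by decide +kernel

theorem cert27 : chk 27 386142272 (.cons 822628354 (.n 1931739462 (.n 638058562 (.n 1056998275 (.n 1610642191 .l .l) (.n 318791873 .l .l)) (.n 1141375426 (.n 3629137932 (.n 7353927178 .l .l) .l) (.n 1410859074 (.n 6247154308 .l .l) (.n 1930953413 .l .l)))) (.n 3187692807 (.n 2468872900 (.n 1275072897 (.n 5705827795 .l .l) .l) (.n 2266236042 (.n 855912450 .l (.n 2857108174 .l .l)) .l)) (.n 1076101254 (.n 5655306249 .l (.n 9500471327 .l .l)) (.n 3999035401 .l (.n 4099182599 .l .l)))))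
  (.cons 9261115215 (.n 4246209350 (.n 1661001863 .l (.n 2725298187 .l (.n 2387083532 .l .l))) (.n 3312189892 .l .l))
  (.cons 721428674 (.n 201338881 .l (.n 4043342789 .l .l))
  (.cons 4446029132 .l
  (.cons 2147500874 .l .nil)))))
  1191706945 0 2 true = true := by decide +kernel

theorem cert28 : chk 28 386142272 (.cons 604254210 (.n 1024987138 (.n 268439617 (.n 335806593 (.n 4684276672 .l .l) (.n 1074278402 (.n 6744535501 .l .l) .l)) (.n 8932331536 (.n 3625763456 .l .l) (.n 117440641 (.n 4314169348 .l .l) (.n 940314626 .l .l)))) (.n 6696042510 (.n 1665929223 (.n 839647620 .l (.n 2638742356 .l .l)) (.n 2519490564 (.n 7790993415 .l .l) (.n 956825989 .l (.n 3843858447 .l .l)))) (.n 4127236744 (.n 5285699600 .l .l) (.n 2986385859 (.n 6660653645 .l .l) .l))))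
  (.cons 2953577218 (.n 2365608388 (.n 1040240645 (.n 5691409481 (.n 3875582477 .l .l) (.n 3075211789 .l .l)) (.n 1126715398 .l (.n 1160564743 .l (.n 1006649477 .l .l)))) (.n 1459630402 (.n 2686308364 .l .l) (.n 1660961155 .l (.n 3691819840 .l .l))))
  (.cons 2048393346 (.n 1728087372 (.n 1040228867 .l .l) (.n 2467606536 .l .l))
  (.cons 5905667408 (.n 738209921 .l .l)
  (.cons 838877442 (.n 5304747079 .l .l)
  (.cons 8143560721 .l .nil))))))
  2686496770 0 2 false = true := by decide +kernel

theorem cert29 : chk 29 386142272 (.cons 4596999113 (.n 1929904515 (.n 4982866758 (.n 6294602694 (.n 6274696081 .l .l) (.n 571494404 (.n 4264124800 .l .l) .l)) (.n 1846280515 (.n 7197500747 (.n 2606530566 .l .l) .l) .l)) (.n 2483060997 (.n 5891248137 (.n 4029718534 (.n 3611590660 .l .l) (.n 1008206211 (.n 5272007936 .l .l) (.n 1847067405 .l .l))) (.n 1628205058 (.n 805310657 .l .l) (.n 7904761024 .l .l))) (.n 1023430722 (.n 3573834496 .l .l) (.n 3526361732 (.n 2484908051 .l .l) .l))))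
  (.cons 3389091919 (.n 2952827334 (.n 3359638546 (.n 587730947 .l .l) (.n 706216194 (.n 3405808275 .l .l) (.n 1593848266 .l .l))) (.n 4617703429 (.n 1795191110 (.n 3828352466 .l (.n 3137384648 .l .l)) (.n 2718748676 (.n 3375116295 (.n 2014593088 .l .l) .l) .l)) (.n 7102357512 (.n 5872104583 .l (.n 2753831488 .l .l)) (.n 5287018816 .l .l))))
  (.cons 2535727108 (.n 1175203842 (.n 1108082754 (.n 2551710019 (.n 3172741129 .l .l) (.n 4432069063 .l .l)) (.n 8613265871 .l .l)) (.n 470036482 (.n 7220031491 .l .l) (.n 3643576325 .l .l)))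
  (.cons 5486236878 (.n 3389522824 (.n 1627422809 .l .l) .l)
  (.cons 5220074445 (.n 1677730245 .l .l)
  (.cons 906260484 .l .nil))))))
  0 0 2 true = true := by decide +kernel

theorem cert30 : chk 30 386142272 (.cons 1595944962 (.n 1863844164 (.n 6749966344 (.n 2064908610 (.n 1074528257 (.n 1863344131 (.n 3189506818 .l .l) (.n 2349686808 .l .l)) (.n 9385111567 .l .l)) (.n 1677763141 (.n 5288022208 .l .l) (.n 537141248 .l (.n 2384199872 .l .l)))) (.n 1090813956 (.n 4177553033 (.n 2415944322 .l (.n 385888257 .l .l)) (.n 1124098116 .l (.n 5205917767 .l .l))) (.n 989876482 (.n 3324829705 (.n 7348536799 .l .l) (.n 3190554766 .l .l)) (.n 1477476354 .l (.n 4063526922 .l .l))))) (.n 2922119943 (.n 4734365705 (.n 8258928648 .l (.n 6784550093 .l .l)) (.n 3657474888 (.n 1879835146 .l .l) .l)) (.n 1512571329 (.n 4838654283 (.n 990130368 .l .l) (.n 553910593 .l (.n 4804837916 .l .l))) (.n 1276117514 .l (.n 3295412561 .l (.n 4664112131 .l .l))))))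
  (.cons 2164551685 (.n 706216322 (.n 588251267 .l (.n 2031354886 (.n 1577070912 .l .l) .l)) (.n 772539074 .l (.n 1393827850 .l .l)))
  (.cons 335822851 (.n 7250904590 (.n 2097172804 (.n 2483036611 (.n 872443970 (.n 8530167116 .l (.n 4097679379 .l .l)) .l) (.n 10101831104 .l .l)) (.n 3860857415 (.n 2268401667 .l .l) (.n 5677334551 (.n 4501012939 .l .l) (.n 3141320832 .l .l)))) (.n 1946165698 (.n 2886730376 .l (.n 1209028609 .l .l)) (.n 3121917958 (.n 1963733440 .l .l) (.n 1811972228 (.n 6949701265 .l (.n 1980236237 .l .l)) .l))))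
  (.cons 403447809 .l
  (.cons 353374210 .l
  (.cons 805339205 .l .nil))))))
  775168006 0 2 false = true := by decide +kernel

theorem cert31 : chk 31 453251136 (.cons 1981284613 (.n 7438884877 (.n 4851499846 (.n 2350395394 (.n 2248189582 .l (.n 4179460115 .l .l)) (.n 8377909257 .l (.n 2835395525 .l .l))) (.n 1174425988 .l (.n 1813250243 (.n 1526772165 .l .l) .l))) (.n 403177473 (.n 1091330050 (.n 5707400202 .l .l) (.n 8964547648 .l .l)) (.n 1545371655 (.n 2920284678 .l .l) (.n 840695875 (.n 9798006222 .l (.n 6207616067 .l .l)) .l))))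
  (.cons 2113933699 (.n 4199137299 .l (.n 11466442436 .l .l))
  (.cons 1108611074 (.n 2718474244 (.n 1879072965 .l (.n 3577479747 .l .l)) (.n 7771869191 .l (.n 436469889 .l .l)))
  (.cons 2097176835 (.n 2047869639 (.n 3959948292 (.n 7151677471 .l .l) (.n 705691779 .l (.n 8690700874 .l .l))) (.n 2854487501 (.n 1862291649 (.n 4298420231 .l .l) .l) (.n 3375915021 (.n 1124085825 (.n 3976237827 .l .l) .l) (.n 1863860227 .l .l))))
  (.cons 621027329 .l
  (.cons 1007157443 (.n 2453434373 .l .l)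
  (.cons 772014274 .l
  (.cons 7569006612 .l .nil))))))))
  0 0 3 false = true := by decide +kernel

theorem cert32 : chk 32 453251136 (.cons 1073762435 (.n 1108082946 (.n 2199949320 (.n 2801812034 (.n 7516287570 .l (.n 5972739015 .l .l)) (.n 1930973187 (.n 4043358929 .l .l) (.n 10021504911 .l (.n 5941495181 .l .l)))) (.n 621559810 (.n 3947102790 (.n 789073923 .l .l) (.n 1158156480 .l .l)) (.n 6176637768 .l (.n 2936041860 (.n 993542157 .l .l) .l)))) (.n 4866236419 (.n 12482365004 (.n 1594885066 (.n 3641968276 .l .l) (.n 1851789325 .l (.n 1612460037 .l .l))) (.n 4999660038 .l (.n 8422249233 .l (.n 3490222088 .l .l)))) (.n 8522913092 (.n 1862275651 (.n 1728069827 (.n 403181571 .l .l) .l) (.n 1444950016 .l .l)) (.n 1258299845 (.n 6025711624 .l (.n 4077191177 .l .l)) (.n 3056599495 (.n 402653633 .l (.n 7775191754 .l .l)) (.n 1979990976 .l .l))))))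
  (.cons 2064122307 (.n 4131717129 (.n 3308519556 (.n 1023430855 .l .l) .l) (.n 4831863564 (.n 872423553 .l .l) (.n 1962967361 .l (.n 4200120326 .l .l))))
  (.cons 805318978 (.n 4028448780 (.n 6694180820 .l (.n 570425606 .l .l)) (.n 4127224907 .l (.n 4095836171 .l (.n 2818654983 .l .l))))
  (.cons 1309171715 (.n 6682051014 (.n 3154219977 .l .l) (.n 3053519625 .l .l))
  (.cons 2030076869 .l
  (.cons 1224774408 (.n 6579291920 .l .l)
  (.cons 436212230 .l .nil)))))))
  0 0 3 false = true := by decide +kernel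

theorem cert33 : chk 33 486805568 (.cons 1879638024 (.n 2030072068 (.n 2248957957 (.n 2220097729 (.n 1426079810 (.n 5269405706 .l .l) (.n 1007157827 .l (.n 5351997901 .l .l))) (.n 386138371 (.n 1142686084 .l (.n 5169528960 .l .l)) (.n 3393474567 .l (.n 11548585995 .l .l)))) (.n 889991170 (.n 2365608323 (.n 1427898691 (.n 1394094144 .l .l) (.n 7352180739 .l .l)) (.n 822083907 (.n 2366636613 .l .l) (.n 1729896452 .l .l))) (.n 1898737670 (.n 2097168707 (.n 1177038850 .l .l) .l) (.n 3506495753 (.n 3292848148 .l .l) .l)))) (.n 2214601869 (.n 8914063386 (.n 1241542852 (.n 2065432706 .l (.n 2904293958 .l .l)) .l) (.n 4701290952 .l (.n 6567530511 .l .l))) (.n 5271454472 (.n 6681300999 (.n 2080456969 .l .l) .l) (.n 4180935106 (.n 4767876418 .l .l) (.n 3221275021 .l .l)))))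
  (.cons 1006649729 (.n 2469158922 (.n 855646402 (.n 2701140549 .l .l) (.n 1509966277 (.n 8429309965 .l .l) .l)) (.n 2270744584 (.n 8103429326 .l (.n 9533916488 (.n 1895842112 .l .l) .l)) (.n 8813544585 (.n 11240854922 .l .l) .l)))
  (.cons 1124102660 .l
  (.cons 5052616708 .l .nil))))
  1291862791 0 2 true = true := by decide +kernel

theorem cert34 : chk 34 486805568 (.cons 2352484360 (.n 6543205835 (.n 5591008015 (.n 7231010315 (.n 4398776834 (.n 2032414724 .l (.n 5301629892 .l .l)) .l) (.n 3626536967 (.n 4682679315 .l .l) (.n 570441795 (.n 3005219205 (.n 8110043151 .l .l) .l) .l))) (.n 6246368786 (.n 4379117202 (.n 2181825153 .l .l) (.n 2684387907 (.n 1477971971 .l .l) .l)) (.n 8908797134 (.n 3808462147 .l .l) (.n 4362129480 .l (.n 10440757253 .l .l))))) (.n 11347167117 (.n 4381737025 (.n 1207980933 (.n 2550236292 .l .l) (.n 2131493642 .l .l)) (.n 1375744451 (.n 1476976646 .l (.n 2317111299 .l .l)) (.n 2652155914 .l .l))) (.n 2887516614 (.n 1493193285 (.n 5841686534 .l .l)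 (.n 13429900430 (.n 587219079 .l .l) (.n 2887270406 .l .l))) (.n 2669412934 (.n 2986394127 .l .l) (.n 2282254720 .l .l)))))
  (.cons 923021314 (.n 3054530564 (.n 8323407883 (.n 672923780 .l (.n 7184375817 (.n 1056972993 .l .l) .l)) (.n 471072896 .l .l)) (.n 1528573955 (.n 2064646854 .l (.n 3271594051 .l .l)) (.n 621019330 (.n 1242562883 .l .l) (.n 2031354627 .l .l))))
  (.cons 822882306 (.n 956309633 (.n 11526583488 .l .l) (.n 6090493971 .l (.n 2351972362 .l .l)))
  (.cons 1243373571 (.n 4462793157 (.n 2218299394 .l .l) (.n 3609284614 .l (.n 1663324167 .l .l)))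
  (.cons 10090185934 (.n 403443714 .l (.n 858001413 .l (.n 806879299 .l .l)))
  (.cons 956321858 (.n 5856560012 .l .l)
  (.cons 3227086865 .l .nil)))))))
  12132836928 0 2 false = true := by decide +kernel

theorem cert35 : chk 35 486805568 (.cons 8947326989 (.n 1074528449 (.n 7806124497 (.n 10508043213 (.n 4817461254 (.n 1158168577 .l .l) (.n 10826118976 .l .l)) (.n 2264954065 (.n 6210717058 .l .l) (.n 1979777606 .l .l))) (.n 2315301062 (.n 1847066690 .l .l) (.n 1259085825 (.n 956579842 (.n 3540059463 .l .l) .l) .l))) (.n 1577074821 (.n 7669612556 (.n 4429222342 (.n 2354840528 .l (.n 705954436 .l (.n 1241522437 .l .l))) (.n 13371561360 .l (.n 218104004 .l .l))) (.n 3176923411 (.n 4043334983 (.n 1376518597 .l .l) (.n 5089002770 .l .l)) (.n 3053478212 (.n 1730151110 .l .l) (.n 4867272713 .l .l)))) (.n 2315280837 (.n 1728058053 .l (.n 956563910 .l .l)) (.n 4466410249 (.n 1460416513 (.n 772022273 .l .l) .l) (.n 1325936641 (.n 1291862083 .l .l) .l)))))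
  (.cons 1882193987 (.n 7657287690 (.n 2818638212 (.n 5219639307 (.n 2315284803 .l (.n 369360960 .l .l)) (.n 2953855488 .l .l)) (.n 3070284552 (.n 7722582029 .l (.n 335568900 (.n 5221646598 .l .l) .l)) (.n 4999706125 (.n 789057538 .l .l) (.n 10559496202 .l .l)))) (.n 738226180 (.n 9837741329 (.n 4987363334 .l .l) (.n 6379352081 .l (.n 5626429465 .l .l))) (.n 11022657429 (.n 1276657669 .l (.n 9026209156 .l .l)) (.n 486551618 (.n 2769056128 .l .l) (.n 3627061268 .l .l)))))
  (.cons 570957825 (.n 2684915720 (.n 1042288645 (.n 7518912516 .l .l) (.n 5961156103 (.n 13142144896 .l .l) (.n 5289805260 .l .l))) (.n 3478405132 .l (.n 6494716032 .l .l)))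
  (.cons 2702442884 (.n 654352387 (.n 2852151682 (.n 7734334473 (.n 4748739207 .l .l) .l) .l) (.n 13020432012 (.n 3911983552 .l .l) (.n 2943418375 .l .l)))
  (.cons 4700766921 (.n 687865985 (.n 4160790927 .l .l) .l)
  (.cons 2450305030 (.n 2885705993 .l .l)
  (.cons 1460957186 .l .nil)))))))
  0 0 2 false = true := by decide +kernel

theorem cert36 : chk 36 486805568 (.cons 3574858694 (.n 3796107395 (.n 7180756240 (.n 5757042714 (.n 1476419778 (.n 1224999235 .l .l) (.n 6174049743 .l .l)) (.n 5557534739 (.n 3157016584 .l .l) (.n 3122397507 (.n 3794796743 .l .l) .l))) (.n 1124859905 (.n 6815506446 (.n 4412474967 .l (.n 1509966662 .l .l)) (.n 1107296706 .l .l)) (.n 1845510597 (.n 3523228672 (.n 1393086472 .l (.n 5100315720 .l .l)) .l) (.n 1057513473 (.n 2852164294 .l (.n 5989578124 .l .l)) (.n 1526727108 .l .l))))) (.n 5487461193 (.n 1545392136 (.n 6245843658 (.n 7717557443 (.n 1056977026 .l .l) (.n 6025118415 .l .l)) (.n 9747657799 (.n 11445732893 .l .l) (.n 1711542528 .l .l)))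 (.n 1919688718 (.n 3008958474 .l (.n 1563979785 .l .l)) (.n 839688199 .l (.n 1141637249 .l .l)))) (.n 1748238402 (.n 3623891653 (.n 2736316419 .l (.n 1493180673 .l .l)) (.n 8829648920 (.n 1242824835 (.n 5402357838 .l .l) .l) (.n 4347134668 .l .l))) (.n 1879835012 (.n 2083807238 (.n 7775567877 (.n 2652119488 .l .l) (.n 2603876556 .l .l)) (.n 3288657929 (.n 2452881743 .l .l) (.n 1812209920 .l .l))) (.n 3846439501 .l (.n 638849027 .l (.n 1393033539 .l .l)))))))
  (.cons 1830289477 (.n 6681788549 (.n 1476698118 (.n 788554050 (.n 889197254 .l (.n 1410076800 .l .l)) .l) (.n 620761541 .l (.n 4951220229 .l (.n 3827052864 .l .l)))) (.n 9433583627 (.n 8394900105 (.n 1326186693 .l .l) (.n 3979346311 .l .l)) (.n 3724595975 (.n 922751238 .l .l) (.n 2298515972 .l (.n 7553753090 .l .l)))))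
  (.cons 1895845891 (.n 2518419018 (.n 3776710221 (.n 7000879115 .l (.n 5051516501 .l .l)) (.n 1597767693 (.n 6194512192 .l .l) (.n 740294670 .l .l))) (.n 4295000648 (.n 269221954 .l (.n 3422569867 .l (.n 6140507012 .l .l))) (.n 1325412481 (.n 2063610702 .l .l) (.n 6612897794 .l .l))))
  (.cons 1677734340 (.n 1962958912 (.n 2365608195 (.n 12583011728 .l .l) (.n 1846296581 .l .l)) (.n 9546350995 (.n 3794554895 .l .l) (.n 7405830928 .l (.n 1124860162 .l .l))))
  (.cons 2837185735 (.n 4147118793 .l (.n 1829503689 .l .l))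
  (.cons 1761628289 .l
  (.cons 436211778 .l .nil)))))))
  2231656452 0 2 false = true := by decide +kernel

theorem cert37 : chk 37 553914432 (.cons 6479152006 (.n 1326469124 (.n 1997807618 (.n 1694515912 (.n 3491782657 .l .l) (.n 2785089239 (.n 4061921674 .l .l) (.n 7704227845 .l .l))) (.n 9787933061 (.n 8125710360 .l .l) (.n 4060152454 .l (.n 687878273 .l .l)))) (.n 3338686914 (.n 1040449665 (.n 3120570753 (.n 3443523919 .l .l) .l) (.n 1783365698 .l (.n 9432728732 .l .l))) (.n 2083262469 (.n 2332045700 .l (.n 8204084693 .l .l)) (.n 2668626242 .l (.n 2231414983 .l .l)))))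
  (.cons 3039035780 (.n 8562671815 (.n 8813543936 (.n 201326786 .l (.n 553664579 .l .l)) (.n 5320476358 .l (.n 839131328 .l .l))) (.n 2214617540 (.n 1847078914 (.n 1611399431 .l .l) (.n 2955964420 (.n 889466944 .l .l) .l)) (.n 6056617863 .l (.n 14350929942 .l (.n 9365717005 .l .l)))))
  (.cons 3289384068 (.n 1593839939 (.n 1510498306 (.n 822358017 (.n 3171983367 .l .l) .l) (.n 4613739269 (.n 2132586496 .l .l) (.n 721428545 .l .l))) (.n 4535091783 (.n 5922379083 .l (.n 1108607042 .l .l)) (.n 789840001 (.n 603987969 .l .l) (.n 4378866636 .l .l))))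
  (.cons 5241832588 (.n 6850117645 (.n 8506151385 (.n 2133065859 .l .l) (.n 8391827460 .l .l)) (.n 7247839817 (.n 4699754505 .l (.n 2922119759 .l .l)) .l))
  (.cons 1460667397 (.n 6694694920 (.n 1965830154 .l .l) (.n 6610280843 .l .l))
  (.cons 1008468291 .l
  (.cons 1782841742 .l
  (.cons 1145569736 .l .nil))))))))
  2652913675 0 2 false = true := by decide +kernel

theorem cert38 : chk 38 553914432 (.cons 4129292997 (.n 8371840655 (.n 8539628745 (.n 7063286472 (.n 1241534531 (.n 1041256450 .l .l) (.n 3192737798 .l (.n 10274210968 .l .l))) (.n 1577066690 (.n 2354397193 .l (.n 168562689 .l .l)) (.n 1140891714 .l (.n 4833411598 .l .l)))) (.n 6747063179 (.n 1226317827 (.n 3611332611 (.n 2634080584 .l (.n 4013187200 .l .l)) .l) (.n 7183532932 .l .l)) (.n 7046517323 (.n 6559961615 .l .l) (.n 4294988484 (.n 8474854724 .l .l) .l)))) (.n 5456015368 (.n 1594630145 (.n 2652110979 (.n 1779187714 (.n 2316095493 .l .l) .l) .l) (.n 4397990149 (.n 3506496972 (.n 2717950920 .l .l) (.n 2030588544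 .l .l)) (.n 1291866562 .l .l))) (.n 1677766786 (.n 10334869257 (.n 2099511424 (.n 3238015625 .l .l) .l) (.n 6140479116 .l (.n 3036693381 .l .l))) (.n 5473083400 (.n 1711341770 (.n 2114716034 .l .l) .l) (.n 4263772609 (.n 4177548166 .l (.n 9619636563 .l .l)) .l)))))
  (.cons 2117075015 (.n 923533377 (.n 1745629186 (.n 3221283018 (.n 2132279553 .l .l) (.n 5603717648 .l .l)) (.n 721420738 (.n 2667614658 .l .l) (.n 1108082689 .l (.n 3707818506 .l .l)))) (.n 5002010628 (.n 10605658125 (.n 2566938883 .l (.n 12903895060 .l .l)) (.n 1509962178 .l (.n 587726913 .l .l))) (.n 889200769 (.n 5268103683 .l .l) (.n 2232180740 (.n 1427112134 .l .l) (.n 6643843929 .l .l)))))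
  (.cons 3122159620 (.n 5100314951 (.n 1644703745 (.n 2166894601 (.n 1733034574 .l .l) .l) (.n 2101084696 .l .l)) (.n 12051107853 .l (.n 1476658059 .l .l)))
  (.cons 2215903809 (.n 3278111046 (.n 1644167556 .l (.n 10905309847 .l .l)) (.n 6478184458 (.n 5655822400 .l .l) (.n 1899511821 .l .l)))
  (.cons 605290561 (.n 6145205120 .l .l)
  (.cons 9329790987 (.n 3057124548 .l .l)
  (.cons 5808115718 .l
  (.cons 3087016645 .l .nil))))))))
  0 0 2 false = true := by decide +kernel

theorem cert39 : chk 39 553914432 (.cons 5739906122 (.n 5626159113 (.n 8053188492 (.n 1409589312 (.n 8271230420 (.n 2249486340 .l .l) (.n 6778070216 .l (.n 3827597316 .l .l))) (.n 4835807237 (.n 822374404 (.n 570437699 .l .l) (.n 7432345168 .l .l)) (.n 3724628427 .l (.n 2181046661 .l .l)))) (.n 1846550531 (.n 1006637443 .l (.n 2466304966 .l (.n 1006653710 .l .l))) (.n 5502961295 (.n 905974018 .l .l) .l))) (.n 2871578635 (.n 1393295554 (.n 4580258181 (.n 2181042499 .l (.n 2885693894 (.n 5083505477 .l .l) .l)) (.n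 1561358339 .l (.n 2132541574 (.n 2232156421 .l .l) .l))) (.n 5284824006 (.n 1192755333 .l (.n 5270668101 .l .l)) (.n 7717585675 (.n 6358610628 .l .l) (.n 5385528002 .l (.n 8242176014 .l .l))))) (.n 2387902474 (.n 2097201348 (.n 5184229899 (.n 470814722 .l .l) .l) (.n 6694163335 (.n 2923442201 .l .l) (.n 4430762496 .l .l))) (.n 285487105 (.n 2097938690 .l (.n 4770349071 .l .l)) (.n 269230081 .l (.n 588279813 .l (.n 4381745600 .l .l)))))))
  (.cons 486547521 (.n 2518155911 (.n 4546651013 (.n 3107193289 (.n 1778401474 (.n 9047732244 .l .l) .l) (.n 1443381250 (.n 5325492234 .l (.n 14596277837 .l .l)) (.n 2064388480 .l .l))) (.n 5251342660 (.n 9563092432 (.n 3760746501 .l .l) (.n 1409548803 .l (.n 2753307008 .l .l))) (.n 5170552839 (.n 8729169927 .l (.n 3626238219 .l .l)) (.n 3240890370 (.n 8007753742 .l .l) (.n 4767137800 (.n 3992982678 .l .l) .l))))) (.n 554434626 (.n 9445668177 (.n 302252161 (.n 2937848841 (.n 4111495808 .l .l) (.n 11258918784 .l .l)) (.n 4955046927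 .l .l)) (.n 1224749378 .l (.n 4513124997 .l (.n 2735998359 .l .l)))) (.n 1979716678 (.n 453771394 (.n 738201729 (.n 6378541076 .l .l) (.n 487063744 (.n 11576386058 .l .l) .l)) (.n 3878684437 (.n 3188482058 .l .l) .l)) (.n 1395655171 (.n 3643559941 (.n 1613234628 .l .l) .l) (.n 3209183241 (.n 1174413315 .l .l) (.n 4026553803 .l .l))))))
  (.cons 754995330 (.n 3926918606 (.n 9602625549 (.n 1962955399 .l .l) .l) (.n 3925946766 (.n 12522152960 .l .l) (.n 10070602112 .l .l)))
  (.cons 771780741 (.n 251662465 .l (.n 1509995013 .l .l))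
  (.cons 1040204553 .l
  (.cons 2433745217 .l .nil))))))
  1140908358 0 2 false = true := by decide +kernel

theorem cert40 : chk 40 553914432 (.cons 956305601 (.n 7554846743 (.n 2132279620 (.n 9160447112 (.n 4583383047 (.n 2451833090 .l (.n 8227717147 .l .l)) (.n 4669833610 (.n 4029153795 .l .l) (.n 538705924 (.n 4798841408 .l .l) .l))) (.n 6832259784 (.n 419696642 .l .l) (.n 2382369219 .l (.n 2852450311 .l .l)))) (.n 10190430218 (.n 772800642 (.n 8272572434 .l .l) (.n 2550423556 (.n 4617437209 .l .l) (.n 3843302208 .l .l))) (.n 4666744841 (.n 8289361984 (.n 1845768384 .l .l) (.n 2585817091 .l .l)) (.n 2937848321 .l .l)))) (.n 2821996736 (.n 3405791745 (.n 3457679748 (.n 5368738502 (.n 1459622081 (.n 3142926338 .l .l) .l) (.n 6985613650 .l .l)) (.n 1209032707 (.n 9563067547 .l .l) .l)) (.n 907022337 (.n 9093379343 .l (.n 6951862277 .l (.n 352587778 .l .l))) (.n 6241174405 .l .l))) (.n 402927618 (.n 4798329283 (.n 6528172876 .l (.n 4181798920 .l .l)) (.n 1007177732 .l (.n 5653934790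 .l .l))) (.n 9898566792 (.n 1328087051 (.n 3137601864 .l .l) (.n 2147512520 .l .l)) (.n 772288576 .l .l)))))
  (.cons 3472941250 (.n 8513914453 (.n 2686976007 (.n 4466409735 (.n 3558605771 (.n 1728073864 .l .l) (.n 3677094084 (.n 4331667969 .l .l) .l)) (.n 1259078082 (.n 3793256451 .l .l) (.n 3996647685 .l .l))) (.n 5203599370 (.n 4147138563 (.n 15340007437 .l .l) (.n 10888509004 .l .l)) (.n 688652353 (.n 6716130061 (.n 4028403725 .l .l) (.n 3254817027 .l .l)) (.n 1711812800 .l .l)))) (.n 2954903558 (.n 989864002 (.n 1510223873 (.n 3019923650 (.n 11999986368 .l .l) .l) .l) (.n 4718604301 (.n 6477890368 .l .l) (.n 487063681 .l .l))) (.n 905977856 (.n 1713636232 (.n 3338686915 .l (.n 6443286538 .l .l)) (.n 3406323715 (.n 3456655424 (.n 1427899990 .l .l) .l) .l)) (.n 4903929033 (.n 3910959108 .l .l) (.n 3204465352 (.n 857211011 .l (.n 3044278546 .l .l)) .l)))))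
  (.cons 2064916484 (.n 822100225 (.n 9081253893 (.n 4497907721 (.n 3422582288 .l (.n 2719485955 .l .l)) (.n 6932660935 .l (.n 10037757647 .l .l))) (.n 12470977995 (.n 738201794 .l (.n 4482158656 .l .l)) (.n 2635072066 (.n 1895842246 .l (.n 4984439616 .l .l)) (.n 2197844357 .l .l)))) (.n 7352090887 (.n 503325059 (.n 1208222146 (.n 11179159568 .l .l) (.n 4665901579 .l .l)) (.n 2903769284 (.n 5454983172 (.n 1493696903 .l .l) .l) .l)) (.n 14048686090 (.n 4162847236 .l (.n 923021440 .l .l)) (.n 3726401539 .l (.n 10373685254 .l .l)))))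
  (.cons 6848250633 (.n 939548804 (.n 3475275781 .l .l) (.n 3003134601 .l .l))
  (.cons 3053780998 (.n 1611923522 .l (.n 5389943233 .l .l))
  (.cons 5237682181 .l
  (.cons 1308639426 .l
  (.cons 2702987267 .l .nil))))))))
  0 0 3 false = true := by decide +kernel

end NS

/-! ### Part 11: the chain of degrees -/

namespace NS

lemma two_le_slen {a b : ℕ} {t t' : CTree} {s : Spine} : 2 ≤ slen (.cons a t (.cons b t' s)) := by
  unfold slen
  unfold slen
  omega

theorem fin14 : Fin' 14 ∧ (true = true → Base 14) :=
  direct cert14 (by norm_num) (by norm_num) (by norm_num) (by norm_num) two_le_slen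

theorem fin15 : Fin' 15 ∧ (false = true → Base 15) :=
  direct cert15 (by norm_num) (by norm_num) (by norm_num) (by norm_num) two_le_slen

theorem fin16 : Fin' 16 ∧ (false = true → Base 16) :=
  direct cert16 (by norm_num) (by norm_num) (by norm_num) (by norm_num) two_le_slen

theorem fin17 : Fin' 17 ∧ (true = true → Base 17) :=
  direct cert17 (by norm_num) (by norm_num) (by norm_num) (by norm_num) two_le_slen

theorem fin18 : Fin' 18 ∧ (false = true → Base 18) :=
  slab (e := 14) cert18 (fin14.2 rfl) (by norm_num) (by norm_num) (by norm_num) (by norm_num)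
  (by norm_num)

theorem fin19 : Fin' 19 ∧ (true = true → Base 19) :=
  slab (e := 14) cert19 (fin14.2 rfl) (by norm_num) (by norm_num) (by norm_num) (by norm_num)
  (by norm_num)

theorem fin20 : Fin' 20 ∧ (false = true → Base 20) :=
  slab (e := 14) cert20 (fin14.2 rfl) (by norm_num) (by norm_num) (by norm_num) (by norm_num)
  (by norm_num)

theorem fin21 : Fin' 21 ∧ (false = true → Base 21) :=
  slab (e := 17) cert21 (fin17.2 rfl) (by norm_num) (by norm_num) (by norm_num) (by norm_num)
  (by norm_num)

theorem fin22 : Fin' 22 ∧ (true = true → Base 22) :=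
  slab (e := 14) cert22 (fin14.2 rfl) (by norm_num) (by norm_num) (by norm_num) (by norm_num)
  (by norm_num)

theorem fin23 : Fin' 23 ∧ (true = true → Base 23) :=
  slab (e := 19) cert23 (fin19.2 rfl) (by norm_num) (by norm_num) (by norm_num) (by norm_num)
  (by norm_num)

theorem fin24 : Fin' 24 ∧ (false = true → Base 24) :=
  slab (e := 19) cert24 (fin19.2 rfl) (by norm_num) (by norm_num) (by norm_num) (by norm_num)
  (by norm_num)

theorem fin25 : Fin' 25 ∧ (false = true → Base 25) :=
  slab (e := 19) cert25 (fin19.2 rfl) (by norm_num) (by norm_num) (by norm_num) (by norm_num)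
  (by norm_num)

theorem fin26 : Fin' 26 ∧ (false = true → Base 26) :=
  slab (e := 22) cert26 (fin22.2 rfl) (by norm_num) (by norm_num) (by norm_num) (by norm_num)
  (by norm_num)

theorem fin27 : Fin' 27 ∧ (true = true → Base 27) :=
  slab (e := 23) cert27 (fin23.2 rfl) (by norm_num) (by norm_num) (by norm_num) (by norm_num)
  (by norm_num)

theorem fin28 : Fin' 28 ∧ (false = true → Base 28) :=
  slab (e := 23) cert28 (fin23.2 rfl) (by norm_num) (by norm_num) (by norm_num) (by norm_num)
  (by norm_num)

theorem fin29 : Fin' 29 ∧ (true = true → Base 29) :=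
  slab (e := 23) cert29 (fin23.2 rfl) (by norm_num) (by norm_num) (by norm_num) (by norm_num)
  (by norm_num)

theorem fin30 : Fin' 30 ∧ (false = true → Base 30) :=
  slab (e := 23) cert30 (fin23.2 rfl) (by norm_num) (by norm_num) (by norm_num) (by norm_num)
  (by norm_num)

theorem fin31 : Fin' 31 ∧ (false = true → Base 31) :=
  slab (e := 27) cert31 (fin27.2 rfl) (by norm_num) (by norm_num) (by norm_num) (by norm_num)
  (by norm_num)

theorem fin32 : Fin' 32 ∧ (false = true → Base 32) :=
  slab (e := 27) cert32 (fin27.2 rfl) (by norm_num) (by norm_num) (by norm_num) (by norm_num)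
  (by norm_num)

theorem fin33 : Fin' 33 ∧ (true = true → Base 33) :=
  slab (e := 29) cert33 (fin29.2 rfl) (by norm_num) (by norm_num) (by norm_num) (by norm_num)
  (by norm_num)

theorem fin34 : Fin' 34 ∧ (false = true → Base 34) :=
  slab (e := 29) cert34 (fin29.2 rfl) (by norm_num) (by norm_num) (by norm_num) (by norm_num)
  (by norm_num)

theorem fin35 : Fin' 35 ∧ (false = true → Base 35) :=
  slab (e := 29) cert35 (fin29.2 rfl) (by norm_num) (by norm_num) (by norm_num) (by norm_num)
  (by norm_num)

theorem fin36 : Fin' 36 ∧ (false = true → Base 36) :=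
  slab (e := 29) cert36 (fin29.2 rfl) (by norm_num) (by norm_num) (by norm_num) (by norm_num)
  (by norm_num)

theorem fin37 : Fin' 37 ∧ (false = true → Base 37) :=
  slab (e := 33) cert37 (fin33.2 rfl) (by norm_num) (by norm_num) (by norm_num) (by norm_num)
  (by norm_num)

theorem fin38 : Fin' 38 ∧ (false = true → Base 38) :=
  slab (e := 33) cert38 (fin33.2 rfl) (by norm_num) (by norm_num) (by norm_num) (by norm_num)
  (by norm_num)

theorem fin39 : Fin' 39 ∧ (false = true → Base 39) :=
  slab (e := 33) cert39 (fin33.2 rfl) (by norm_num) (by norm_num) (by norm_num) (by norm_num)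
  (by norm_num)

theorem fin40 : Fin' 40 ∧ (false = true → Base 40) :=
  slab (e := 33) cert40 (fin33.2 rfl) (by norm_num) (by norm_num) (by norm_num) (by norm_num)
  (by norm_num)

theorem fin_all (d : ℕ) (h1 : 14 ≤ d) (h2 : d ≤ 40) : Fin' d := by
  interval_cases d
  · exact fin14.1
  · exact fin15.1
  · exact fin16.1
  · exact fin17.1
  · exact fin18.1
  · exact fin19.1
  · exact fin20.1
  · exact fin21.1
  · exact fin22.1
  · exact fin23.1
  · exact fin24.1
  · exact fin25.1
  · exact fin26.1
  · exact fin27.1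
  · exact fin28.1
  · exact fin29.1
  · exact fin30.1
  · exact fin31.1
  · exact fin32.1
  · exact fin33.1
  · exact fin34.1
  · exact fin35.1
  · exact fin36.1
  · exact fin37.1
  · exact fin38.1
  · exact fin39.1
  · exact fin40.1

end NS

/-- `L_3(d; 4^{×x}, 3^{×y}, 2^{×z})` is non-special for `14 ≤ d ≤ 40`. -/
theorem nonSpecial_of_le_forty (d x y z : ℕ) (hd1 : 14 ≤ d) (hd2 : d ≤ 40) :
    nonSpecial d (List.replicate x 4 ++ List.replicate y 3 ++ List.replicate z 2) := by
  exact NS.nonSpecial_of_fin (NS.fin_all d hd1 hd2 x y z)
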